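/- Let d ≥ 1, α ∈ (0,1) and λ > 0, and let a^{ij}, b^i, c, S : ℝ × ℝ^d × ℝ^d → ℝ have finite norms ‖·‖_{C_ℓ^α} := ‖·‖_{L^∞} + [·]_{C_ℓ^α}, with Σ_{i,j} a^{ij}(z) ξ_i ξ_j ≥ λ|ξ|² for all z and all ξ ∈ ℝ^d. Then there exists C, depending only on d, λ, α and upper bounds for ‖a^{ij}‖_{C_ℓ^α}, ‖b^i‖_{C_ℓ^α}, ‖c‖_{C_ℓ^α}, such that every g : ℝ × ℝ^d × ℝ^d → ℝ which is C¹ in (t,x), C² in v, satisfies (∂_t + v·∇_x) g = Σ_{i,j} a^{ij} ∂²_{v_i v_j} g + Σ_i b^i ∂_{v_i} g + c g + S at every point, and has [g]_{C_ℓ^{2+α}} < ∞, obeys for every z₀ ∈ ℝ × ℝ^d × ℝ^d: ‖g‖_{L^∞(Q₁(z₀))} + [g]_{C_ℓ^{2+α}(Q₁(z₀))} ≤ C ([S]_{C_ℓ^α(Q₂(z₀))} + ‖g‖_{L^∞(Q₂(z₀))}). -/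

import Mathlib

open Real MeasureTheory
open scoped BigOperators ENNReal

noncomputable section

abbrev E (d : ℕ) := EuclideanSpace ℝ (Fin d)
abbrev Z (d : ℕ) := ℝ × E d × E d

variable {d : ℕ}

/-- The kinetic cylinder `Q_r(z₀)`. -/
def kCyl (r : ℝ) (z₀ : Z d) : Set (Z d) :=
  {z | z₀.1 - r ^ 2 < z.1 ∧ z.1 ≤ z₀.1 ∧
    ‖z.2.1 - z₀.2.1 - (z.1 - z₀.1) • z₀.2.2‖ < r ^ 3 ∧ ‖z.2.2 - z₀.2.2‖ < r}

/-- Partial derivative in time. -/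
def pt (g : Z d → ℝ) (z : Z d) : ℝ := deriv (fun s => g (s, z.2.1, z.2.2)) z.1

/-- Partial derivative in the direction `x i`. -/
def px (g : Z d → ℝ) (i : Fin d) (z : Z d) : ℝ :=
  deriv (fun s : ℝ => g (z.1, z.2.1 + s • EuclideanSpace.single i (1 : ℝ), z.2.2)) 0

/-- Partial derivative in the direction `v i`. -/
def pv (g : Z d → ℝ) (i : Fin d) (z : Z d) : ℝ :=
  deriv (fun s : ℝ => g (z.1, z.2.1, z.2.2 + s • EuclideanSpace.single i (1 : ℝ))) 0

/-- Second partial derivative in `v i`, `v j`. -/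
def pvv (g : Z d → ℝ) (i j : Fin d) : Z d → ℝ := pv (pv g j) i

/-- Transport derivative `∂_t g + v ⋅ ∇_x g`. -/
def Yop (g : Z d → ℝ) (z : Z d) : ℝ := pt g z + ∑ i, z.2.2 i * px g i z

/-- Euclidean norm of the velocity gradient `∇_v g`. -/
def gradvNorm (g : Z d → ℝ) (z : Z d) : ℝ := Real.sqrt (∑ i, (pv g i z) ^ 2)

/-- (Frobenius) norm of the velocity Hessian `D²_v g`. -/
def hessvNorm (g : Z d → ℝ) (z : Z d) : ℝ := Real.sqrt (∑ i, ∑ j, (pvv g i j z) ^ 2)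

/-- `g` is `C¹` in `(t,x)` and `C²` in `v` on `Q`, with continuous partial derivatives. -/
structure KinReg (g : Z d → ℝ) (Q : Set (Z d)) : Prop where
  cont : ContinuousOn g Q
  dt : ∀ z ∈ Q, DifferentiableAt ℝ (fun s => g (s, z.2.1, z.2.2)) z.1
  dx : ∀ z ∈ Q, ∀ i, DifferentiableAt ℝ
    (fun s : ℝ => g (z.1, z.2.1 + s • EuclideanSpace.single i (1 : ℝ), z.2.2)) 0
  dv : ∀ z ∈ Q, ∀ i, DifferentiableAt ℝ
    (fun s : ℝ => g (z.1, z.2.1, z.2.2 + s • EuclideanSpace.single i (1 : ℝ))) 0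
  dvv : ∀ z ∈ Q, ∀ i j, DifferentiableAt ℝ
    (fun s : ℝ => pv g j (z.1, z.2.1, z.2.2 + s • EuclideanSpace.single i (1 : ℝ))) 0
  ptc : ContinuousOn (pt g) Q
  pxc : ∀ i, ContinuousOn (px g i) Q
  pvc : ∀ i, ContinuousOn (pv g i) Q
  pvvc : ∀ i j, ContinuousOn (pvv g i j) Q

/-- Sup norm (in `ℝ≥0∞`) of `h` over the set `Q`. -/
def supAbs (Q : Set (Z d)) (h : Z d → ℝ) : ℝ≥0∞ := ⨆ z ∈ Q, ENNReal.ofReal |h z|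

/-- Kinetic Hölder seminorm of exponent `β` on `Q`. -/
def kHolder (β : ℝ) (Q : Set (Z d)) (h : Z d → ℝ) : ℝ≥0∞ :=
  ⨆ (z₀ ∈ Q) (r : ℝ) (_ : 0 < r) (_ : kCyl r z₀ ⊆ Q) (z ∈ kCyl r z₀),
    ENNReal.ofReal (|h z - h z₀| / r ^ β)

/-- Polynomial of kinetic degree at most 2. -/
def kpoly (a b : ℝ) (q : Fin d → ℝ) (M : Matrix (Fin d) (Fin d) ℝ) (z : Z d) : ℝ :=
  a + b * z.1 + ∑ i, q i * z.2.2 i + (1 / 2) * ∑ i, ∑ j, M i j * z.2.2 i * z.2.2 j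

/-- Kinetic Hölder seminorm of order `2 + α` on `Q`, by approximation with polynomials of
kinetic degree at most 2. -/
def kSemi2 (α : ℝ) (Q : Set (Z d)) (g : Z d → ℝ) : ℝ≥0∞ :=
  ⨆ (z₀ ∈ Q) (r : ℝ) (_ : 0 < r) (_ : kCyl r z₀ ⊆ Q),
    (⨅ (a : ℝ) (b : ℝ) (q : Fin d → ℝ) (M : Matrix (Fin d) (Fin d) ℝ),
      ⨆ z ∈ kCyl r z₀, ENNReal.ofReal |g z - kpoly a b q M z|)
      / ENNReal.ofReal (r ^ (2 + α))

namespace KS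
open Filter Topology Set

abbrev ee (i : Fin d) : E d := EuclideanSpace.single i (1 : ℝ)

/-- Kinetic `C^{1,2}` data. -/
structure KD (u Yu : Z d → ℝ) (ui : Fin d → Z d → ℝ) (uij : Fin d → Fin d → Z d → ℝ) : Prop where
  hY : ∀ (t : ℝ) (x v : E d), HasDerivAt (fun s : ℝ => u (t + s, x + s • v, v)) (Yu (t, x, v)) 0
  hv : ∀ i (t : ℝ) (x v : E d), HasDerivAt (fun s : ℝ => u (t, x, v + s • ee i)) (ui i (t, x, v)) 0
  hvv : ∀ i j (t : ℝ) (x v : E d),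
    HasDerivAt (fun s : ℝ => ui j (t, x, v + s • ee i)) (uij i j (t, x, v)) 0
  cu : Continuous u
  cY : Continuous Yu
  cv : ∀ i, Continuous (ui i)
  cvv : ∀ i j, Continuous (uij i j)

lemma shift_deriv {f : ℝ → ℝ} {a b : ℝ} (h : HasDerivAt (fun s => f (a + s)) b 0) :
    HasDerivAt f b a := by
  have h1 : HasDerivAt (fun s => f (a + s)) b (a - a) := by simpa using h
  have := h1.comp_sub_const a a
  simpa using this

lemma diag_deriv {F F' : ℝ → ℝ → ℝ} {a : ℝ}
    (h1 : ∀ s h, HasDerivAt (F s) (F' s h) h)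
    (h2 : Continuous (Function.uncurry F'))
    (h3 : HasDerivAt (fun s => F s 0) a 0) :
    HasDerivAt (fun s => F s s) (a + F' 0 0) 0 := by
  have h4 : HasDerivAt (fun s => F s s - F s 0) (F' 0 0) 0 := by
    rw [hasDerivAt_iff_isLittleO_nhds_zero]
    rw [Asymptotics.isLittleO_iff]
    intro c hc
    have hcont := h2.tendsto (0, 0)
    have := Metric.tendsto_nhds.1 hcont c hc
    obtain ⟨δ, hδ, hδ'⟩ := Metric.eventually_nhds_iff.1 this
    filter_upwards [Metric.ball_mem_nhds (0:ℝ) hδ] with s hs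
    simp only [zero_add, sub_self, sub_zero]
    have key := Convex.norm_image_sub_le_of_norm_hasDerivWithin_le (f := fun h => F s h - h * F' 0 0)
      (f' := fun h => F' s h - F' 0 0) (C := c) (s := uIcc 0 s) (x := 0) (y := s)
      (fun h hh => (((h1 s h).sub (by simpa using (hasDerivAt_id h).mul_const (F' 0 0)))).hasDerivWithinAt)
      (fun h hh => by
        have : dist (s, h) ((0:ℝ), (0:ℝ)) < δ := by
          rw [Prod.dist_eq, max_lt_iff]
          refine ⟨by simpa using hs, ?_⟩
          have h5 : |h| ≤ |s| := by
            have := abs_sub_left_of_mem_uIcc hh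
            simpa using this
          have h6 : |s| < δ := by simpa using hs
          simpa using lt_of_le_of_lt h5 h6
        have := hδ' this
        rw [dist_eq_norm] at this
        exact this.le)
      (convex_uIcc 0 s) left_mem_uIcc right_mem_uIcc
    simp only [zero_mul, sub_zero, smul_eq_mul] at key ⊢
    convert key using 2
    ring
  have := h3.add h4
  refine this.congr_of_eventuallyEq ?_
  filter_upwards with s
  simp

lemma KinReg.toKD {g : Z d → ℝ} (h : KinReg g Set.univ) : KD g (Yop g) (pv g) (pvv g) := by
  have hg := continuousOn_univ.1 h.cont
  have hpt := continuousOn_univ.1 h.ptc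
  have hpx := fun i => continuousOn_univ.1 (h.pxc i)
  refine ⟨?_, ?_, ?_, hg, ?_, fun i => continuousOn_univ.1 (h.pvc i),
    fun i j => continuousOn_univ.1 (h.pvvc i j)⟩
  · intro t x v
    have main : ∀ I : Finset (Fin d), HasDerivAt (fun s : ℝ => g (t + s, x + s • ∑ i ∈ I, v i • ee i, v))
        (pt g (t, x, v) + ∑ i ∈ I, v i * px g i (t, x, v)) 0 := by
      intro I
      induction I using Finset.induction_on with
      | empty =>
        simp only [Finset.sum_empty, smul_zero, add_zero]
        have h1 : HasDerivAt (fun s => g (s, x, v)) (pt g (t, x, v)) t :=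
          (h.dt (t, x, v) trivial).hasDerivAt
        have h2 : HasDerivAt (fun s => g (s, x, v)) (pt g (t, x, v)) (t + 0) := by simpa using h1
        exact h2.comp_const_add t 0
      | insert k I hk ih =>
        have := diag_deriv (F := fun s r => g (t + s, x + s • ∑ i ∈ I, v i • ee i + r • v k • ee k, v))
          (F' := fun s r => v k * px g k (t + s, x + s • ∑ i ∈ I, v i • ee i + r • v k • ee k, v))
          (a := pt g (t, x, v) + ∑ i ∈ I, v i * px g i (t, x, v)) ?_ ?_ ?_
        · simp only [zero_smul, add_zero] at this
          convert this using 1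
          · funext s
            rw [Finset.sum_insert hk, smul_add, add_assoc, add_comm (s • v k • ee k)]
          · rw [Finset.sum_insert hk]; ring
        · intro s r
          apply shift_deriv
          have h1 := (h.dx (t + s, x + s • ∑ i ∈ I, v i • ee i + r • v k • ee k, v) trivial k).hasDerivAt
          have h1' : HasDerivAt (fun s' : ℝ => g (t + s, x + s • ∑ i ∈ I, v i • ee i + r • v k • ee k
            + s' • ee k, v)) (px g k (t + s, x + s • ∑ i ∈ I, v i • ee i + r • v k • ee k, v))
            (v k * 0) := by simpa [px] using h1
          have h2 := h1'.comp (0:ℝ) ((hasDerivAt_id (0:ℝ)).const_mul (v k))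
          rw [mul_one, mul_comm] at h2
          refine h2.congr_of_eventuallyEq ?_
          filter_upwards with q
          simp only [Function.comp]
          congr 3
          rw [add_smul, ← add_assoc, smul_smul q, mul_comm q]
        · simp only [Function.uncurry_def]
          refine continuous_const.mul ((hpx k).comp ?_)
          fun_prop
        · simpa using ih
    have := main Finset.univ
    have hvs : ∑ i, v i • ee i = v := by
      have := (EuclideanSpace.basisFun (Fin d) ℝ).sum_repr v
      simpa using this
    rw [hvs] at this
    simpa [Yop] using this
  · intro i t x v
    exact (h.dv (t, x, v) trivial i).hasDerivAt
  · intro i j t x v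
    exact (h.dvv (t, x, v) trivial i j).hasDerivAt
  · unfold Yop
    refine hpt.add (continuous_finsetSum _ fun i _ => Continuous.mul ?_ (hpx i))
    fun_prop

variable {u Yu : Z d → ℝ} {ui : Fin d → Z d → ℝ} {uij : Fin d → Fin d → Z d → ℝ}

lemma KD.hv' (h : KD u Yu ui uij) (i) (t : ℝ) (x v : E d) (s : ℝ) :
    HasDerivAt (fun s : ℝ => u (t, x, v + s • ee i)) (ui i (t, x, v + s • ee i)) s := by
  apply shift_deriv
  have := h.hv i t x (v + s • ee i)
  simpa [add_smul, add_assoc] using this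

lemma KD.hvv' (h : KD u Yu ui uij) (i j) (t : ℝ) (x v : E d) (s : ℝ) :
    HasDerivAt (fun s : ℝ => ui j (t, x, v + s • ee i)) (uij i j (t, x, v + s • ee i)) s := by
  apply shift_deriv
  have := h.hvv i j t x (v + s • ee i)
  simpa [add_smul, add_assoc] using this

lemma KD.hY' (h : KD u Yu ui uij) (t : ℝ) (x v : E d) (s : ℝ) :
    HasDerivAt (fun s : ℝ => u (t + s, x + s • v, v)) (Yu (t + s, x + s • v, v)) s := by
  apply shift_deriv
  have := h.hY (t + s) (x + s • v) v
  simpa [add_smul, add_assoc] using this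

/-- mixed second difference -/
def mdiff (u : Z d → ℝ) (i j : Fin d) (h : ℝ) (z : Z d) : ℝ :=
  u (z.1, z.2.1, z.2.2 + h • ee i + h • ee j) - u (z.1, z.2.1, z.2.2 + h • ee i)
    - u (z.1, z.2.1, z.2.2 + h • ee j) + u z

lemma KD.mixed_eq (hu : KD u Yu ui uij) (i j : Fin d) {h : ℝ} (hh : 0 < h) (z : Z d) :
    ∃ p ∈ Ioo 0 h, ∃ q ∈ Ioo 0 h, mdiff u i j h z =
      h ^ 2 * uij i j (z.1, z.2.1, z.2.2 + p • ee i + q • ee j) := by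
  obtain ⟨t, x, v⟩ := z
  -- φ(q) = u(v + h e_i + q e_j) - u(v + q e_j)
  obtain ⟨q, hq, hq'⟩ := exists_hasDerivAt_eq_slope
    (fun q : ℝ => u (t, x, v + h • ee i + q • ee j) - u (t, x, v + q • ee j))
    (fun q : ℝ => ui j (t, x, v + h • ee i + q • ee j) - ui j (t, x, v + q • ee j)) hh
    (HasDerivAt.continuousOn fun q _ => (hu.hv' j t x (v + h • ee i) q).sub (hu.hv' j t x v q))
    (fun q _ => (hu.hv' j t x (v + h • ee i) q).sub (hu.hv' j t x v q))
  obtain ⟨p, hp, hp'⟩ := exists_hasDerivAt_eq_slope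
    (fun p : ℝ => ui j (t, x, (v + q • ee j) + p • ee i))
    (fun p : ℝ => uij i j (t, x, (v + q • ee j) + p • ee i)) hh
    (HasDerivAt.continuousOn fun p _ => hu.hvv' i j t x (v + q • ee j) p)
    (fun p _ => hu.hvv' i j t x (v + q • ee j) p)
  refine ⟨p, hp, q, hq, ?_⟩
  simp only [sub_zero, zero_smul, add_zero] at hp' hq'
  have e1 : v + p • ee i + q • ee j = v + q • ee j + p • ee i := by abel
  have e2 : v + h • ee i + q • ee j = v + q • ee j + h • ee i := by abel
  simp only [mdiff]
  rw [e1, hp']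
  rw [e2] at hq'
  rw [hq']
  field_simp
  ring

lemma KD.mixed_tendsto (hu : KD u Yu ui uij) (i j : Fin d) (z : Z d) :
    Tendsto (fun h : ℝ => mdiff u i j h z / h ^ 2) (𝓝[>] 0) (𝓝 (uij i j z)) := by
  have hc : Continuous (fun pq : ℝ × ℝ => uij i j (z.1, z.2.1, z.2.2 + pq.1 • ee i + pq.2 • ee j)) := by
    refine (hu.cvv i j).comp ?_
    fun_prop
  have h0 := hc.tendsto (0, 0)
  simp only [zero_smul, add_zero] at h0
  rw [Metric.tendsto_nhds] at h0 ⊢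
  intro ε hε
  obtain ⟨δ, hδ, hδ'⟩ := Metric.eventually_nhds_iff.1 (h0 ε hε)
  filter_upwards [Ioo_mem_nhdsGT hδ] with h hh
  obtain ⟨p, hp, q, hq, he⟩ := hu.mixed_eq i j hh.1 z
  rw [he, mul_div_cancel_left₀ _ (by have := hh.1; positivity)]
  apply hδ' (y := (p, q))
  rw [Prod.dist_eq, max_lt_iff]
  simp only [dist_zero_right, Real.norm_eq_abs, abs_of_pos hp.1, abs_of_pos hq.1]
  exact ⟨hp.2.trans hh.2, hq.2.trans hh.2⟩

lemma KD.symm (hu : KD u Yu ui uij) (i j : Fin d) (z : Z d) : uij i j z = uij j i z := by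
  refine tendsto_nhds_unique (hu.mixed_tendsto i j z) ((hu.mixed_tendsto j i z).congr ?_)
  intro h
  simp only [mdiff]
  have e1 : z.2.2 + h • ee i + h • ee j = z.2.2 + h • ee j + h • ee i := by abel
  rw [e1]; ring

lemma KD.v_tendsto (hu : KD u Yu ui uij) (i : Fin d) (z : Z d) :
    Tendsto (fun h : ℝ => (u (z.1, z.2.1, z.2.2 + h • ee i) - u z) / h) (𝓝[>] 0) (𝓝 (ui i z)) := by
  have := (hasDerivAt_iff_tendsto_slope.1 (hu.hv i z.1 z.2.1 z.2.2)).mono_left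
    (nhdsWithin_mono 0 (fun h (hh : 0 < h) => hh.ne'))
  refine this.congr fun h => ?_
  simp [slope_def_field]

lemma KD.Y_tendsto (hu : KD u Yu ui uij) (z : Z d) :
    Tendsto (fun h : ℝ => (u z - u (z.1 - h ^ 2, z.2.1 - h ^ 2 • z.2.2, z.2.2)) / h ^ 2)
      (𝓝[>] 0) (𝓝 (Yu z)) := by
  have h1 := (hasDerivAt_iff_tendsto_slope.1 (hu.hY z.1 z.2.1 z.2.2))
  have h2 : Tendsto (fun h : ℝ => - h ^ 2) (𝓝[>] 0) (𝓝[≠] 0) := by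
    refine tendsto_nhdsWithin_iff.2 ⟨?_, ?_⟩
    · have : Tendsto (fun h : ℝ => - h ^ 2) (𝓝 0) (𝓝 (- 0 ^ 2)) :=
        (by fun_prop : Continuous (fun h : ℝ => - h ^ 2)).tendsto 0
      simp only [ne_eq, OfNat.ofNat_ne_zero, not_false_eq_true, zero_pow, neg_zero] at this
      exact this.mono_left nhdsWithin_le_nhds
    · filter_upwards [self_mem_nhdsWithin] with h hh
      have : (0:ℝ) < h := hh
      have : 0 < h ^ 2 := by positivity
      simp; exact hh.ne'
  refine (h1.comp h2).congr fun h => ?_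
  simp [slope_def_field, Function.comp, sub_eq_add_neg]
  rw [div_neg, ← neg_div]; ring_nf

end KS

namespace KS
open Filter Topology Set

def qf (m : Fin d → Fin d → ℝ) (V W : Fin d → ℝ) : ℝ := ∑ i, ∑ j, m i j * V i * W j

def tay (c b : ℝ) (q : Fin d → ℝ) (m : Fin d → Fin d → ℝ) (z₁ z : Z d) : ℝ :=
  c + b * (z.1 - z₁.1) + ∑ i, q i * (z.2.2 i - z₁.2.2 i) +
    (1 / 2) * ∑ i, ∑ j, m i j * (z.2.2 i - z₁.2.2 i) * (z.2.2 j - z₁.2.2 j)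

lemma qf_add_left (m : Fin d → Fin d → ℝ) (V W X : Fin d → ℝ) :
    qf m (V + W) X = qf m V X + qf m W X := by
  simp only [qf, Pi.add_apply, ← Finset.sum_add_distrib]
  refine Finset.sum_congr rfl fun i _ => Finset.sum_congr rfl fun j _ => by ring

lemma qf_add_right (m : Fin d → Fin d → ℝ) (V W X : Fin d → ℝ) :
    qf m V (W + X) = qf m V W + qf m V X := by
  simp only [qf, Pi.add_apply, ← Finset.sum_add_distrib]
  refine Finset.sum_congr rfl fun i _ => Finset.sum_congr rfl fun j _ => by ring

lemma qf_comm {m : Fin d → Fin d → ℝ} (hm : ∀ i j, m i j = m j i) (V W : Fin d → ℝ) :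
    qf m V W = qf m W V := by
  simp only [qf]
  rw [Finset.sum_comm]
  refine Finset.sum_congr rfl fun i _ => Finset.sum_congr rfl fun j _ => by rw [hm]; ring

lemma qf_single (m : Fin d → Fin d → ℝ) (i : Fin d) (h : ℝ) (W : Fin d → ℝ) :
    qf m (Pi.single i h) W = h * ∑ j, m i j * W j := by
  simp only [qf]
  rw [Finset.sum_eq_single i]
  · rw [Finset.mul_sum]; refine Finset.sum_congr rfl fun j _ => by simp; ring
  · intro b _ hb; simp [Pi.single_eq_of_ne hb]
  · simp

lemma lin_add (q V W : Fin d → ℝ) : ∑ i, q i * (V + W) i = ∑ i, q i * V i + ∑ i, q i * W i := by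
  simp only [Pi.add_apply, mul_add, Finset.sum_add_distrib]

lemma lin_single (q : Fin d → ℝ) (i : Fin d) (h : ℝ) :
    ∑ j, q j * (Pi.single i h : Fin d → ℝ) j = h * q i := by
  rw [Finset.sum_eq_single i]
  · simp [mul_comm]
  · intro b _ hb; simp [Pi.single_eq_of_ne hb]
  · simp

lemma tay_eq (c b : ℝ) (q : Fin d → ℝ) (m : Fin d → Fin d → ℝ) (z₁ z : Z d) (V : Fin d → ℝ)
    (hV : ∀ i, z.2.2 i - z₁.2.2 i = V i) :
    tay c b q m z₁ z = c + b * (z.1 - z₁.1) + ∑ i, q i * V i + (1/2) * qf m V V := by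
  simp only [tay, hV, qf]

lemma tay_sub (c b : ℝ) (q : Fin d → ℝ) (m : Fin d → Fin d → ℝ) (c' b' : ℝ) (q' : Fin d → ℝ)
    (m' : Fin d → Fin d → ℝ) (z₁ z : Z d) :
    tay c b q m z₁ z - tay c' b' q' m' z₁ z =
      tay (c - c') (b - b') (fun i => q i - q' i) (fun i j => m i j - m' i j) z₁ z := by
  simp only [tay, sub_mul, Finset.sum_sub_distrib]
  ring

/-- symmetric difference -/
def sdiff (u : Z d → ℝ) (i : Fin d) (h : ℝ) (z : Z d) : ℝ :=
  u (z.1, z.2.1, z.2.2 + h • ee i) - u (z.1, z.2.1, z.2.2 + (-h) • ee i)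

/-- time difference -/
def tdiff (u : Z d → ℝ) (h : ℝ) (z : Z d) : ℝ :=
  u z - u (z.1 - h ^ 2, z.2.1 - h ^ 2 • z.2.2, z.2.2)

lemma smul_ee_apply (h : ℝ) (i k : Fin d) : (h • ee i) k = (Pi.single i h : Fin d → ℝ) k := by
  by_cases hk : k = i
  · subst hk; simp
  · simp [hk]

lemma sdiff_tay (c b : ℝ) (q : Fin d → ℝ) {m : Fin d → Fin d → ℝ} (hm : ∀ i j, m i j = m j i)
    (z₁ z : Z d) (i : Fin d) (h : ℝ) :
    sdiff (tay c b q m z₁) i h z = 2 * h * (q i + ∑ j, m i j * (z.2.2 j - z₁.2.2 j)) := by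
  simp only [sdiff]
  set V : Fin d → ℝ := fun k => z.2.2 k - z₁.2.2 k with hV
  rw [tay_eq c b q m z₁ _ (V + Pi.single i h) (fun k => by
    simp only [PiLp.add_apply, Pi.add_apply, smul_ee_apply, hV]; ring),
    tay_eq c b q m z₁ _ (V + Pi.single i (-h)) (fun k => by
    simp only [PiLp.add_apply, Pi.add_apply, smul_ee_apply, hV]; ring)]
  simp only [lin_add, lin_single, qf_add_left, qf_add_right, qf_single]
  rw [qf_comm hm V (Pi.single i h), qf_comm hm V (Pi.single i (-h))]
  have : ∀ (h : ℝ), ∑ j, m i j * (Pi.single i h : Fin d → ℝ) j = h * m i i := fun h => lin_single _ _ _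
  simp only [qf_single, hV]
  ring

lemma mdiff_tay (c b : ℝ) (q : Fin d → ℝ) {m : Fin d → Fin d → ℝ} (hm : ∀ i j, m i j = m j i)
    (z₁ z : Z d) (i j : Fin d) (h : ℝ) :
    mdiff (tay c b q m z₁) i j h z = h ^ 2 * m i j := by
  simp only [mdiff]
  set V : Fin d → ℝ := fun k => z.2.2 k - z₁.2.2 k with hV
  rw [tay_eq c b q m z₁ _ (V + Pi.single i h + Pi.single j h) (fun k => by
    simp only [PiLp.add_apply, Pi.add_apply, smul_ee_apply, hV]; ring),
    tay_eq c b q m z₁ _ (V + Pi.single i h) (fun k => by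
    simp only [PiLp.add_apply, Pi.add_apply, smul_ee_apply, hV]; ring),
    tay_eq c b q m z₁ _ (V + Pi.single j h) (fun k => by
    simp only [PiLp.add_apply, Pi.add_apply, smul_ee_apply, hV]; ring),
    tay_eq c b q m z₁ z V (fun k => rfl)]
  simp only [lin_add, lin_single, qf_add_left, qf_add_right]
  rw [qf_comm hm V (Pi.single i h), qf_comm hm V (Pi.single j h),
    qf_comm hm (Pi.single j h) (Pi.single i h)]
  simp only [qf_single]
  have : ∀ i k (h : ℝ), ∑ j, m i j * (Pi.single k h : Fin d → ℝ) j = h * m i k :=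
    fun i k h => lin_single _ _ _
  simp only [this]
  ring

lemma tdiff_tay (c b : ℝ) (q : Fin d → ℝ) (m : Fin d → Fin d → ℝ)
    (z₁ z : Z d) (h : ℝ) :
    tdiff (tay c b q m z₁) h z = h ^ 2 * b := by
  simp only [tdiff, tay]
  ring

lemma norm_ee (i : Fin d) : ‖(ee i : E d)‖ = 1 := by simp

lemma mem_kCyl_self {z : Z d} {s : ℝ} (hs : 0 < s) : z ∈ kCyl s z := by
  refine ⟨by have := pow_pos hs 2; linarith, le_refl _, ?_, ?_⟩ <;> simp [hs]

lemma mem_kCyl_v {z : Z d} {s : ℝ} (hs : 0 < s) {w : E d} (hw : ‖w‖ < s) :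
    (z.1, z.2.1, z.2.2 + w) ∈ kCyl s z := by
  refine ⟨by have := pow_pos hs 2; simp; linarith, le_refl _, ?_, ?_⟩
  · simp [hs]
  · simpa using hw

lemma diff_bounds {w : Z d → ℝ} {D s : ℝ} {z : Z d} (hs : 0 < s)
    (hw : ∀ z' ∈ kCyl s z, |w z'| ≤ D) :
    |w z| ≤ D ∧ (∀ i, |sdiff w i (s/4) z| ≤ 2 * D) ∧ (∀ i j, |mdiff w i j (s/4) z| ≤ 4 * D) ∧
    |tdiff w (s/4) z| ≤ 2 * D := by
  have h0 := hw z (mem_kCyl_self hs)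
  have n1 : ∀ i : Fin d, ‖(s/4) • ee i‖ = s/4 := fun i => by
    rw [norm_smul, norm_ee, mul_one, Real.norm_of_nonneg (by positivity)]
  have h1 : ∀ i : Fin d, |w (z.1, z.2.1, z.2.2 + (s/4) • ee i)| ≤ D := fun i =>
    hw _ (mem_kCyl_v hs (by rw [n1]; linarith))
  refine ⟨h0, fun i => ?_, fun i j => ?_, ?_⟩
  · have h2 : |w (z.1, z.2.1, z.2.2 + (-(s/4)) • ee i)| ≤ D :=
      hw _ (mem_kCyl_v hs (by rw [neg_smul, norm_neg, n1]; linarith))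
    have h1 := h1 i
    simp only [sdiff]
    rw [abs_le] at *
    constructor <;> linarith [h1.1, h1.2, h2.1, h2.2]
  · have h2 : |w (z.1, z.2.1, z.2.2 + (s/4) • ee i + (s/4) • ee j)| ≤ D := by
      have := hw _ (mem_kCyl_v (z := z) hs (w := (s/4) • ee i + (s/4) • ee j) (by
        refine lt_of_le_of_lt (norm_add_le _ _) ?_
        rw [n1, n1]; linarith))
      rwa [← add_assoc] at this
    have h3 := h1 i
    have h4 := h1 j
    simp only [mdiff]
    rw [abs_le] at *
    constructor <;> linarith [h3.1, h3.2, h2.1, h2.2, h4.1, h4.2]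
  · have h2 : |w (z.1 - (s/4) ^ 2, z.2.1 - (s/4) ^ 2 • z.2.2, z.2.2)| ≤ D := by
      apply hw
      refine ⟨?_, ?_, ?_, ?_⟩
      · simp only; nlinarith
      · simp only; nlinarith [sq_nonneg (s/4)]
      · simp only
        have : z.2.1 - (s / 4) ^ 2 • z.2.2 - z.2.1 - (z.1 - (s / 4) ^ 2 - z.1) • z.2.2 = 0 := by
          module
        rw [this, norm_zero]; positivity
      · simpa using hs
    simp only [tdiff]
    rw [abs_le] at *
    constructor <;> linarith [h0.1, h0.2, h2.1, h2.2]

lemma coef_bounds {c b : ℝ} {q : Fin d → ℝ} {m : Fin d → Fin d → ℝ} (hm : ∀ i j, m i j = m j i)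
    {z₁ : Z d} {s D : ℝ} (hs : 0 < s) (h : ∀ z' ∈ kCyl s z₁, |tay c b q m z₁ z'| ≤ D) :
    |c| ≤ D ∧ |b| ≤ 32 * D / s ^ 2 ∧ (∀ i, |q i| ≤ 4 * D / s) ∧ (∀ i j, |m i j| ≤ 64 * D / s ^ 2) := by
  obtain ⟨h1, h2, h3, h4⟩ := diff_bounds hs h
  refine ⟨by simpa [tay] using h1, ?_, fun i => ?_, fun i j => ?_⟩
  · rw [tdiff_tay, abs_mul, abs_of_nonneg (by positivity)] at h4
    rw [le_div_iff₀ (by positivity)]; nlinarith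
  · have := h2 i
    rw [sdiff_tay c b q hm, abs_mul, abs_of_nonneg (by positivity)] at this
    simp only [sub_self, mul_zero, Finset.sum_const_zero, add_zero] at this
    rw [le_div_iff₀ (by positivity)]; nlinarith
  · have := h3 i j
    rw [mdiff_tay c b q hm, abs_mul, abs_of_nonneg (by positivity)] at this
    rw [le_div_iff₀ (by positivity)]; nlinarith

lemma tay_bound {c b : ℝ} {q : Fin d → ℝ} {m : Fin d → Fin d → ℝ} {z₁ z : Z d} {r c0 b0 q0 m0 : ℝ}
    (hr : 0 < r) (hz : z ∈ kCyl r z₁) (hc : |c| ≤ c0) (hb : |b| ≤ b0) (hq : ∀ i, |q i| ≤ q0)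
    (hm : ∀ i j, |m i j| ≤ m0) :
    |tay c b q m z₁ z| ≤ c0 + b0 * r ^ 2 + d * (q0 * r) + (1/2) * (d * (d * (m0 * r ^ 2))) := by
  obtain ⟨h1, h2, -, h4⟩ := hz
  have hV : ∀ i, |z.2.2 i - z₁.2.2 i| ≤ r := fun i => by
    have := PiLp.norm_apply_le (z.2.2 - z₁.2.2) i
    rw [Real.norm_eq_abs, PiLp.sub_apply] at this
    exact this.trans h4.le
  have ht : |z.1 - z₁.1| ≤ r ^ 2 := by rw [abs_le]; constructor <;> nlinarith
  have e1 : |b * (z.1 - z₁.1)| ≤ b0 * r ^ 2 := by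
    rw [abs_mul]; exact mul_le_mul hb ht (abs_nonneg _) ((abs_nonneg _).trans hb)
  have e2 : |∑ i, q i * (z.2.2 i - z₁.2.2 i)| ≤ d * (q0 * r) := by
    refine (Finset.abs_sum_le_sum_abs _ _).trans ?_
    refine (Finset.sum_le_card_nsmul _ _ (q0 * r) fun i _ => ?_).trans (by simp)
    rw [abs_mul]; exact mul_le_mul (hq i) (hV i) (abs_nonneg _) ((abs_nonneg _).trans (hq i))
  have e3 : |∑ i, ∑ j, m i j * (z.2.2 i - z₁.2.2 i) * (z.2.2 j - z₁.2.2 j)| ≤ d * (d * (m0 * r ^ 2)) := by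
    refine (Finset.abs_sum_le_sum_abs _ _).trans ?_
    refine (Finset.sum_le_card_nsmul _ _ (d * (m0 * r ^ 2)) fun i _ => ?_).trans (by simp)
    refine (Finset.abs_sum_le_sum_abs _ _).trans ?_
    refine (Finset.sum_le_card_nsmul _ _ (m0 * r ^ 2) fun j _ => ?_).trans (by simp)
    rw [abs_mul, abs_mul, pow_two, ← mul_assoc]
    have := (abs_nonneg _).trans (hm i j)
    gcongr
    · exact hm i j
    · exact hV i
    · exact hV j
  simp only [tay]
  refine (abs_add_le _ _).trans (add_le_add ((abs_add_le _ _).trans (add_le_add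
    ((abs_add_le _ _).trans (add_le_add hc e1)) e2)) ?_)
  rw [abs_mul, abs_of_nonneg (by norm_num : (0:ℝ) ≤ 1/2)]
  gcongr

lemma kpoly_eq_tay (a b : ℝ) (q : Fin d → ℝ) (M : Matrix (Fin d) (Fin d) ℝ) (z₁ z : Z d) :
    kpoly a b q M z = tay (kpoly a b q M z₁) b
      (fun i => q i + ∑ j, (M i j + M j i) / 2 * z₁.2.2 j)
      (fun i j => (M i j + M j i) / 2) z₁ z := by
  set V : Fin d → ℝ := fun k => z.2.2 k - z₁.2.2 k with hV
  set W : Fin d → ℝ := fun k => z₁.2.2 k with hW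
  have hsym : ∀ X : Fin d → ℝ, qf M X X = qf (fun i j => (M i j + M j i) / 2) X X := by
    intro X
    have h1 : qf M X X = qf (fun i j => M j i) X X := by
      simp only [qf]; rw [Finset.sum_comm]
      refine Finset.sum_congr rfl fun i _ => Finset.sum_congr rfl fun j _ => by ring
    have h2 : qf (fun i j => (M i j + M j i) / 2) X X = (qf M X X + qf (fun i j => M j i) X X) / 2 := by
      simp only [qf, ← Finset.sum_add_distrib, Finset.sum_div]
      refine Finset.sum_congr rfl fun i _ => Finset.sum_congr rfl fun j _ => by ring
    rw [h2, ← h1]; ring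
  have hk : ∀ y : Z d, ∀ X : Fin d → ℝ, (∀ i, y.2.2 i = X i) →
      kpoly a b q M y = a + b * y.1 + ∑ i, q i * X i + (1/2) * qf M X X := by
    intro y X h; simp only [kpoly, qf, h]
  rw [hk z (W + V) (fun i => by simp [hV, hW]), hk z₁ W (fun i => rfl),
    tay_eq _ _ _ _ _ _ V (fun i => rfl)]
  set m : Fin d → Fin d → ℝ := (fun i j => (M i j + M j i) / 2) with hm
  have hms : ∀ i j, m i j = m j i := fun i j => by simp only [hm]; ring
  rw [hsym, hsym]
  simp only [lin_add, qf_add_left, qf_add_right]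
  have : ∑ i, (q i + ∑ j, m i j * z₁.2.2 j) * V i = ∑ i, q i * V i + qf m V W := by
    simp only [add_mul, Finset.sum_add_distrib, qf, Finset.sum_mul]
    congr 1
    refine Finset.sum_congr rfl fun i _ => Finset.sum_congr rfl fun j _ => by ring
  rw [this, qf_comm hms W V]
  ring

lemma tay_eq_kpoly (c b : ℝ) (q : Fin d → ℝ) {m : Fin d → Fin d → ℝ} (hm : ∀ i j, m i j = m j i)
    (z₁ : Z d) : ∃ a' b' q' M', ∀ z, tay c b q m z₁ z = kpoly a' b' q' M' z := by
  refine ⟨tay c b q m z₁ 0, b, fun i => q i - ∑ j, m i j * z₁.2.2 j, m, fun z => ?_⟩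
  set W : Fin d → ℝ := fun k => z₁.2.2 k with hW
  set X : Fin d → ℝ := fun k => z.2.2 k with hX
  have hk : kpoly (tay c b q m z₁ 0) b (fun i => q i - ∑ j, m i j * z₁.2.2 j) m z =
      tay c b q m z₁ 0 + b * z.1 + ∑ i, (q i - ∑ j, m i j * W j) * X i + (1/2) * qf m X X := by
    simp only [kpoly, qf, hW, hX]
  rw [hk, tay_eq c b q m z₁ z (X + (-1:ℝ) • W) (fun i => by simp [hX, hW]; ring),
    tay_eq c b q m z₁ 0 ((-1:ℝ) • W) (fun i => by simp [hW])]
  simp only [lin_add, qf_add_left, qf_add_right]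
  have e1 : ∑ i, (q i - ∑ j, m i j * W j) * X i = ∑ i, q i * X i + qf m X ((-1:ℝ) • W) := by
    rw [← sub_eq_iff_eq_add', ← Finset.sum_sub_distrib]
    simp only [qf]
    refine Finset.sum_congr rfl fun i _ => ?_
    rw [sub_mul, sub_sub_cancel_left, Finset.sum_mul, ← Finset.sum_neg_distrib]
    refine Finset.sum_congr rfl fun j _ => by simp; ring
  rw [e1, qf_comm hm ((-1:ℝ) • W) X]
  simp
  ring

end KS

namespace KS
open Filter Topology Set

variable {u Yu : Z d → ℝ} {ui : Fin d → Z d → ℝ} {uij : Fin d → Fin d → Z d → ℝ}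

lemma KD.s_tendsto (hu : KD u Yu ui uij) (i : Fin d) (z : Z d) :
    Tendsto (fun h : ℝ => sdiff u i h z / (2 * h)) (𝓝[>] 0) (𝓝 (ui i z)) := by
  have h1 : HasDerivAt (fun s : ℝ => u (z.1, z.2.1, z.2.2 + s • ee i)) (ui i z) 0 :=
    hu.hv i z.1 z.2.1 z.2.2
  have h2 : HasDerivAt (fun s : ℝ => u (z.1, z.2.1, z.2.2 + (-s) • ee i)) (- ui i z) 0 := by
    have h1' : HasDerivAt (fun s : ℝ => u (z.1, z.2.1, z.2.2 + s • ee i)) (ui i z) (-0) := by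
      simpa using h1
    have := h1'.comp (0:ℝ) (hasDerivAt_neg (0:ℝ))
    simpa [Function.comp_def] using this
  have h3 := (h1.sub h2)
  have := (hasDerivAt_iff_tendsto_slope.1 h3).mono_left
    (nhdsWithin_mono 0 (fun h (hh : 0 < h) => hh.ne'))
  have := this.div_const 2
  have e : (ui i z - -ui i z) / 2 = ui i z := by ring
  rw [e] at this
  refine this.congr fun h => ?_
  simp [slope_def_field, sdiff]
  rw [div_div, mul_comm]

def TB (α : ℝ) (u Yu : Z d → ℝ) (ui : Fin d → Z d → ℝ) (uij : Fin d → Fin d → Z d → ℝ)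
    (z : Z d) (ρ N : ℝ) : Prop :=
  ∀ r, 0 < r → r ≤ ρ → ∀ z' ∈ kCyl r z,
    |u z' - tay (u z) (Yu z) (fun i => ui i z) (fun i j => uij i j z) z z'| ≤ N * r ^ (2 + α)

lemma scale_pow {r β : ℝ} (hr : 0 < r) (k : ℕ) : (r / 2 ^ k) ^ β = r ^ β * ((2:ℝ) ^ (-β)) ^ k := by
  rw [Real.div_rpow hr.le (by positivity), div_eq_mul_inv, ← Real.rpow_natCast ((2:ℝ)^(-β)),
    ← Real.rpow_mul (by norm_num), neg_mul, Real.rpow_neg (by norm_num), mul_comm β,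
    Real.rpow_mul (by norm_num), Real.rpow_natCast]

lemma two_pow_neg_lt {α : ℝ} (hα : 0 < α) : (2:ℝ) ^ (-α) < 1 :=
  Real.rpow_lt_one_of_one_lt_of_neg (by norm_num) (by linarith)

lemma seq_lim {x : ℕ → ℝ} {X K β α r : ℝ} (hα : 0 < α) (hβ : α ≤ β) (hr : 0 < r) (hK : 0 ≤ K)
    (h : ∀ k : ℕ, |x k - x (k+1)| ≤ K * (r / 2 ^ k) ^ β) (hX : Tendsto x atTop (𝓝 X)) :
    |x 0 - X| ≤ K * r ^ β / (1 - 2 ^ (-α)) := by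
  have := dist_le_of_le_geometric_of_tendsto₀ ((2:ℝ)^(-α)) (K * r ^ β) (two_pow_neg_lt hα)
    (f := x) (a := X) (fun k => by
      rw [Real.dist_eq]
      refine (h k).trans ?_
      rw [scale_pow hr, ← mul_assoc]
      gcongr
      norm_num) hX
  rwa [Real.dist_eq] at this

lemma seq_tend {x y : ℕ → ℝ} {X K β r : ℝ} (hβ : 0 < β) (hr : 0 < r)
    (h : ∀ k : ℕ, |y k - x k| ≤ K * (r / 2 ^ k) ^ β) (hX : Tendsto y atTop (𝓝 X)) :
    Tendsto x atTop (𝓝 X) := by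
  have h1 : Tendsto (fun k : ℕ => K * (r / 2 ^ k) ^ β) atTop (𝓝 0) := by
    simp_rw [scale_pow hr]
    have := ((tendsto_pow_atTop_nhds_zero_of_lt_one (by positivity) (two_pow_neg_lt hβ)).const_mul
      (r ^ β)).const_mul K
    simpa using this
  have h2 : Tendsto (fun k => y k - x k) atTop (𝓝 0) := squeeze_zero_norm h h1
  simpa using hX.sub h2

lemma scale_tendsto {r : ℝ} (hr : 0 < r) :
    Tendsto (fun k : ℕ => r / 2 ^ k / 4) atTop (𝓝[>] 0) := by
  refine tendsto_nhdsWithin_iff.2 ⟨?_, Eventually.of_forall fun k => by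
    simp only [mem_Ioi]; positivity⟩
  have := ((tendsto_pow_atTop_nhds_zero_of_lt_one (r := (1/2:ℝ)) (by norm_num) (by norm_num)).const_mul
      (r/4))
  simp only [mul_zero] at this
  refine this.congr fun k => ?_
  rw [div_pow, one_pow]; ring

lemma mdiff_sub (u w : Z d → ℝ) (i j : Fin d) (h : ℝ) (z : Z d) :
    mdiff (fun z => u z - w z) i j h z = mdiff u i j h z - mdiff w i j h z := by
  simp only [mdiff]; ring
lemma sdiff_sub (u w : Z d → ℝ) (i : Fin d) (h : ℝ) (z : Z d) :
    sdiff (fun z => u z - w z) i h z = sdiff u i h z - sdiff w i h z := by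
  simp only [sdiff]; ring
lemma tdiff_sub (u w : Z d → ℝ) (h : ℝ) (z : Z d) :
    tdiff (fun z => u z - w z) h z = tdiff u h z - tdiff w h z := by
  simp only [tdiff]; ring

lemma kCyl_mono {r s : ℝ} (hr : 0 ≤ r) (h : r ≤ s) (z : Z d) : kCyl r z ⊆ kCyl s z := by
  intro z' hz
  obtain ⟨h1, h2, h3, h4⟩ := hz
  exact ⟨by have := pow_le_pow_left₀ hr h 2; linarith, h2,
    h3.trans_le (pow_le_pow_left₀ hr h 3), h4.trans_le h⟩

def CT (d : ℕ) (α : ℝ) : ℝ := 1 + (258 + 16 * d + 256 * d ^ 2) / (1 - (2:ℝ) ^ (-α))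

lemma CT_pos {α : ℝ} (hα : 0 < α) : 0 < CT d α := by
  have := two_pow_neg_lt hα
  have : 0 < 1 - (2:ℝ) ^ (-α) := by linarith
  unfold CT; positivity

lemma KD.telescope (hu : KD u Yu ui uij) {α ρ N : ℝ} (hα : 0 < α) (hN : 0 ≤ N) (z₁ : Z d)
    (h : ∀ r, 0 < r → r ≤ ρ → ∃ c b q m, (∀ i j, m i j = m j i) ∧
      ∀ z ∈ kCyl r z₁, |u z - tay c b q m z₁ z| ≤ N * r ^ (2 + α)) :
    TB α u Yu ui uij z₁ ρ (CT d α * N) := by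
  intro r hr hrρ z hz
  have hs : ∀ k : ℕ, 0 < r / 2 ^ k ∧ r / 2 ^ k ≤ ρ := fun k =>
    ⟨by positivity, (div_le_self hr.le (one_le_pow₀ (by norm_num))).trans hrρ⟩
  choose c b q m hm hp using fun k : ℕ => h (r / 2 ^ k) (hs k).1 (hs k).2
  have hhalf : ∀ k : ℕ, r / 2 ^ (k+1) = r / 2 ^ k / 2 := fun k => by rw [pow_succ]; field_simp
  -- power splitting
  have p2 : ∀ s : ℝ, 0 < s → s ^ (2 + α) = s ^ 2 * s ^ α := fun s hs => by
    rw [Real.rpow_add hs]; norm_num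
  have p1 : ∀ s : ℝ, 0 < s → s ^ (1 + α) = s * s ^ α := fun s hs => by
    rw [Real.rpow_add hs]; norm_num
  -- consecutive differences
  have hd : ∀ k : ℕ, |c k - c (k+1)| ≤ 2 * N * (r / 2 ^ k) ^ (2 + α) ∧
      |b k - b (k+1)| ≤ 256 * N * (r / 2 ^ k) ^ α ∧
      (∀ i, |q k i - q (k+1) i| ≤ 16 * N * (r / 2 ^ k) ^ (1 + α)) ∧
      (∀ i j, |m k i j - m (k+1) i j| ≤ 512 * N * (r / 2 ^ k) ^ α) := by
    intro k
    set s := r / 2 ^ k with hsdef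
    have hs0 : 0 < s := (hs k).1
    have := coef_bounds (m := fun i j => m k i j - m (k+1) i j)
      (c := c k - c (k+1)) (b := b k - b (k+1)) (q := fun i => q k i - q (k+1) i)
      (fun i j => by rw [hm k i j, hm (k+1) i j]) (z₁ := z₁) (s := s/2) (D := 2 * N * s ^ (2 + α))
      (by positivity) (fun z' hz' => by
        rw [← tay_sub]
        have h1 := hp k z' (kCyl_mono (by positivity) (by rw [← hsdef]; linarith) z₁ hz')
        have h2 := hp (k+1) z' (by rw [hhalf]; exact hz')
        have h3 : N * (r / 2 ^ (k+1)) ^ (2+α) ≤ N * s ^ (2+α) := by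
          rw [hhalf]
          have : s / 2 ≤ s := by linarith
          gcongr
        rw [abs_le] at *
        constructor <;> linarith [h1.1, h1.2, h2.1, h2.2])
    obtain ⟨g1, g2, g3, g4⟩ := this
    rw [p2 s hs0] at *
    refine ⟨g1, g2.trans (le_of_eq ?_), fun i => (g3 i).trans (le_of_eq ?_), fun i j => (g4 i j).trans (le_of_eq ?_)⟩
    · field_simp; ring
    · rw [p1 s hs0]; field_simp; ring
    · field_simp; ring
  -- limits
  have hb := fun k : ℕ => diff_bounds (hs k).1 (w := fun z => u z - tay (c k) (b k) (q k) (m k) z₁ z) (hp k)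
  have lc : Tendsto c atTop (𝓝 (u z₁)) := by
    refine seq_tend (y := fun _ => u z₁) (K := N) (β := 2 + α) (by linarith) hr (fun k => ?_)
      tendsto_const_nhds
    have := (hb k).1
    simpa [tay] using this
  have lb : Tendsto b atTop (𝓝 (Yu z₁)) := by
    refine seq_tend (K := 32 * N) (β := α) (by linarith) hr (fun k => ?_)
      ((hu.Y_tendsto z₁).comp (scale_tendsto hr))
    have := (hb k).2.2.2
    have h0 := (hs k).1
    set s := r / 2 ^ k
    rw [tdiff_sub, tdiff_tay] at this
    simp only [Function.comp]
    have e : (u z₁ - u (z₁.1 - (s/4)^2, z₁.2.1 - (s/4)^2 • z₁.2.2, z₁.2.2)) / (s/4)^2 - b k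
      = (tdiff u (s/4) z₁ - (s/4)^2 * b k) / (s/4)^2 := by
      simp only [tdiff]; field_simp
    rw [e, abs_div, abs_of_nonneg (by positivity : 0 ≤ (s/4)^2), div_le_iff₀ (by positivity)]
    refine this.trans (le_of_eq ?_)
    rw [p2 s h0]; ring
  have lq : ∀ i, Tendsto (fun k => q k i) atTop (𝓝 (ui i z₁)) := by
    intro i
    refine seq_tend (K := 4 * N) (β := 1 + α) (by linarith) hr (fun k => ?_)
      ((hu.s_tendsto i z₁).comp (scale_tendsto hr))
    have := (hb k).2.1 i
    have h0 := (hs k).1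
    set s := r / 2 ^ k
    rw [sdiff_sub, sdiff_tay _ _ _ (hm k)] at this
    simp only [sub_self, mul_zero, Finset.sum_const_zero, add_zero] at this
    simp only [Function.comp]
    have e : sdiff u i (s/4) z₁ / (2 * (s/4)) - q k i
      = (sdiff u i (s/4) z₁ - 2 * (s/4) * q k i) / (2 * (s/4)) := by
      field_simp
    rw [e, abs_div, abs_of_nonneg (by positivity : 0 ≤ 2 * (s/4)), div_le_iff₀ (by positivity)]
    refine this.trans (le_of_eq ?_)
    rw [p2 s h0, p1 s h0]; ring
  have lm : ∀ i j, Tendsto (fun k => m k i j) atTop (𝓝 (uij i j z₁)) := by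
    intro i j
    refine seq_tend (K := 64 * N) (β := α) (by linarith) hr (fun k => ?_)
      ((hu.mixed_tendsto i j z₁).comp (scale_tendsto hr))
    have := (hb k).2.2.1 i j
    have h0 := (hs k).1
    set s := r / 2 ^ k
    rw [mdiff_sub, mdiff_tay _ _ _ (hm k)] at this
    simp only [Function.comp]
    have e : mdiff u i j (s/4) z₁ / (s/4)^2 - m k i j
      = (mdiff u i j (s/4) z₁ - (s/4)^2 * m k i j) / (s/4)^2 := by
      field_simp
    rw [e, abs_div, abs_of_nonneg (by positivity : 0 ≤ (s/4)^2), div_le_iff₀ (by positivity)]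
    refine this.trans (le_of_eq ?_)
    rw [p2 s h0]; ring
  have tc := seq_lim hα (by linarith) hr (by positivity) (fun k => (hd k).1) lc
  have tb := seq_lim hα le_rfl hr (by positivity) (fun k => (hd k).2.1) lb
  have tq := fun i => seq_lim (x := fun k => q k i) hα (by linarith) hr (by positivity) (fun k => (hd k).2.2.1 i) (lq i)
  have tm := fun i j => seq_lim (x := fun k => m k i j) hα le_rfl hr (by positivity) (fun k => (hd k).2.2.2 i j) (lm i j)
  have hr0 : r / 2 ^ 0 = r := by simp
  have f1 := hp 0 z (by rw [hr0]; exact hz)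
  rw [hr0] at f1
  have f2 := tay_bound hr hz tc tb tq tm
  rw [← tay_sub] at f2
  have h3 : 0 < 1 - (2:ℝ) ^ (-α) := by have := two_pow_neg_lt hα; linarith
  have e : CT d α * N * r ^ (2 + α) = N * r ^ (2 + α) + (2 * N * r ^ (2 + α) / (1 - 2 ^ (-α)) +
      256 * N * r ^ α / (1 - 2 ^ (-α)) * r ^ 2 + d * (16 * N * r ^ (1 + α) / (1 - 2 ^ (-α)) * r) +
      (1/2) * (d * (d * (512 * N * r ^ α / (1 - 2 ^ (-α)) * r ^ 2)))) := by
    rw [p2 r hr, p1 r hr, CT]; field_simp; ring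
  rw [e]
  rw [abs_le] at *
  constructor <;> linarith [f1.1, f1.2, f2.1, f2.2]

/-- interpolation -/
lemma KD.interp (hu : KD u Yu ui uij) {α ρ N G s : ℝ} {z : Z d}
    (h : TB α u Yu ui uij z ρ N) (hs : 0 < s) (hsρ : s ≤ ρ) (hG : ∀ z' ∈ kCyl s z, |u z'| ≤ G) :
    |Yu z| ≤ 32 * (N * s ^ (2 + α) + G) / s ^ 2 ∧ (∀ i, |ui i z| ≤ 4 * (N * s ^ (2 + α) + G) / s) ∧
    (∀ i j, |uij i j z| ≤ 64 * (N * s ^ (2 + α) + G) / s ^ 2) := by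
  have := coef_bounds (m := fun i j => uij i j z) (fun i j => hu.symm i j z) hs
    (c := u z) (b := Yu z) (q := fun i => ui i z) (D := N * s ^ (2 + α) + G) (z₁ := z)
    (fun z' hz' => by
      have h1 := h s hs hsρ z' hz'
      have h2 := hG z' hz'
      rw [abs_le] at *
      constructor <;> linarith [h1.1, h1.2, h2.1, h2.2])
  exact this.2

lemma kCyl_sub {r₁ r₂ : ℝ} (h1 : 0 < r₁) (h2 : 0 < r₂) {z z₁ : Z d} (hz : z ∈ kCyl r₁ z₁) :
    kCyl r₂ z ⊆ kCyl (r₁ + r₂) z₁ := by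
  intro y hy
  obtain ⟨a1, a2, a3, a4⟩ := hz
  obtain ⟨b1, b2, b3, b4⟩ := hy
  refine ⟨by nlinarith, b2.trans a2, ?_, ?_⟩
  · have e : y.2.1 - z₁.2.1 - (y.1 - z₁.1) • z₁.2.2 = (y.2.1 - z.2.1 - (y.1 - z.1) • z.2.2)
      + (z.2.1 - z₁.2.1 - (z.1 - z₁.1) • z₁.2.2) + (y.1 - z.1) • (z.2.2 - z₁.2.2) := by module
    rw [e]
    refine (norm_add₃_le ).trans_lt ?_
    have : ‖(y.1 - z.1) • (z.2.2 - z₁.2.2)‖ ≤ r₂ ^ 2 * r₁ := by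
      rw [norm_smul]
      refine mul_le_mul ?_ a4.le (norm_nonneg _) (by positivity)
      rw [Real.norm_eq_abs, abs_le]; constructor <;> nlinarith
    nlinarith [mul_pos h1 h2, mul_pos (mul_pos h1 h1) h2, mul_pos (mul_pos h2 h1) h2]
  · have e : y.2.2 - z₁.2.2 = (y.2.2 - z.2.2) + (z.2.2 - z₁.2.2) := by abel
    rw [e]
    refine (norm_add_le _ _).trans_lt (by linarith)

lemma KD.grad_holder (hu : KD u Yu ui uij) {α ρ N r : ℝ} (hα1 : α < 1) (hN : 0 ≤ N) {z z₁ : Z d}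
    (hr : 0 < r) (hrρ : 2 * r ≤ ρ) (hz : z ∈ kCyl r z₁)
    (h : TB α u Yu ui uij z ρ N) (h₁ : TB α u Yu ui uij z₁ ρ N) (i : Fin d) :
    |ui i z - ui i z₁| ≤ 36 * N * r ^ (1 + α) + ∑ j, |uij i j z₁| * r := by
  set T := tay (u z) (Yu z) (fun i => ui i z) (fun i j => uij i j z) z with hT
  set T₁ := tay (u z₁) (Yu z₁) (fun i => ui i z₁) (fun i j => uij i j z₁) z₁ with hT₁
  have p2 : ∀ s : ℝ, 0 < s → s ^ (2 + α) = s ^ 2 * s ^ α := fun s hs => by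
    rw [Real.rpow_add hs]; norm_num
  have p1 : ∀ s : ℝ, 0 < s → s ^ (1 + α) = s * s ^ α := fun s hs => by
    rw [Real.rpow_add hs]; norm_num
  have h8 : (2 * r) ^ (2 + α) ≤ 8 * r ^ (2 + α) := by
    rw [Real.mul_rpow (by norm_num) hr.le]
    gcongr
    calc (2:ℝ) ^ (2 + α) ≤ 2 ^ (3:ℝ) := Real.rpow_le_rpow_of_exponent_le (by norm_num) (by linarith)
      _ = 8 := by norm_num
  have hb := diff_bounds hr (w := fun y => T y - T₁ y) (z := z) (D := 9 * N * r ^ (2 + α)) (fun y hy => by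
    have a1 := h r hr (by linarith) y hy
    have a2 := h₁ (2 * r) (by positivity) hrρ y (by
      have := kCyl_sub hr hr hz hy
      rwa [← two_mul] at this)
    have a3 : N * (2 * r) ^ (2 + α) ≤ N * (8 * r ^ (2 + α)) := by gcongr
    rw [abs_le] at *
    constructor <;> linarith [a1.1, a1.2, a2.1, a2.2])
  have := hb.2.1 i
  rw [sdiff_sub, hT, hT₁, sdiff_tay _ _ _ (fun i j => hu.symm i j z),
    sdiff_tay _ _ _ (fun i j => hu.symm i j z₁)] at this
  simp only [sub_self, mul_zero, Finset.sum_const_zero, add_zero] at this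
  rw [← mul_sub, abs_mul, abs_of_nonneg (by positivity)] at this
  have e1 : |ui i z - (ui i z₁ + ∑ j, uij i j z₁ * (z.2.2 j - z₁.2.2 j))| ≤ 36 * N * r ^ (1 + α) := by
    rw [p2 r hr] at this
    rw [p1 r hr]
    refine le_of_mul_le_mul_left (this.trans (le_of_eq ?_)) (by positivity : 0 < 2 * (r/4))
    ring
  have e2 : |∑ j, uij i j z₁ * (z.2.2 j - z₁.2.2 j)| ≤ ∑ j, |uij i j z₁| * r := by
    refine (Finset.abs_sum_le_sum_abs _ _).trans (Finset.sum_le_sum fun j _ => ?_)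
    rw [abs_mul]
    gcongr
    have := PiLp.norm_apply_le (z.2.2 - z₁.2.2) j
    rw [Real.norm_eq_abs, PiLp.sub_apply] at this
    exact this.trans hz.2.2.2.le
  rw [abs_le] at *
  constructor <;> linarith [e1.1, e1.2, e2.1, e2.2]

end KS

namespace KS
open Filter Topology Set

/-- Inverse diffusion matrix data. -/
structure Ell (cM CM : ℝ) (A : Fin d → Fin d → ℝ) (M : E d →L[ℝ] E d) : Prop where
  symm : ∀ x y, inner ℝ (M x) y = inner ℝ (M y) x
  coer : ∀ x, cM * ‖x‖ ^ 2 ≤ inner ℝ (M x) x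
  bdd : ∀ x y, |inner ℝ (M x) y| ≤ CM * (‖x‖ * ‖y‖)
  quad : ∀ x y, ∑ i, ∑ j, A i j * (M x) i * (M y) j = inner ℝ (M x) y
  tr : ∑ i, ∑ j, A i j * (M (ee j)) i = d

theorem exists_ell {lam Ka : ℝ} (hlam : 0 < lam) (hKa : 0 < Ka) (hd : 1 ≤ d)
    (A : Fin d → Fin d → ℝ) (hs : ∀ i j, A i j = A j i) (hK : ∀ i j, |A i j| ≤ Ka)
    (hE : ∀ ξ : E d, lam * ‖ξ‖ ^ 2 ≤ ∑ i, ∑ j, A i j * ξ i * ξ j) :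
    ∃ M : E d →L[ℝ] E d, Ell (lam / (d * Ka) ^ 2) (1 / lam) A M := by
  classical
  let T : E d →ₗ[ℝ] E d := Matrix.toEuclideanLin (Matrix.of A)
  have hT : ∀ x i, T x i = ∑ j, A i j * x j := by
    intro x i
    simp [T, Matrix.toLpLin_apply, Matrix.mulVec, dotProduct]
  have hin : ∀ x y : E d, inner ℝ x (T y) = ∑ i, ∑ j, A i j * x i * y j := by
    intro x y
    rw [PiLp.inner_apply]
    refine Finset.sum_congr rfl fun i _ => ?_
    rw [hT]
    simp only [RCLike.inner_apply, conj_trivial, Finset.sum_mul]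
    exact Finset.sum_congr rfl fun j _ => by ring
  have hsy : ∀ x y : E d, inner ℝ x (T y) = inner ℝ y (T x) := by
    intro x y
    rw [hin, hin, Finset.sum_comm]
    exact Finset.sum_congr rfl fun i _ => Finset.sum_congr rfl fun j _ => by rw [hs]; ring
  have hco : ∀ x : E d, lam * ‖x‖ ^ 2 ≤ inner ℝ x (T x) := fun x => by rw [hin]; exact hE x
  have hlow : ∀ x : E d, lam * ‖x‖ ≤ ‖T x‖ := by
    intro x
    have h1 := (hco x).trans (real_inner_le_norm _ _)
    by_cases h0 : ‖x‖ = 0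
    · rw [h0]; simp
    · have : 0 < ‖x‖ := lt_of_le_of_ne (norm_nonneg _) (Ne.symm h0)
      nlinarith
  have hinj : Function.Injective T := by
    rw [← LinearMap.ker_eq_bot, LinearMap.ker_eq_bot']
    intro x hx
    have := hlow x
    rw [hx, norm_zero] at this
    have : ‖x‖ ≤ 0 := by nlinarith
    simpa using this
  let e := LinearEquiv.ofInjectiveEndo T hinj
  have he : ∀ x, T (e.symm x) = x := fun x => e.apply_symm_apply x
  have hup : ∀ x : E d, ‖T x‖ ≤ d * Ka * ‖x‖ := by
    intro x
    have hx : ∀ j, |x j| ≤ ‖x‖ := fun j => by simpa using PiLp.norm_apply_le x j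
    have h1 : ∀ i, |T x i| ≤ d * Ka * ‖x‖ := by
      intro i
      rw [hT]
      refine (Finset.abs_sum_le_sum_abs _ _).trans ?_
      calc ∑ j, |A i j * x j| ≤ ∑ j : Fin d, Ka * ‖x‖ := Finset.sum_le_sum fun j _ => by
            rw [abs_mul]; exact mul_le_mul (hK i j) (hx j) (abs_nonneg _) hKa.le
        _ = d * Ka * ‖x‖ := by simp; ring
    have h2 : inner ℝ (T x) (T x) = ∑ i, ∑ j, A i j * T x i * x j := hin _ _
    rw [real_inner_self_eq_norm_sq] at h2
    have hTx : ∀ j, |T x j| ≤ ‖T x‖ := fun j => by simpa using PiLp.norm_apply_le (T x) j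
    have c1 : ∑ i, |x i| ≤ √d * ‖x‖ := by
      have := Finset.sum_mul_sq_le_sq_mul_sq Finset.univ (fun _ : Fin d => (1:ℝ)) (fun i => |x i|)
      simp only [one_mul, one_pow, Finset.sum_const, Finset.card_univ, Fintype.card_fin, nsmul_eq_mul, mul_one, sq_abs] at this
      rw [← EuclideanSpace.real_norm_sq_eq] at this
      rw [← Real.sqrt_sq (norm_nonneg x), ← Real.sqrt_mul (by positivity)]
      exact Real.le_sqrt_of_sq_le this
    have c2 : ∑ i, |T x i| ≤ √d * ‖T x‖ := by
      have := Finset.sum_mul_sq_le_sq_mul_sq Finset.univ (fun _ : Fin d => (1:ℝ)) (fun i => |T x i|)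
      simp only [one_mul, one_pow, Finset.sum_const, Finset.card_univ, Fintype.card_fin, nsmul_eq_mul, mul_one, sq_abs] at this
      rw [← EuclideanSpace.real_norm_sq_eq] at this
      rw [← Real.sqrt_sq (norm_nonneg (T x)), ← Real.sqrt_mul (by positivity)]
      exact Real.le_sqrt_of_sq_le this
    have h3 : ‖T x‖ ^ 2 ≤ Ka * ((√d * ‖T x‖) * (√d * ‖x‖)) := by
      rw [h2]
      calc ∑ i, ∑ j, A i j * T x i * x j ≤ ∑ i, ∑ j, Ka * (|T x i| * |x j|) := by
            refine Finset.sum_le_sum fun i _ => Finset.sum_le_sum fun j _ => ?_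
            refine (le_abs_self _).trans ?_
            rw [abs_mul, abs_mul, mul_assoc]
            exact mul_le_mul_of_nonneg_right (hK i j) (by positivity)
        _ = Ka * ((∑ i, |T x i|) * (∑ j, |x j|)) := by
            rw [Finset.sum_mul_sum, Finset.mul_sum]
            exact Finset.sum_congr rfl fun i _ => by rw [Finset.mul_sum]
        _ ≤ _ := by
            refine mul_le_mul_of_nonneg_left (mul_le_mul c2 c1 ?_ (by positivity)) hKa.le
            exact Finset.sum_nonneg fun i _ => abs_nonneg _
    have h4 : √(d:ℝ) * √d = d := Real.mul_self_sqrt (by positivity)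
    by_cases h0 : ‖T x‖ = 0
    · rw [h0]; positivity
    · have : 0 < ‖T x‖ := lt_of_le_of_ne (norm_nonneg _) (Ne.symm h0)
      have h5 : ‖T x‖ * ‖T x‖ ≤ (d * Ka * ‖x‖) * ‖T x‖ := by
        calc _ = ‖T x‖ ^ 2 := by ring
          _ ≤ _ := h3
          _ = (√(d:ℝ) * √d) * Ka * ‖x‖ * ‖T x‖ := by ring
          _ = _ := by rw [h4]
      exact le_of_mul_le_mul_right h5 this
  have hd0 : (0:ℝ) < d := by exact_mod_cast hd
  refine ⟨LinearMap.toContinuousLinearMap e.symm.toLinearMap, ?_, ?_, ?_, ?_, ?_⟩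
  · intro x y
    simp only [LinearMap.coe_toContinuousLinearMap', LinearEquiv.coe_coe]
    conv_lhs => rw [← he y]
    conv_rhs => rw [← he x]
    exact hsy _ _
  · intro x
    simp only [LinearMap.coe_toContinuousLinearMap', LinearEquiv.coe_coe]
    have h1 := hup (e.symm x)
    have h2 := hco (e.symm x)
    rw [he] at h1 h2
    refine le_trans ?_ h2
    rw [div_mul_eq_mul_div, div_le_iff₀ (by positivity), mul_assoc]
    refine mul_le_mul_of_nonneg_left ?_ hlam.le
    rw [← mul_pow, mul_comm ‖e.symm x‖]
    exact pow_le_pow_left₀ (norm_nonneg _) h1 2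
  · intro x y
    simp only [LinearMap.coe_toContinuousLinearMap', LinearEquiv.coe_coe]
    refine (abs_real_inner_le_norm _ _).trans ?_
    have h1 := hlow (e.symm x)
    rw [he] at h1
    have : ‖e.symm x‖ ≤ 1 / lam * ‖x‖ := by
      rw [div_mul_eq_mul_div, one_mul, le_div_iff₀ hlam]; linarith
    rw [← mul_assoc]
    exact mul_le_mul_of_nonneg_right this (norm_nonneg _)
  · intro x y
    simp only [LinearMap.coe_toContinuousLinearMap', LinearEquiv.coe_coe]
    rw [← hin, he]
  · simp only [LinearMap.coe_toContinuousLinearMap', LinearEquiv.coe_coe]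
    rw [Finset.sum_comm]
    have : ∀ j, ∑ i, A i j * (e.symm (ee j)) i = 1 := by
      intro j
      have h1 : T (e.symm (ee j)) j = (ee j : E d) j := by rw [he]
      rw [hT] at h1
      rw [show (ee j : E d) j = 1 by simp [ee]] at h1
      rw [← h1]
      exact Finset.sum_congr rfl fun i _ => by rw [hs]
    simp [this]

def H1 (M : E d →L[ℝ] E d) (p : E d × E d) : ℝ :=
  inner ℝ (M p.2) p.2 - 3 * inner ℝ (M p.2) p.1 + 3 * inner ℝ (M p.1) p.1

def HH (M : E d →L[ℝ] E d) (T : ℝ) (X V : E d) : ℝ :=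
  inner ℝ (M V) V / T - 3 * inner ℝ (M V) X / T ^ 2 + 3 * inner ℝ (M X) X / T ^ 3

def Gam (M : E d →L[ℝ] E d) (T : ℝ) (X V : E d) : ℝ := (T ^ (2 * d))⁻¹ * Real.exp (- HH M T X V)

def SS (p : E d × E d) : ℝ := 1 + ‖p.1‖ + ‖p.2‖
def qq (p : E d × E d) : ℝ := ‖p.1‖ ^ 2 + ‖p.2‖ ^ 2

theorem SS_ge (p : E d × E d) : 1 ≤ SS p := by
  unfold SS; linarith [norm_nonneg p.1, norm_nonneg p.2]

theorem qq_nonneg (p : E d × E d) : 0 ≤ qq p := by unfold qq; positivity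

theorem SS_sq (p : E d × E d) : SS p ^ 2 ≤ 3 * (1 + qq p) := by
  unfold SS qq
  nlinarith [sq_nonneg (1 - ‖p.1‖), sq_nonneg (1 - ‖p.2‖), sq_nonneg (‖p.1‖ - ‖p.2‖)]

theorem SS_cont : Continuous (SS (d := d)) := by unfold SS; fun_prop
theorem qq_cont : Continuous (qq (d := d)) := by unfold qq; fun_prop
theorem H1_cont (M : E d →L[ℝ] E d) : Continuous (H1 M) := by unfold H1; fun_prop

theorem Ell.H1_ge {cM CM : ℝ} {A : Fin d → Fin d → ℝ} {M : E d →L[ℝ] E d} (h : Ell cM CM A M)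
    (hc : 0 < cM) (p : E d × E d) : cM / 8 * qq p ≤ H1 M p := by
  obtain ⟨ξ, ν⟩ := p
  have h1 := h.coer ξ
  have h2 := h.coer ν
  have h3 := h.coer (ν - (12 / 7 : ℝ) • ξ)
  have h4 : 0 ≤ inner ℝ (M (ν - (12 / 7 : ℝ) • ξ)) (ν - (12 / 7 : ℝ) • ξ) :=
    le_trans (by positivity) h3
  simp only [map_sub, map_smul, inner_sub_left, inner_sub_right, inner_smul_left, inner_smul_right,
    conj_trivial] at h4
  rw [h.symm ξ ν] at h4
  simp only [H1, qq]
  have := mul_nonneg hc.le (sq_nonneg ‖ξ‖)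
  have := mul_nonneg hc.le (sq_nonneg ‖ν‖)
  nlinarith

theorem Ell.H1_le {cM CM : ℝ} {A : Fin d → Fin d → ℝ} {M : E d →L[ℝ] E d} (h : Ell cM CM A M)
    (hC : 0 < CM) (p : E d × E d) : H1 M p ≤ 5 * CM * qq p := by
  obtain ⟨ξ, ν⟩ := p
  have h1 := abs_le.1 (h.bdd ξ ξ)
  have h2 := abs_le.1 (h.bdd ν ν)
  have h3 := abs_le.1 (h.bdd ν ξ)
  simp only [H1, qq]
  nlinarith [mul_nonneg hC.le (sq_nonneg (‖ξ‖ - ‖ν‖))]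

theorem HH_scale (M : E d →L[ℝ] E d) {ρ : ℝ} (hρ : 0 < ρ) (T : ℝ) (X V : E d) :
    HH M (ρ ^ 2 * T) (ρ ^ 3 • X) (ρ • V) = HH M T X V := by
  simp only [HH, map_smul, inner_smul_left, inner_smul_right, conj_trivial]
  by_cases hT : T = 0
  · simp [hT]
  · field_simp

theorem Gam_scale (M : E d →L[ℝ] E d) {ρ : ℝ} (hρ : 0 < ρ) (T : ℝ) (X V : E d) :
    Gam M (ρ ^ 2 * T) (ρ ^ 3 • X) (ρ • V) = (ρ ^ (4 * d))⁻¹ * Gam M T X V := by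
  rw [Gam, HH_scale M hρ, Gam, mul_pow, ← pow_mul, mul_inv]
  ring_nf

theorem HH_one (M : E d →L[ℝ] E d) (X V : E d) : HH M 1 X V = H1 M (X, V) := by
  simp [HH, H1]

theorem Gam_one (M : E d →L[ℝ] E d) (X V : E d) : Gam M 1 X V = Real.exp (- H1 M (X, V)) := by
  simp [Gam, HH_one]

/-- Gaussian integrability. -/
theorem int_gauss {c : ℝ} (hc : 0 < c) : Integrable (fun p : E d × E d => Real.exp (- c * qq p)) := by
  have h1 : Integrable (fun v : E d => Real.exp (- c * ‖v‖ ^ 2)) := by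
    have := GaussianFourier.integrable_cexp_neg_mul_sq_norm_add (b := (c:ℂ)) (by simpa using hc) 0 (0 : E d)
    have := this.re
    refine this.congr (Eventually.of_forall fun v => ?_)
    simp only [inner_zero_left]
    have : (-(c:ℂ) * (‖v‖:ℂ) ^ 2 + 0 * ((0:ℝ):ℂ)) = ((- c * ‖v‖ ^ 2 : ℝ) : ℂ) := by push_cast; ring
    rw [this, ← Complex.ofReal_exp]
    rfl
  have := h1.mul_prod h1
  refine this.congr (Eventually.of_forall fun p => ?_)
  simp only [qq]
  rw [← Real.exp_add]
  ring_nf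

theorem SS_pow_le {c : ℝ} (hc : 0 < c) (k : ℕ) (p : E d × E d) :
    SS p ^ k * Real.exp (- c * qq p) ≤ Real.exp (k ^ 2 / c) * Real.exp (- (c / 2) * qq p) := by
  have h1 : SS p ≤ Real.exp (‖p.1‖ + ‖p.2‖) := by
    have := Real.add_one_le_exp (‖p.1‖ + ‖p.2‖)
    unfold SS; linarith
  have h2 : SS p ^ k ≤ Real.exp (k * (‖p.1‖ + ‖p.2‖)) := by
    rw [Real.exp_nat_mul]
    exact pow_le_pow_left₀ (by linarith [SS_ge p]) h1 k
  calc _ ≤ Real.exp (k * (‖p.1‖ + ‖p.2‖)) * Real.exp (- c * qq p) := by gcongr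
    _ ≤ _ := by
      rw [← Real.exp_add, ← Real.exp_add]
      apply Real.exp_le_exp.2
      unfold qq
      have e : ∀ a : ℝ, k * a ≤ c / 2 * a ^ 2 + k ^ 2 / c / 2 := by
        intro a
        have : c / 2 * a ^ 2 + k ^ 2 / c / 2 - k * a = (c / 2) * (a - k / c) ^ 2 := by
          field_simp; ring
        have h0 : 0 ≤ (c / 2) * (a - k / c) ^ 2 := by positivity
        linarith
      have := e ‖p.1‖
      have := e ‖p.2‖
      nlinarith

theorem int_weight {c : ℝ} (hc : 0 < c) (k : ℕ) :
    Integrable (fun p : E d × E d => SS p ^ k * Real.exp (- c * qq p)) := by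
  refine ((int_gauss (d := d) (c := c / 2) (by positivity)).const_mul (Real.exp (k ^ 2 / c))).mono' ?_ ?_
  · have := SS_cont (d := d)
    have := qq_cont (d := d)
    exact Continuous.aestronglyMeasurable (by fun_prop)
  · refine Eventually.of_forall fun p => ?_
    have h0 := SS_ge p
    rw [Real.norm_of_nonneg (by positivity)]
    exact SS_pow_le hc k p

/-- If `k` is continuous and bounded by weight then integrable. -/
theorem int_of_le {c : ℝ} (hc : 0 < c) (k : ℕ) {f : E d × E d → ℝ} (hf : Continuous f) {B : ℝ}
    (hB : ∀ p, |f p| ≤ B * (SS p ^ k * Real.exp (- c * qq p))) : Integrable f :=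
  ((int_weight hc k).const_mul B).mono' hf.aestronglyMeasurable (Eventually.of_forall hB)

theorem Ell.int_exp {cM CM : ℝ} {A : Fin d → Fin d → ℝ} {M : E d →L[ℝ] E d} (h : Ell cM CM A M)
    (hc : 0 < cM) : Integrable (fun p : E d × E d => Real.exp (- H1 M p)) := by
  refine int_of_le (c := cM / 8) (by positivity) 0 (B := 1) ?_ ?_
  · have := H1_cont M; fun_prop
  · intro p
    rw [abs_of_nonneg (by positivity)]
    simp only [pow_zero, one_mul]
    exact Real.exp_le_exp.2 (by linarith [h.H1_ge hc p])

def ZM (M : E d →L[ℝ] E d) : ℝ := ∫ p : E d × E d, Real.exp (- H1 M p)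

def zlow (d : ℕ) (CM : ℝ) : ℝ := ∫ p : E d × E d, Real.exp (- (5 * CM) * qq p)

theorem zlow_pos {CM : ℝ} (hC : 0 < CM) : 0 < zlow d CM := by
  unfold zlow
  rw [integral_pos_iff_support_of_nonneg (fun p => (Real.exp_pos _).le) (int_gauss (by positivity))]
  have : Function.support (fun p : E d × E d => Real.exp (- (5 * CM) * qq p)) = univ := by
    ext p; simp
  rw [this]
  exact isOpen_univ.measure_pos volume univ_nonempty

theorem Ell.ZM_ge {cM CM : ℝ} {A : Fin d → Fin d → ℝ} {M : E d →L[ℝ] E d} (h : Ell cM CM A M)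
    (hc : 0 < cM) (hC : 0 < CM) : zlow d CM ≤ ZM M := by
  refine integral_mono (int_gauss (by positivity)) (h.int_exp hc) fun p => ?_
  exact Real.exp_le_exp.2 (by linarith [h.H1_le hC p])

end KS

namespace KS
open Filter Topology Set

def cB : ℕ → ℝ
  | 0 => 0
  | (n + 1) => 2 * cB n + 2 * (n + 1)

theorem cB_nonneg (n : ℕ) : 0 ≤ cB n := by
  induction n with
  | zero => simp [cB]
  | succ n ih => simp only [cB]; positivity

theorem kap_bound {ϑ : ℝ} (h : |ϑ| ≤ 1 / 2) (n : ℕ) :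
    |((1 + ϑ)⁻¹) ^ n - 1 + n * ϑ| ≤ cB n * ϑ ^ 2 := by
  have h' := abs_le.1 h
  have hpos : 0 < 1 + ϑ := by linarith
  have hk : (1 + ϑ)⁻¹ ≤ 2 := by
    rw [inv_le_comm₀ hpos (by norm_num)]; linarith
  have hk0 : 0 < (1 + ϑ)⁻¹ := by positivity
  induction n with
  | zero => simp [cB]
  | succ n ih =>
    have e : ((1 + ϑ)⁻¹) ^ (n + 1) - 1 + ((n + 1 : ℕ) : ℝ) * ϑ =
        (1 + ϑ)⁻¹ * (((1 + ϑ)⁻¹) ^ n - 1 + n * ϑ) + (1 + ϑ)⁻¹ * ((n + 1) * ϑ ^ 2) := by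
      push_cast
      have hi : (1 + ϑ)⁻¹ * (1 + ϑ) = 1 := inv_mul_cancel₀ hpos.ne'
      linear_combination (1 - (n + 1) * ϑ) * hi
    rw [e]
    refine (abs_add_le _ _).trans ?_
    rw [abs_mul, abs_mul, abs_of_pos hk0, abs_of_nonneg (by positivity : 0 ≤ ((n:ℝ) + 1) * ϑ ^ 2)]
    simp only [cB]
    have := mul_le_mul hk ih (abs_nonneg _) (by norm_num)
    have h3 := mul_le_mul_of_nonneg_right hk (by positivity : 0 ≤ ((n:ℝ) + 1) * ϑ ^ 2)
    linarith

theorem exp_bound3 (x : ℝ) : |Real.exp (-x) - 1 + x - x ^ 2 / 2| ≤ |x| ^ 3 * Real.exp |x| := by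
  have := Complex.norm_exp_sub_sum_le_norm_mul_exp (-(x:ℂ)) 3
  simp only [Finset.sum_range_succ, Finset.sum_range_zero, norm_neg, Complex.norm_real] at this
  have e : Complex.exp (-(x:ℂ)) - (0 + (-(x:ℂ)) ^ 0 / (Nat.factorial 0 : ℕ) + (-(x:ℂ)) ^ 1 / (Nat.factorial 1 : ℕ) + (-(x:ℂ)) ^ 2 / (Nat.factorial 2 : ℕ))
    = ((Real.exp (-x) - 1 + x - x ^ 2 / 2 : ℝ) : ℂ) := by
    push_cast [Nat.factorial]
    ring
  rw [e, Complex.norm_real] at this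
  exact this

theorem exp_bound1 (x : ℝ) : |Real.exp (-x) - 1| ≤ |x| * Real.exp |x| := by
  have := Complex.norm_exp_sub_sum_le_norm_mul_exp (-(x:ℂ)) 1
  simp only [Finset.sum_range_succ, Finset.sum_range_zero, norm_neg, Complex.norm_real] at this
  have e : Complex.exp (-(x:ℂ)) - (0 + (-(x:ℂ)) ^ 0 / (Nat.factorial 0 : ℕ))
    = ((Real.exp (-x) - 1 : ℝ) : ℂ) := by
    push_cast [Nat.factorial]
    ring
  rw [e, Complex.norm_real] at this
  simpa using this

theorem mul_bd {a b A B : ℝ} (h1 : |a| ≤ A) (h2 : |b| ≤ B) : |a * b| ≤ A * B := by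
  rw [abs_mul]
  exact mul_le_mul h1 h2 (abs_nonneg _) ((abs_nonneg _).trans h1)

/-- remainder estimate, scalar version -/
theorem rest_bound {ϑ ε B a b c2 e g h1 h2 x y w : ℝ} (hε : 0 ≤ ε) (hε1 : ε ≤ 1 / 2)
    (hϑ : |ϑ| ≤ ε ^ 2) (hB : 0 ≤ B) (ha : |a| ≤ B) (he : |e| ≤ B) (hx : |x| ≤ B)
    (hb : |b| ≤ ε * B) (hg : |g| ≤ ε * B) (hc : |c2| ≤ ε ^ 2 * B) (hh1 : |h1| ≤ ε ^ 3 * B)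
    (hh2 : |h2| ≤ ε ^ 3 * B) (hy : |y| ≤ ε ^ 3 * B) (hw : |w| ≤ ε ^ 3 * B) (κ : ℝ)
    (hκ : κ = (1 + ϑ)⁻¹) :
    |κ * (a + 2 * b + c2) - 3 * κ ^ 2 * (e + h1 + ϑ * a + g + h2 + ϑ * b)
      + 3 * κ ^ 3 * (x + 2 * y + 2 * ϑ * e + ϑ ^ 2 * a + 2 * ϑ * h1 + w)
      - (a - 3 * e + 3 * x) - (2 * b - 3 * g)
      - (c2 + ϑ * (- 4 * a + 12 * e - 9 * x))| ≤ 2000 * ε ^ 3 * B := by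
  have hε2 : ε ^ 2 ≤ 1 / 2 * ε := by nlinarith
  have hε3 : ε ^ 3 ≤ 1 / 4 * ε := by nlinarith
  have hε4 : ε ^ 4 ≤ 1 / 2 * ε ^ 3 := by
    have : 0 ≤ ε ^ 3 := by positivity
    nlinarith
  have hϑ1 : |ϑ| ≤ 1 / 2 := hϑ.trans (by nlinarith)
  have hϑ2 : ϑ ^ 2 ≤ ε ^ 4 := by
    rw [← sq_abs]
    calc |ϑ| ^ 2 ≤ (ε ^ 2) ^ 2 := pow_le_pow_left₀ (abs_nonneg _) hϑ 2
      _ = ε ^ 4 := by ring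
  have hϑ3 : ϑ ^ 2 ≤ 1 / 2 * ε ^ 3 := hϑ2.trans hε4
  have k1 := kap_bound hϑ1 1
  have k2 := kap_bound hϑ1 2
  have k3 := kap_bound hϑ1 3
  rw [← hκ] at k1 k2 k3
  norm_num [cB] at k1 k2 k3
  have K1 : |κ - 1 + ϑ| ≤ 1 * ε ^ 3 := by linarith
  have K2 : |κ ^ 2 - 1 + 2 * ϑ| ≤ 4 * ε ^ 3 := by linarith
  have K3 : |κ ^ 3 - 1 + 3 * ϑ| ≤ 11 * ε ^ 3 := by linarith
  have hεp : 0 ≤ ε * B := by positivity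
  have hεB : ε * B ≤ 1 / 2 * B := mul_le_mul_of_nonneg_right hε1 hB
  have hε2B : ε ^ 2 * B ≤ 1 / 2 * (ε * B) := by
    have := mul_le_mul_of_nonneg_right hε2 hB
    linarith only [this]
  have hε3B : ε ^ 3 * B ≤ 1 / 4 * (ε * B) := by
    have := mul_le_mul_of_nonneg_right hε3 hB
    linarith only [this]
  have hp3 : 0 ≤ ε ^ 3 * B := by positivity
  have hϑa := abs_le.1 (mul_bd hϑ ha)
  have hϑb := mul_bd hϑ hb
  have hϑe := abs_le.1 (mul_bd hϑ he)
  have hϑ2a : |ϑ ^ 2 * a| ≤ 1 / 2 * ε ^ 3 * B := mul_bd (by rw [abs_of_nonneg (by positivity)]; exact hϑ3) ha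
  have hϑb' : |ϑ * b| ≤ ε ^ 3 * B := by calc _ ≤ _ := hϑb
                                          _ = _ := by ring
  have hϑh' : |ϑ * h1| ≤ ε ^ 3 * B := by
    have := mul_bd hϑ1 hh1
    linarith only [this, hp3]
  have ha' := abs_le.1 ha
  have hb' := abs_le.1 hb
  have hc' := abs_le.1 hc
  have he' := abs_le.1 he
  have hg' := abs_le.1 hg
  have hx' := abs_le.1 hx
  have hy' := abs_le.1 hy
  have hw' := abs_le.1 hw
  have hh1' := abs_le.1 hh1
  have hh2' := abs_le.1 hh2
  have hϑb2 := abs_le.1 hϑb'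
  have hϑh2 := abs_le.1 hϑh'
  have hϑ2a' := abs_le.1 hϑ2a
  have P0 : |2 * b + c2| ≤ 3 * (ε * B) := abs_le.2
    ⟨by linarith only [hb'.1, hc'.1, hε2B, hεp], by linarith only [hb'.2, hc'.2, hε2B, hεp]⟩
  have P0' := abs_le.1 P0
  have P1 : |a + 2 * b + c2| ≤ 4 * B := abs_le.2
    ⟨by linarith only [P0'.1, ha'.1, hεB, hB], by linarith only [P0'.2, ha'.2, hεB, hB]⟩
  have Q1 : |h1 + h2 + ϑ * b| ≤ 3 * (ε ^ 3 * B) := abs_le.2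
    ⟨by linarith only [hh1'.1, hh2'.1, hϑb2.1], by linarith only [hh1'.2, hh2'.2, hϑb2.2]⟩
  have Q1' := abs_le.1 Q1
  have Q2 : |h1 + ϑ * a + g + h2 + ϑ * b| ≤ 4 * (ε * B) := abs_le.2
    ⟨by linarith only [Q1'.1, hϑa.1, hg'.1, hε3B, hε2B, hεp], by linarith only [Q1'.2, hϑa.2, hg'.2, hε3B, hε2B, hεp]⟩
  have Q2' := abs_le.1 Q2
  have Q3 : |e + h1 + ϑ * a + g + h2 + ϑ * b| ≤ 4 * B := abs_le.2
    ⟨by linarith only [Q2'.1, he'.1, hεB, hB], by linarith only [Q2'.2, he'.2, hεB, hB]⟩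
  have R1 : |2 * y + ϑ ^ 2 * a + 2 * (ϑ * h1) + w| ≤ 6 * (ε ^ 3 * B) := abs_le.2
    ⟨by linarith only [hy'.1, hϑ2a'.1, hϑh2.1, hw'.1, hp3], by linarith only [hy'.2, hϑ2a'.2, hϑh2.2, hw'.2, hp3]⟩
  have R1' := abs_le.1 R1
  have R2 : |2 * y + 2 * (ϑ * e) + ϑ ^ 2 * a + 2 * (ϑ * h1) + w| ≤ 4 * (ε * B) := abs_le.2
    ⟨by linarith only [R1'.1, hϑe.1, hε3B, hε2B, hεp], by linarith only [R1'.2, hϑe.2, hε3B, hε2B, hεp]⟩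
  have R2' := abs_le.1 R2
  have R3 : |x + 2 * y + 2 * (ϑ * e) + ϑ ^ 2 * a + 2 * (ϑ * h1) + w| ≤ 4 * B := abs_le.2
    ⟨by linarith only [R2'.1, hx'.1, hεB, hB], by linarith only [R2'.2, hx'.2, hεB, hB]⟩
  have t1 := abs_le.1 (mul_bd K1 P1)
  have t2 := abs_le.1 (mul_bd hϑ P0)
  have t3 := abs_le.1 (mul_bd K2 Q3)
  have t4 := abs_le.1 (mul_bd hϑ Q2)
  have t6 := abs_le.1 (mul_bd K3 R3)
  have t7 := abs_le.1 (mul_bd hϑ R2)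
  have id : κ * (a + 2 * b + c2) - 3 * κ ^ 2 * (e + h1 + ϑ * a + g + h2 + ϑ * b)
      + 3 * κ ^ 3 * (x + 2 * y + 2 * ϑ * e + ϑ ^ 2 * a + 2 * ϑ * h1 + w)
      - (a - 3 * e + 3 * x) - (2 * b - 3 * g)
      - (c2 + ϑ * (- 4 * a + 12 * e - 9 * x)) =
    (κ - 1 + ϑ) * (a + 2 * b + c2) - ϑ * (2 * b + c2)
    - 3 * ((κ ^ 2 - 1 + 2 * ϑ) * (e + h1 + ϑ * a + g + h2 + ϑ * b)
      - 2 * (ϑ * (h1 + ϑ * a + g + h2 + ϑ * b)) + (h1 + h2 + ϑ * b))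
    + 3 * ((κ ^ 3 - 1 + 3 * ϑ) * (x + 2 * y + 2 * (ϑ * e) + ϑ ^ 2 * a + 2 * (ϑ * h1) + w)
      - 3 * (ϑ * (2 * y + 2 * (ϑ * e) + ϑ ^ 2 * a + 2 * (ϑ * h1) + w))
      + (2 * y + ϑ ^ 2 * a + 2 * (ϑ * h1) + w)) := by ring
  rw [id]
  clear id
  generalize (κ - 1 + ϑ) * (a + 2 * b + c2) = u1 at *
  generalize ϑ * (2 * b + c2) = u2 at *
  generalize (κ ^ 2 - 1 + 2 * ϑ) * (e + h1 + ϑ * a + g + h2 + ϑ * b) = u3 at *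
  generalize ϑ * (h1 + ϑ * a + g + h2 + ϑ * b) = u4 at *
  generalize (κ ^ 3 - 1 + 3 * ϑ) * (x + 2 * y + 2 * (ϑ * e) + ϑ ^ 2 * a + 2 * (ϑ * h1) + w) = u6 at *
  generalize ϑ * (2 * y + 2 * (ϑ * e) + ϑ ^ 2 * a + 2 * (ϑ * h1) + w) = u7 at *
  refine abs_le.2 ⟨?_, ?_⟩
  · linarith only [t1.1, t2.2, t3.2, t4.1, t6.1, t7.2, Q1'.2, R1'.1, hp3]
  · linarith only [t1.2, t2.1, t3.1, t4.2, t6.2, t7.1, Q1'.1, R1'.2, hp3]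

/-- scalar exponential expansion -/
theorem exp_expand {ϑ ε B L N R κ : ℝ} {n : ℕ} (hε : 0 ≤ ε) (hε1 : ε ≤ 1 / 2)
    (hϑ : |ϑ| ≤ ε ^ 2) (hB : 0 ≤ B) (hL : |L| ≤ 5 * ε * B) (hN : |N| ≤ 26 * ε ^ 2 * B)
    (hR : |R| ≤ 2000 * ε ^ 3 * B) (hκ : κ = (1 + ϑ)⁻¹) :
    |κ ^ n * Real.exp (-(L + N + R)) - (1 - n * ϑ - L - N + L ^ 2 / 2)|
      ≤ (cB n + 1000 * n + 2000 + 600000 + 1000 ^ 3) * ε ^ 3 * (1 + B) ^ 3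
        * Real.exp (1000 * ε * B) := by
  have hε2 : ε ^ 2 ≤ 1 / 2 * ε := by nlinarith
  have hε3 : ε ^ 3 ≤ 1 / 2 * ε ^ 2 := by nlinarith [sq_nonneg ε]
  have hϑ1 : |ϑ| ≤ 1 / 2 := hϑ.trans (by nlinarith)
  have hϑ2 : ϑ ^ 2 ≤ ε ^ 3 := by
    rw [← sq_abs]
    calc |ϑ| ^ 2 ≤ (ε ^ 2) ^ 2 := pow_le_pow_left₀ (abs_nonneg _) hϑ 2
      _ = ε ^ 3 * ε := by ring
      _ ≤ ε ^ 3 * 1 := by gcongr; linarith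
      _ = _ := by ring
  set x := L + N + R with hx
  have hNR : |N + R| ≤ 1026 * ε ^ 2 * B := by
    have h1 := abs_add_le N R
    have h2 := mul_le_mul_of_nonneg_right hε3 hB
    linarith only [h1, h2, hN, hR]
  have hxb : |x| ≤ 1000 * ε * B := by
    have h1 := abs_add_le L (N + R)
    rw [hx, add_assoc]
    have h2 := mul_le_mul_of_nonneg_right hε2 hB
    have h3 : 0 ≤ ε * B := by positivity
    linarith only [h1, h2, hL, hNR, h3]
  have hxL : |L + x| ≤ 1005 * ε * B := by
    have := abs_add_le L x
    linarith
  have hk := kap_bound hϑ1 n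
  rw [← hκ] at hk
  set σ := κ ^ n - 1 + n * ϑ with hσ
  have hσb : |σ| ≤ cB n * ε ^ 3 := hk.trans (mul_le_mul_of_nonneg_left hϑ2 (cB_nonneg n))
  set y := Real.exp (-x) with hy
  set D := Real.exp (1000 * ε * B) with hD
  have hxD : Real.exp |x| ≤ D := Real.exp_le_exp.2 hxb
  have hD1 : 1 ≤ D := Real.one_le_exp (by positivity)
  have hyD : |y| ≤ D := by
    rw [abs_of_pos (Real.exp_pos _)]
    exact (Real.exp_le_exp.2 (neg_le_abs x)).trans hxD
  have hy1 : |y - 1| ≤ 1000 * ε * B * D := (exp_bound1 x).trans (by gcongr)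
  have hy3 : |y - 1 + x - x ^ 2 / 2| ≤ (1000 * ε * B) ^ 3 * D := (exp_bound3 x).trans (by gcongr)
  have id : κ ^ n * y - (1 - n * ϑ - L - N + L ^ 2 / 2) =
      σ * y - n * (ϑ * (y - 1)) + ((y - 1 + x - x ^ 2 / 2) - R + (1 / 2) * ((N + R) * (L + x))) := by
    rw [hσ, hx]; ring
  rw [id]
  have t1 := mul_bd hσb hyD
  have t2 := mul_bd hϑ hy1
  have t3 := mul_bd hNR hxL
  have hn : (0:ℝ) ≤ n := by positivity
  have hc := cB_nonneg n
  have t2' : |n * (ϑ * (y - 1))| ≤ n * (ε ^ 2 * (1000 * ε * B * D)) := by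
    rw [abs_mul, abs_of_nonneg hn]; gcongr
  have hB1 : 1 ≤ (1 + B) ^ 3 := one_le_pow₀ (by linarith)
  have hB2 : B ≤ (1 + B) ^ 3 := by
    have h1 : 0 ≤ B ^ 2 := by positivity
    have h2 : 0 ≤ B ^ 3 := by positivity
    have h3 : (1 + B) ^ 3 = 1 + 3 * B + 3 * B ^ 2 + B ^ 3 := by ring
    linarith only [h1, h2, h3, hB]
  have hB3 : B ^ 2 ≤ (1 + B) ^ 3 := by
    have h1 : 0 ≤ B ^ 2 := by positivity
    have h2 : 0 ≤ B ^ 3 := by positivity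
    have h3 : (1 + B) ^ 3 = 1 + 3 * B + 3 * B ^ 2 + B ^ 3 := by ring
    linarith only [h1, h2, h3, hB]
  have hB4 : B ^ 3 ≤ (1 + B) ^ 3 := pow_le_pow_left₀ hB (by linarith) 3
  have hD0 : 0 ≤ D := by linarith
  calc _ ≤ |σ * y| + |n * (ϑ * (y - 1))| + (|y - 1 + x - x ^ 2 / 2| + |R| + (1 / 2) * |(N + R) * (L + x)|) := by
        refine (abs_add_le _ _).trans ?_
        refine add_le_add (abs_sub _ _) ?_
        refine (abs_add_le _ _).trans ?_
        refine add_le_add (abs_sub _ _) ?_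
        rw [abs_mul]; norm_num
    _ ≤ cB n * ε ^ 3 * D + n * (ε ^ 2 * (1000 * ε * B * D)) + ((1000 * ε * B) ^ 3 * D + 2000 * ε ^ 3 * B * D
          + (1 / 2) * (1026 * ε ^ 2 * B * (1005 * ε * B)) * D) := by
        have : |R| ≤ 2000 * ε ^ 3 * B * D := hR.trans (le_mul_of_one_le_right (by positivity) hD1)
        have h4 : (1 / 2) * |(N + R) * (L + x)| ≤ (1 / 2) * (1026 * ε ^ 2 * B * (1005 * ε * B)) * D :=
          (mul_le_mul_of_nonneg_left t3 (by norm_num)).trans (le_mul_of_one_le_right (by positivity) hD1)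
        linarith only [this, h4, t1, t2', hy3]
    _ = (cB n * 1 + 1000 * n * B + 1000 ^ 3 * B ^ 3 + 2000 * B + (1 / 2) * (1026 * 1005) * B ^ 2) * (ε ^ 3 * D) := by ring
    _ ≤ ((cB n + 1000 * n + 2000 + 600000 + 1000 ^ 3) * (1 + B) ^ 3) * (ε ^ 3 * D) := by
        refine mul_le_mul_of_nonneg_right ?_ (by positivity)
        have i1 := mul_le_mul_of_nonneg_left hB1 hc
        have i2 := mul_le_mul_of_nonneg_left hB2 (by positivity : 0 ≤ 1000 * (n:ℝ))
        linarith only [i1, i2, hB1, hB2, hB3, hB4]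
    _ = _ := by ring

/-- Taylor coefficient functions -/
def kt (M : E d →L[ℝ] E d) (p : E d × E d) : ℝ :=
  - (2 * d) + 4 * inner ℝ (M p.2) p.2 - 12 * inner ℝ (M p.2) p.1 + 9 * inner ℝ (M p.1) p.1
def kl (M : E d →L[ℝ] E d) (p : E d × E d) (ω : E d) : ℝ := - inner ℝ (M ((2:ℝ) • p.2 - (3:ℝ) • p.1)) ω
def kq (M : E d →L[ℝ] E d) (p : E d × E d) (ω : E d) : ℝ := - inner ℝ (M ω) ω + (kl M p ω) ^ 2 / 2

set_option maxHeartbeats 1000000 in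
theorem taylor_ker (d : ℕ) {cM CM : ℝ} (hc : 0 < cM) (hC : 0 < CM) : ∃ C ε₀ : ℝ, 0 < C ∧ 0 < ε₀ ∧ ε₀ ≤ 1 / 2 ∧
    ∀ (A : Fin d → Fin d → ℝ) (M : E d →L[ℝ] E d), Ell cM CM A M →
    ∀ (p : E d × E d) (ϑ ε : ℝ) (η ω : E d), 0 ≤ ε → ε ≤ ε₀ → |ϑ| ≤ ε ^ 2 → ‖η‖ ≤ ε ^ 3 → ‖ω‖ ≤ ε →
    |Gam M (1 + ϑ) (p.1 + η + ϑ • p.2) (p.2 + ω)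
      - Real.exp (- H1 M p) * (1 + ϑ * kt M p + kl M p ω + kq M p ω)|
      ≤ C * ε ^ 3 * (SS p ^ 6 * Real.exp (- (cM / 16) * qq p)) := by
  set c0 : ℝ := cB (2 * d) + 1000 * ((2 * d : ℕ) : ℝ) + 2000 + 600000 + 1000 ^ 3 with hc0
  have hc0p : 0 < c0 := by have := cB_nonneg (2 * d); positivity
  refine ⟨c0 * (1 + CM) ^ 3 * Real.exp (cM / 16), min (1 / 2) (cM / (48000 * CM)), by positivity,
    by positivity, min_le_left _ _, ?_⟩
  rintro A M hM ⟨ξ, ν⟩ ϑ ε η ω hε hε0 hϑ hη hω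
  have hε1 : ε ≤ 1 / 2 := hε0.trans (min_le_left _ _)
  have hε2 : ε * (48000 * CM) ≤ cM := by
    have := hε0.trans (min_le_right _ _)
    rwa [le_div_iff₀ (by positivity)] at this
  set S := SS (ξ, ν) with hS
  have hS1 : 1 ≤ S := SS_ge _
  have hξ : ‖ξ‖ ≤ S := by simp only [hS, SS]; linarith [norm_nonneg ν, norm_nonneg ξ]
  have hν : ‖ν‖ ≤ S := by simp only [hS, SS]; linarith [norm_nonneg ν, norm_nonneg ξ]
  set B := CM * S ^ 2 with hB
  have hB0 : 0 ≤ B := by positivity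
  have hεε : ε ^ 3 ≤ 1 := pow_le_one₀ hε (by linarith)
  have bd : ∀ (x y : E d) (k l : ℝ), ‖x‖ ≤ k * S → ‖y‖ ≤ l * S → 0 ≤ k → 0 ≤ l → |inner ℝ (M x) y| ≤ k * l * B := by
    intro x y k l hx hy hk hl
    refine (hM.bdd x y).trans ?_
    calc CM * (‖x‖ * ‖y‖) ≤ CM * ((k * S) * (l * S)) := by gcongr
      _ = _ := by rw [hB]; ring
  have hω' : ‖ω‖ ≤ ε * S := hω.trans (le_mul_of_one_le_right hε hS1)
  have hη' : ‖η‖ ≤ ε ^ 3 * S := hη.trans (le_mul_of_one_le_right (by positivity) hS1)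
  have hξ' : ‖ξ‖ ≤ 1 * S := by linarith
  have hν' : ‖ν‖ ≤ 1 * S := by linarith
  have e3 : 0 ≤ ε ^ 3 := by positivity
  have ba := bd ν ν 1 1 hν' hν' zero_le_one zero_le_one
  have be := bd ν ξ 1 1 hν' hξ' zero_le_one zero_le_one
  have bx := bd ξ ξ 1 1 hξ' hξ' zero_le_one zero_le_one
  have bb := bd ν ω 1 ε hν' hω' zero_le_one hε
  have bg := bd ω ξ ε 1 hω' hξ' hε zero_le_one
  have bc := bd ω ω ε ε hω' hω' hε hε
  have bh1 := bd ν η 1 (ε ^ 3) hν' hη' zero_le_one e3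
  have bh2 := bd ω η ε (ε ^ 3) hω' hη' hε e3
  have bw := bd η η (ε ^ 3) (ε ^ 3) hη' hη' e3 e3
  have by' := bd ξ η 1 (ε ^ 3) hξ' hη' zero_le_one e3
  have bh2' : |inner ℝ (M ω) η| ≤ ε ^ 3 * B := by
    refine bh2.trans ?_
    gcongr
    nlinarith
  have bw' : |inner ℝ (M η) η| ≤ ε ^ 3 * B := by
    refine bw.trans ?_
    gcongr
    nlinarith
  have hRb := rest_bound (ϑ := ϑ) (B := B) (a := inner ℝ (M ν) ν) (b := inner ℝ (M ν) ω) (c2 := inner ℝ (M ω) ω)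
    (e := inner ℝ (M ν) ξ) (g := inner ℝ (M ω) ξ) (h1 := inner ℝ (M ν) η) (h2 := inner ℝ (M ω) η)
    (x := inner ℝ (M ξ) ξ) (y := inner ℝ (M ξ) η) (w := inner ℝ (M η) η) hε hε1 hϑ hB0
    (by linarith) (by linarith) (by linarith) (by linarith) (by linarith) (by calc _ ≤ _ := bc
                                                                             _ = _ := by ring)
    (by linarith) bh2' (by linarith) bw' _ rfl
  obtain ⟨R, hRdef⟩ : ∃ R : ℝ, R = (1 + ϑ)⁻¹ * (inner ℝ (M ν) ν + 2 * inner ℝ (M ν) ω + inner ℝ (M ω) ω) -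
      3 * (1 + ϑ)⁻¹ ^ 2 * (inner ℝ (M ν) ξ + inner ℝ (M ν) η + ϑ * inner ℝ (M ν) ν + inner ℝ (M ω) ξ
        + inner ℝ (M ω) η + ϑ * inner ℝ (M ν) ω) +
      3 * (1 + ϑ)⁻¹ ^ 3 * (inner ℝ (M ξ) ξ + 2 * inner ℝ (M ξ) η + 2 * ϑ * inner ℝ (M ν) ξ
        + ϑ ^ 2 * inner ℝ (M ν) ν + 2 * ϑ * inner ℝ (M ν) η + inner ℝ (M η) η) -
      (inner ℝ (M ν) ν - 3 * inner ℝ (M ν) ξ + 3 * inner ℝ (M ξ) ξ) -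
      (2 * inner ℝ (M ν) ω - 3 * inner ℝ (M ω) ξ) -
      (inner ℝ (M ω) ω + ϑ * (-4 * inner ℝ (M ν) ν + 12 * inner ℝ (M ν) ξ - 9 * inner ℝ (M ξ) ξ)) := ⟨_, rfl⟩
  rw [← hRdef] at hRb
  set κ := (1 + ϑ)⁻¹ with hκ
  set L := 2 * inner ℝ (M ν) ω - 3 * inner ℝ (M ω) ξ with hL
  set N := inner ℝ (M ω) ω + ϑ * (- 4 * inner ℝ (M ν) ν + 12 * inner ℝ (M ν) ξ - 9 * inner ℝ (M ξ) ξ) with hN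
  have hLb : |L| ≤ 5 * ε * B := by
    have h1 := abs_le.1 bb
    have h2 := abs_le.1 bg
    rw [hL]; exact abs_le.2 ⟨by linarith only [h1.1, h2.2], by linarith only [h1.2, h2.1]⟩
  have hNb : |N| ≤ 26 * ε ^ 2 * B := by
    have i1 : |(- 4 * inner ℝ (M ν) ν + 12 * inner ℝ (M ν) ξ - 9 * inner ℝ (M ξ) ξ)| ≤ 25 * B := by
      have h1 := abs_le.1 ba
      have h2 := abs_le.1 be
      have h3 := abs_le.1 bx
      exact abs_le.2 ⟨by linarith only [h1.2, h2.1, h3.2], by linarith only [h1.1, h2.2, h3.1]⟩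
    have i2 := mul_bd hϑ i1
    rw [hN]
    refine (abs_add_le _ _).trans ?_
    have : ε * ε * B = ε ^ 2 * B := by ring
    linarith only [this, i2, bc]
  have main := exp_expand (n := 2 * d) hε hε1 hϑ hB0 hLb hNb hRb hκ
  have hlk : kl M (ξ, ν) ω = - L := by
    simp only [kl, hL, map_sub, map_smul, inner_sub_left, inner_smul_left, conj_trivial]
    rw [hM.symm ξ ω]
  have hsymν : inner ℝ (M ω) ν = inner ℝ (M ν) ω := hM.symm _ _
  have hpoly : 1 - ((2 * d : ℕ) : ℝ) * ϑ - L - N + L ^ 2 / 2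
      = 1 + ϑ * kt M (ξ, ν) + kl M (ξ, ν) ω + kq M (ξ, ν) ω := by
    rw [kq, hlk, kt, hN]; push_cast; ring
  have hH : HH M (1 + ϑ) (ξ + η + ϑ • ν) (ν + ω) = H1 M (ξ, ν) + (L + N + R) := by
    rw [hRdef, hL, hN, hκ]
    simp only [HH, H1, map_add, map_smul, inner_add_left, inner_add_right, inner_smul_left,
      inner_smul_right, conj_trivial, div_eq_mul_inv, ← inv_pow]
    rw [hM.symm ω ν, hM.symm η ν, hM.symm ξ ν, hM.symm η ξ]
    ring
  rw [Gam, hH, ← hpoly, neg_add, Real.exp_add, ← inv_pow]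
  have : κ ^ (2 * d) * (Real.exp (-H1 M (ξ, ν)) * Real.exp (-(L + N + R))) -
      Real.exp (-H1 M (ξ, ν)) * (1 - ((2 * d : ℕ) : ℝ) * ϑ - L - N + L ^ 2 / 2) =
      Real.exp (-H1 M (ξ, ν)) * (κ ^ (2 * d) * Real.exp (-(L + N + R)) - (1 - ((2 * d : ℕ) : ℝ) * ϑ - L - N + L ^ 2 / 2)) := by ring
  rw [this, abs_mul, abs_of_pos (Real.exp_pos _)]
  rw [← hc0] at main
  have f1 : (1 + B) ^ 3 ≤ (1 + CM) ^ 3 * S ^ 6 := by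
    have : 1 + B ≤ (1 + CM) * S ^ 2 := by
      have h1 : 1 ≤ S ^ 2 := one_le_pow₀ hS1
      rw [hB]; linarith only [h1]
    calc (1 + B) ^ 3 ≤ ((1 + CM) * S ^ 2) ^ 3 := by gcongr
      _ = _ := by ring
  have f2 : Real.exp (-H1 M (ξ, ν)) * Real.exp (1000 * ε * B) ≤ Real.exp (cM / 16) * Real.exp (- (cM / 16) * qq (ξ, ν)) := by
    rw [← Real.exp_add, ← Real.exp_add]
    apply Real.exp_le_exp.2
    have g1 := hM.H1_ge hc (ξ, ν)
    have g2 := SS_sq (ξ, ν)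
    have g3 := qq_nonneg (ξ, ν)
    have : 1000 * ε * B ≤ cM / 16 * (1 + qq (ξ, ν)) := by
      calc 1000 * ε * B = 1000 * ε * CM * S ^ 2 := by rw [hB]; ring
        _ ≤ 1000 * ε * CM * (3 * (1 + qq (ξ, ν))) := by gcongr
        _ = (ε * (48000 * CM)) * ((1 + qq (ξ, ν)) / 16) := by ring
        _ ≤ cM * ((1 + qq (ξ, ν)) / 16) := by gcongr
        _ = _ := by ring
    linarith only [this, g1, g3, hc]
  calc _ ≤ Real.exp (-H1 M (ξ, ν)) * (c0 * ε ^ 3 * (1 + B) ^ 3 * Real.exp (1000 * ε * B)) := by gcongr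
    _ = c0 * ε ^ 3 * (1 + B) ^ 3 * (Real.exp (-H1 M (ξ, ν)) * Real.exp (1000 * ε * B)) := by ring
    _ ≤ c0 * ε ^ 3 * ((1 + CM) ^ 3 * S ^ 6) * (Real.exp (cM / 16) * Real.exp (- (cM / 16) * qq (ξ, ν))) := by gcongr
    _ = _ := by ring

end KS

namespace KS
open Filter Topology Set

def gz (z : Z d) (ρ : ℝ) (p : E d × E d) : Z d :=
  (z.1 - ρ ^ 2, z.2.1 - ρ ^ 2 • z.2.2 + ρ ^ 3 • (p.2 - p.1), z.2.2 - ρ • p.2)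

def lag (s : ℝ) (p : E d × E d) : Z d := (s, p.1 + s • p.2, p.2)

def PP (z : Z d) (ρ : ℝ) (p : E d × E d) : E d × E d :=
  (z.2.1 - z.1 • (z.2.2 - ρ • p.2) - ρ ^ 3 • p.1, z.2.2 - ρ • p.2)

theorem lag_PP (z : Z d) (ρ : ℝ) (p : E d × E d) : lag (z.1 - ρ ^ 2) (PP z ρ p) = gz z ρ p := by
  refine Prod.ext rfl (Prod.ext ?_ rfl)
  simp only [lag, PP, gz]
  module

/-- change of variables -/
theorem cov (z : Z d) {ρ : ℝ} (hρ : 0 < ρ) (F : E d × E d → ℝ) :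
    ∫ p, F p = ρ ^ (4 * d) * ∫ p, F (PP z ρ p) := by
  obtain ⟨t, x, v⟩ := z
  -- shear
  let S : (E d × E d) ≃ₜ (E d × E d) :=
    { toFun := fun p => (p.1 + (x - t • (p.2 + v)), p.2 + v)
      invFun := fun p => (p.1 - (x - t • p.2), p.2 - v)
      left_inv := fun p => by ext1 <;> simp
      right_inv := fun p => by ext1 <;> simp
      continuous_toFun := by fun_prop
      continuous_invFun := by fun_prop }
  have hS : MeasurePreserving (S : E d × E d → E d × E d) := by
    have h1 : MeasurePreserving (fun p : E d × E d => (p.1 + v, p.2 + (x - t • (p.1 + v))))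
        ((volume : Measure (E d)).prod volume) ((volume : Measure (E d)).prod volume) := by
      refine MeasurePreserving.skew_product (f := fun w : E d => w + v) (measurePreserving_add_right _ _)
        (g := fun w q => q + (x - t • (w + v))) ?_ ?_
      · apply Continuous.measurable
        unfold Function.uncurry
        fun_prop
      · refine Eventually.of_forall fun w => ?_
        exact (measurePreserving_add_right _ _).map_eq
    have h2 := (Measure.measurePreserving_swap (μ := (volume : Measure (E d))) (ν := (volume : Measure (E d))))
    exact h2.comp (h1.comp h2)
  have e1 : ∫ p, F p = ∫ p, F (S p) :=
    (hS.integral_comp S.toMeasurableEquiv.measurableEmbedding F).symm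
  -- scaling
  have ha : -ρ ^ 3 ≠ 0 := neg_ne_zero.2 (by positivity)
  have hb : -ρ ≠ 0 := by simpa using hρ.ne'
  let D : (E d × E d) ≃ₜ (E d × E d) :=
    (Homeomorph.smulOfNeZero (-ρ ^ 3) ha).prodCongr (Homeomorph.smulOfNeZero (-ρ) hb)
  have hD : Measure.map D (volume : Measure (E d × E d)) = ENNReal.ofReal ((ρ ^ (4 * d))⁻¹) • volume := by
    have : (D : E d × E d → E d × E d) = Prod.map (fun y => (-ρ ^ 3) • y) (fun y => (-ρ) • y) := rfl
    rw [this, Measure.volume_eq_prod, ← Measure.map_prod_map _ _ (by fun_prop) (by fun_prop),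
      Measure.map_addHaar_smul _ ha, Measure.map_addHaar_smul _ hb, Measure.prod_smul_left,
      Measure.prod_smul_right, smul_smul, ← ENNReal.ofReal_mul (by positivity)]
    congr 2
    simp only [finrank_euclideanSpace, Fintype.card_fin, abs_inv, abs_pow, abs_neg, abs_of_pos hρ]
    rw [← mul_inv, ← pow_mul, ← pow_add]
    congr 2
    ring
  have e2 : ∫ p, F (S (D p)) = (ρ ^ (4 * d))⁻¹ * ∫ p, F (S p) := by
    have h1 : ∫ p, F (S p) ∂(Measure.map D volume) = ∫ p, F (S (D p)) :=
      integral_map_equiv D.toMeasurableEquiv (fun p => F (S p))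
    rw [← h1, hD, integral_smul_measure, ENNReal.toReal_ofReal (by positivity)]
    rfl
  have e3 : ∀ p, S (D p) = PP (t, x, v) ρ p := by
    intro p
    refine Prod.ext ?_ ?_
    · change (-ρ ^ 3) • p.1 + (x - t • ((-ρ) • p.2 + v)) = x - t • (v - ρ • p.2) - ρ ^ 3 • p.1
      module
    · change (-ρ) • p.2 + v = v - ρ • p.2
      module
  simp only [e3] at e2
  rw [e2, e1, ← mul_assoc, mul_inv_cancel₀ (by positivity), one_mul]

def Kp (M : E d →L[ℝ] E d) (z : Z d) (s : ℝ) (p : E d × E d) : ℝ :=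
  Gam M (z.1 - s) (z.2.1 - p.1 - z.1 • p.2) (z.2.2 - p.2)

/-- kernel integral seen from base point `z₁` -/
theorem lag_int (M : E d →L[ℝ] E d) (h : Z d → ℝ) (z z₁ : Z d) {ρ : ℝ} (hρ : 0 < ρ) :
    ∫ p, h (lag (z₁.1 - ρ ^ 2) p) * Kp M z (z₁.1 - ρ ^ 2) p =
    ∫ p, h (gz z₁ ρ p) * Gam M (1 + (z.1 - z₁.1) / ρ ^ 2)
      (p.1 + (ρ ^ 3)⁻¹ • (z.2.1 - z₁.2.1 - (z.1 - z₁.1) • z₁.2.2) + ((z.1 - z₁.1) / ρ ^ 2) • p.2)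
      (p.2 + ρ⁻¹ • (z.2.2 - z₁.2.2)) := by
  rw [cov z₁ hρ, ← integral_const_mul]
  congr 1
  ext p
  rw [lag_PP]
  have e : Kp M z (z₁.1 - ρ ^ 2) (PP z₁ ρ p) = (ρ ^ (4 * d))⁻¹ * Gam M (1 + (z.1 - z₁.1) / ρ ^ 2)
      (p.1 + (ρ ^ 3)⁻¹ • (z.2.1 - z₁.2.1 - (z.1 - z₁.1) • z₁.2.2) + ((z.1 - z₁.1) / ρ ^ 2) • p.2)
      (p.2 + ρ⁻¹ • (z.2.2 - z₁.2.2)) := by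
    rw [← Gam_scale M hρ, Kp]
    congr 1
    · field_simp; ring
    · simp only [PP, smul_add, smul_smul]
      rw [mul_inv_cancel₀ (by positivity), show ρ ^ 3 * ((z.1 - z₁.1) / ρ ^ 2) = (z.1 - z₁.1) * ρ by field_simp]
      module
    · simp only [PP, smul_add, smul_smul]
      rw [mul_inv_cancel₀ (by positivity)]
      module
  rw [e]
  have : ρ ^ (4 * d) ≠ 0 := by positivity
  field_simp

theorem lag_int_self (M : E d →L[ℝ] E d) (h : Z d → ℝ) (z : Z d) {ρ : ℝ} (hρ : 0 < ρ) :
    ∫ p, h (lag (z.1 - ρ ^ 2) p) * Kp M z (z.1 - ρ ^ 2) p =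
    ∫ p, h (gz z ρ p) * Real.exp (- H1 M p) := by
  rw [lag_int M h z z hρ]
  simp [Gam_one]

/-! ### derivatives of the kernel -/

def qv (z : Z d) (s : ℝ) (p : E d × E d) : E d :=
  (3 / (z.1 - s) ^ 2) • (z.2.1 - p.1 - z.1 • p.2) - (1 / (z.1 - s)) • (z.2.2 - p.2)

theorem inv_pow_deriv {T : ℝ} (hT : 0 < T) (n : ℕ) :
    HasDerivAt (fun T : ℝ => (T ^ n)⁻¹) (- (n / T) * (T ^ n)⁻¹) T := by
  have := (hasDerivAt_pow n T).inv (by positivity)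
  refine this.congr_deriv ?_
  cases n with
  | zero => simp
  | succ n =>
    simp only [Nat.add_sub_cancel]
    field_simp
    try ring

theorem Gam_T_deriv {cM CM : ℝ} {A : Fin d → Fin d → ℝ} {M : E d →L[ℝ] E d} (h : Ell cM CM A M)
    {T : ℝ} (hT : 0 < T) (X V : E d) :
    HasDerivAt (fun T => Gam M T X V)
      (Gam M T X V * (inner ℝ (M ((3 / T ^ 2) • X - (1 / T) • V)) ((3 / T ^ 2) • X - (1 / T) • V) - 2 * d / T)) T := by
  have h1 := inv_pow_deriv hT (2 * d)
  have i1 := (inv_pow_deriv hT 1).const_mul (inner ℝ (M V) V)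
  have i2 := (inv_pow_deriv hT 2).const_mul (3 * inner ℝ (M V) X)
  have i3 := (inv_pow_deriv hT 3).const_mul (3 * inner ℝ (M X) X)
  have h2 : HasDerivAt (fun T => HH M T X V) (- inner ℝ (M ((3 / T ^ 2) • X - (1 / T) • V)) ((3 / T ^ 2) • X - (1 / T) • V)) T := by
    have := (i1.sub i2).add i3
    refine (this.congr_of_eventuallyEq (Eventually.of_forall fun S => ?_)).congr_deriv ?_
    · simp [HH, div_eq_mul_inv]
    · simp only [map_sub, map_smul, inner_sub_left, inner_sub_right, inner_smul_left, inner_smul_right, conj_trivial]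
      rw [h.symm X V]
      field_simp
      push_cast
      ring
  have := h1.mul h2.neg.exp
  refine this.congr_deriv ?_
  simp only [Gam, Pi.neg_apply]
  push_cast
  ring

theorem HH_line {cM CM : ℝ} {A : Fin d → Fin d → ℝ} {M : E d →L[ℝ] E d} (h : Ell cM CM A M)
    {τ : ℝ} (hτ : 0 < τ) (X V e : E d) (r : ℝ) :
    HH M τ (X - (r * τ) • e) (V - r • e) = HH M τ X V
      - r * inner ℝ (M ((3 / τ ^ 2) • X - (1 / τ) • V)) e + r ^ 2 * (inner ℝ (M e) e / τ) := by
  simp only [HH, map_sub, map_smul, inner_sub_left, inner_sub_right, inner_smul_left, inner_smul_right, conj_trivial]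
  rw [h.symm e V, h.symm e X]
  field_simp
  ring

theorem Kp_line {cM CM : ℝ} {A : Fin d → Fin d → ℝ} {M : E d →L[ℝ] E d} (h : Ell cM CM A M)
    (z : Z d) {s : ℝ} (hs : s < z.1) (p : E d × E d) (i : Fin d) :
    HasLineDerivAt ℝ (Kp M z s) (Kp M z s p * (M (qv z s p)) i) p ((-s) • ee i, ee i) := by
  have hτ : 0 < z.1 - s := by linarith
  unfold HasLineDerivAt
  have e1 : ∀ r : ℝ, Kp M z s (p + r • ((-s) • ee i, ee i)) = ((z.1 - s) ^ (2 * d))⁻¹ *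
      Real.exp (-(HH M (z.1 - s) (z.2.1 - p.1 - z.1 • p.2) (z.2.2 - p.2)
      - r * inner ℝ (M (qv z s p)) (ee i) + r ^ 2 * (inner ℝ (M (ee i)) (ee i) / (z.1 - s)))) := by
    intro r
    rw [qv, ← HH_line h hτ, Kp, Gam]
    congr 4
    · simp only [Prod.fst_add, Prod.snd_add, Prod.smul_fst, Prod.smul_snd]
      module
    · simp only [Prod.fst_add, Prod.snd_add, Prod.smul_fst, Prod.smul_snd]
      module
  simp only [e1]
  have h1 : HasDerivAt (fun r : ℝ => (HH M (z.1 - s) (z.2.1 - p.1 - z.1 • p.2) (z.2.2 - p.2)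
      - r * inner ℝ (M (qv z s p)) (ee i) + r ^ 2 * (inner ℝ (M (ee i)) (ee i) / (z.1 - s))))
      (- inner ℝ (M (qv z s p)) (ee i)) 0 := by
    have a := (((hasDerivAt_id (0:ℝ)).mul_const (inner ℝ (M (qv z s p)) (ee i))).const_sub
      (HH M (z.1 - s) (z.2.1 - p.1 - z.1 • p.2) (z.2.2 - p.2))).add
      ((hasDerivAt_pow 2 (0:ℝ)).mul_const (inner ℝ (M (ee i)) (ee i) / (z.1 - s)))
    refine a.congr_deriv ?_
    simp
  refine (h1.neg.exp.const_mul _).congr_deriv ?_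
  have : inner ℝ (M (qv z s p)) (ee i) = (M (qv z s p)) i := by
    simp [ee, EuclideanSpace.inner_single_right]
  rw [this, Kp, Gam]
  simp
  ring

theorem qv_line (M : E d →L[ℝ] E d) (z : Z d) {s : ℝ} (hs : s < z.1) (p : E d × E d) (i j : Fin d) :
    HasLineDerivAt ℝ (fun p => (M (qv z s p)) i) (- (2 / (z.1 - s)) * (M (ee j)) i) p ((-s) • ee j, ee j) := by
  have hτ : z.1 - s ≠ 0 := by linarith
  unfold HasLineDerivAt
  have e1 : ∀ r : ℝ, (M (qv z s (p + r • ((-s) • ee j, ee j)))) i = (M (qv z s p)) i - r * (2 / (z.1 - s) * (M (ee j)) i) := by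
    intro r
    have : qv z s (p + r • ((-s) • ee j, ee j)) = qv z s p - (r * (2 / (z.1 - s))) • ee j := by
      simp only [qv, Prod.fst_add, Prod.snd_add, Prod.smul_fst, Prod.smul_snd]
      have : (r * (2 / (z.1 - s))) = (3 / (z.1 - s) ^ 2) * (r * (z.1 - s)) - (1 / (z.1 - s)) * r := by
        field_simp; ring
      rw [this]
      module
    rw [this, map_sub, map_smul]
    simp
    ring
  simp only [e1]
  have := (((hasDerivAt_id (0:ℝ)).mul_const (2 / (z.1 - s) * (M (ee j)) i)).const_sub ((M (qv z s p)) i))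
  exact this.congr_deriv (by ring)

theorem Kp_cont (M : E d →L[ℝ] E d) (z : Z d) {s : ℝ} (hs : s < z.1) : Continuous (Kp M z s) := by
  have hτ : z.1 - s ≠ 0 := by linarith
  unfold Kp Gam HH
  fun_prop (disch := positivity)

theorem Kp_contOn (M : E d →L[ℝ] E d) (z : Z d) :
    ContinuousOn (fun w : ℝ × (E d × E d) => Kp M z w.1 w.2) {w | w.1 < z.1} := by
  unfold Kp Gam HH
  have : ∀ w ∈ {w : ℝ × (E d × E d) | w.1 < z.1}, z.1 - w.1 ≠ 0 := fun w hw => by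
    have : w.1 < z.1 := hw
    linarith
  have h2 : ∀ n, ∀ w ∈ {w : ℝ × (E d × E d) | w.1 < z.1}, (z.1 - w.1) ^ n ≠ 0 := fun n w hw => pow_ne_zero _ (this w hw)
  fun_prop (disch := first | exact this | exact h2 _)

theorem qv_contOn (z : Z d) :
    ContinuousOn (fun w : ℝ × (E d × E d) => qv z w.1 w.2) {w | w.1 < z.1} := by
  unfold qv
  have : ∀ w ∈ {w : ℝ × (E d × E d) | w.1 < z.1}, z.1 - w.1 ≠ 0 := fun w hw => by
    have : w.1 < z.1 := hw
    linarith
  have h2 : ∀ n, ∀ w ∈ {w : ℝ × (E d × E d) | w.1 < z.1}, (z.1 - w.1) ^ n ≠ 0 := fun n w hw => pow_ne_zero _ (this w hw)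
  fun_prop (disch := first | exact this | exact h2 _)

theorem qv_cont (z : Z d) (s : ℝ) : Continuous (qv z s) := by
  unfold qv
  fun_prop

end KS

namespace KS
open Filter Topology Set

theorem deriv_zero_of_ev {f : ℝ → ℝ} {a : ℝ} (h : HasDerivAt f a 0) (h0 : ∀ᶠ s in 𝓝 (0:ℝ), f s = 0) : a = 0 := by
  have h1 : HasDerivAt f 0 0 := (hasDerivAt_const (0:ℝ) (0:ℝ)).congr_of_eventuallyEq h0
  exact h.unique h1

theorem KD.zero_off {u Yu : Z d → ℝ} {ui : Fin d → Z d → ℝ} {uij : Fin d → Fin d → Z d → ℝ}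
    (hu : KD u Yu ui uij) {K : Set (Z d)} (hK : IsClosed K) (h0 : ∀ z ∉ K, u z = 0) :
    (∀ z ∉ K, Yu z = 0) ∧ (∀ i, ∀ z ∉ K, ui i z = 0) ∧ (∀ i j, ∀ z ∉ K, uij i j z = 0) := by
  have hopen : IsOpen Kᶜ := hK.isOpen_compl
  have hev : ∀ (z : Z d), z ∉ K → ∀ γ : ℝ → Z d, Continuous γ → γ 0 = z → ∀ᶠ s in 𝓝 (0:ℝ), γ s ∉ K := by
    intro z hz γ hγ h
    have : γ ⁻¹' Kᶜ ∈ 𝓝 (0:ℝ) := (hopen.preimage hγ).mem_nhds (by simpa [h] using hz)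
    exact this
  have h1 : ∀ i, ∀ z ∉ K, ui i z = 0 := by
    rintro i ⟨t, x, v⟩ hz
    refine deriv_zero_of_ev (hu.hv i t x v) ?_
    filter_upwards [hev _ hz (fun s : ℝ => (t, x, v + s • ee i)) (by fun_prop) (by simp)] with s hs
    exact h0 _ hs
  refine ⟨?_, h1, ?_⟩
  · rintro ⟨t, x, v⟩ hz
    refine deriv_zero_of_ev (hu.hY t x v) ?_
    filter_upwards [hev _ hz (fun s : ℝ => (t + s, x + s • v, v)) (by fun_prop) (by simp)] with s hs
    exact h0 _ hs
  · rintro i j ⟨t, x, v⟩ hz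
    refine deriv_zero_of_ev (hu.hvv i j t x v) ?_
    filter_upwards [hev _ hz (fun s : ℝ => (t, x, v + s • ee i)) (by fun_prop) (by simp)] with s hs
    exact h1 j _ hs

theorem lag_cont : Continuous (fun w : ℝ × (E d × E d) => lag w.1 w.2) := by
  unfold lag; fun_prop

theorem lag_cont' (s : ℝ) : Continuous (lag (d := d) s) := by
  unfold lag; fun_prop

/-- compact set in `p` -/
def Kpre (K : Set (Z d)) : Set (E d × E d) :=
  (fun z : Z d => (z.2.1 - z.1 • z.2.2, z.2.2)) '' K

theorem Kpre_compact {K : Set (Z d)} (hK : IsCompact K) : IsCompact (Kpre K) := by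
  apply hK.image
  fun_prop

theorem lag_mem {K : Set (Z d)} {s : ℝ} {p : E d × E d} (h : lag s p ∈ K) : p ∈ Kpre K :=
  ⟨_, h, by simp [lag]⟩

theorem int_lag {K : Set (Z d)} (hK : IsCompact K) {h : Z d → ℝ} (hc : Continuous h) (h0 : ∀ z ∉ K, h z = 0)
    {k : E d × E d → ℝ} (hk : Continuous k) (s : ℝ) : Integrable (fun p => h (lag s p) * k p) := by
  have h1 : Continuous fun p => h (lag s p) * k p := (hc.comp (lag_cont' s)).mul hk
  apply h1.integrable_of_hasCompactSupport
  refine HasCompactSupport.of_support_subset_isCompact (Kpre_compact hK) ?_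
  intro p hp
  by_contra hn
  apply hp
  have : lag s p ∉ K := fun hh => hn (lag_mem hh)
  simp [h0 _ this]

theorem lag_line {f f' : Z d → ℝ} {i : Fin d}
    (h : ∀ (t : ℝ) (x v : E d), HasDerivAt (fun s : ℝ => f (t, x, v + s • ee i)) (f' (t, x, v)) 0)
    (s : ℝ) (p : E d × E d) : HasLineDerivAt ℝ (fun p => f (lag s p)) (f' (lag s p)) p ((-s) • ee i, ee i) := by
  unfold HasLineDerivAt
  have e : ∀ r : ℝ, lag s (p + r • (((-s) • ee i, ee i) : E d × E d)) = (s, p.1 + s • p.2, p.2 + r • ee i) := by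
    intro r
    refine Prod.ext rfl (Prod.ext ?_ rfl)
    simp only [lag, Prod.fst_add, Prod.snd_add, Prod.smul_fst, Prod.smul_snd]
    module
  simp only [e]
  exact h s _ _

theorem ibp {f f' g g' : E d × E d → ℝ} {e : E d × E d} (hf : ∀ p, HasLineDerivAt ℝ f (f' p) p e)
    (hg : ∀ p, HasLineDerivAt ℝ g (g' p) p e) (h1 : Integrable fun p => f' p * g p)
    (h2 : Integrable fun p => f p * g' p) (h3 : Integrable fun p => f p * g p) :
    ∫ p, f' p * g p = - ∫ p, f p * g' p := by
  haveI : (volume : Measure (E d × E d)).IsAddHaarMeasure := by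
    rw [Measure.volume_eq_prod]
    exact Measure.prod.instIsAddHaarMeasure _ _
  have := integral_bilinear_hasLineDerivAt_right_eq_neg_left_of_integrable (μ := (volume : Measure (E d × E d)))
    (B := ContinuousLinearMap.mul ℝ ℝ) (f := f) (f' := f') (g := g) (g' := g') (v := e) h1 h2 h3
    (fun x _ => hf x) (fun x _ => hg x)
  simp only [ContinuousLinearMap.mul_apply'] at this
  rw [this, neg_neg]

variable {cM CM : ℝ} {A : Fin d → Fin d → ℝ} {M : E d →L[ℝ] E d}
  {u Yu : Z d → ℝ} {ui : Fin d → Z d → ℝ} {uij : Fin d → Fin d → Z d → ℝ} {K : Set (Z d)}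

theorem comp_cont (M : E d →L[ℝ] E d) (z : Z d) (s : ℝ) (i : Fin d) : Continuous (fun p => (M (qv z s p)) i) := by
  have := qv_cont z s
  fun_prop

theorem Ell.int_uij (h : Ell cM CM A M) (hu : KD u Yu ui uij) (hK : IsCompact K) (h0 : ∀ z ∉ K, u z = 0)
    (z : Z d) {s : ℝ} (hs : s < z.1) (i j : Fin d) :
    ∫ p, uij i j (lag s p) * Kp M z s p = ∫ p, u (lag s p) * (Kp M z s p * ((M (qv z s p)) j * (M (qv z s p)) i
      - (2 / (z.1 - s)) * (M (ee j)) i)) := by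
  obtain ⟨hY0, hi0, hij0⟩ := hu.zero_off hK.isClosed h0
  have cK := Kp_cont M z hs
  have cq := comp_cont M z s
  rw [ibp (f := fun p => ui j (lag s p)) (g := Kp M z s) (e := ((-s) • ee i, ee i))
    (fun p => lag_line (hu.hvv i j) s p) (fun p => Kp_line h z hs p i)
    (int_lag hK (hu.cvv i j) (hij0 i j) cK s)
    (int_lag hK (hu.cv j) (hi0 j) (cK.mul (cq i)) s) (int_lag hK (hu.cv j) (hi0 j) cK s)]
  have hg : ∀ p, HasLineDerivAt ℝ (fun p => Kp M z s p * (M (qv z s p)) i)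
      (Kp M z s p * (M (qv z s p)) j * (M (qv z s p)) i + Kp M z s p * (- (2 / (z.1 - s)) * (M (ee j)) i)) p
      ((-s) • ee j, ee j) := by
    intro p
    have a := Kp_line h z hs p j
    have b := qv_line M z hs p i j
    unfold HasLineDerivAt at *
    refine (HasDerivAt.mul a b).congr_deriv ?_
    simp only [zero_smul, add_zero]
  have cg : Continuous fun p => (Kp M z s p * (M (qv z s p)) j * (M (qv z s p)) i + Kp M z s p * (- (2 / (z.1 - s)) * (M (ee j)) i)) :=
    ((cK.mul (cq j)).mul (cq i)).add (cK.mul continuous_const)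
  rw [ibp (f := fun p => u (lag s p)) (g := fun p => Kp M z s p * (M (qv z s p)) i) (e := ((-s) • ee j, ee j))
    (fun p => lag_line (hu.hv j) s p) hg
    (int_lag hK (hu.cv j) (hi0 j) (cK.mul (cq i)) s)
    (int_lag hK hu.cu h0 cg s) (int_lag hK hu.cu h0 (cK.mul (cq i)) s), neg_neg]
  congr 1
  ext p
  ring

def LA (A : Fin d → Fin d → ℝ) (Yu : Z d → ℝ) (uij : Fin d → Fin d → Z d → ℝ) (z : Z d) : ℝ :=
  Yu z - ∑ i, ∑ j, A i j * uij i j z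

theorem Ell.int_f (h : Ell cM CM A M) (hu : KD u Yu ui uij) (hK : IsCompact K) (h0 : ∀ z ∉ K, u z = 0)
    (z : Z d) {s : ℝ} (hs : s < z.1) :
    ∫ p, LA A Yu uij (lag s p) * Kp M z s p = ∫ p, (Yu (lag s p) * Kp M z s p - u (lag s p) *
      (Kp M z s p * (inner ℝ (M (qv z s p)) (qv z s p) - 2 * d / (z.1 - s)))) := by
  obtain ⟨hY0, hi0, hij0⟩ := hu.zero_off hK.isClosed h0
  have cK := Kp_cont M z hs
  have cq := comp_cont M z s
  have cq' := qv_cont z s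
  have e1 : ∀ p, LA A Yu uij (lag s p) * Kp M z s p = Yu (lag s p) * Kp M z s p
      - ∑ i, ∑ j, A i j * (uij i j (lag s p) * Kp M z s p) := by
    intro p
    rw [LA, sub_mul, Finset.sum_mul]
    congr 1
    refine Finset.sum_congr rfl fun i _ => ?_
    rw [Finset.sum_mul]
    exact Finset.sum_congr rfl fun j _ => by ring
  have e2 : ∀ p, u (lag s p) * (Kp M z s p * (inner ℝ (M (qv z s p)) (qv z s p) - 2 * d / (z.1 - s))) =
      ∑ i, ∑ j, A i j * (u (lag s p) * (Kp M z s p * ((M (qv z s p)) j * (M (qv z s p)) i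
      - (2 / (z.1 - s)) * (M (ee j)) i))) := by
    intro p
    rw [← h.quad (qv z s p) (qv z s p)]
    rw [show 2 * (d:ℝ) / (z.1 - s) = (2 / (z.1 - s)) * (d:ℝ) by ring, ← h.tr]
    simp only [Finset.mul_sum, ← Finset.sum_sub_distrib]
    exact Finset.sum_congr rfl fun i _ => Finset.sum_congr rfl fun j _ => by ring
  simp only [e1, e2]
  have I1 : ∀ i j, Integrable fun p => A i j * (uij i j (lag s p) * Kp M z s p) := fun i j =>
    (int_lag hK (hu.cvv i j) (hij0 i j) cK s).const_mul _
  have I2 : ∀ i j, Integrable fun p => A i j * (u (lag s p) * (Kp M z s p * ((M (qv z s p)) j * (M (qv z s p)) i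
      - (2 / (z.1 - s)) * (M (ee j)) i))) := fun i j =>
    (int_lag hK hu.cu h0 (cK.mul (((cq j).mul (cq i)).sub continuous_const)) s).const_mul _
  rw [integral_sub (int_lag hK hu.cY hY0 cK s)
      (integrable_finsetSum _ fun i _ => integrable_finsetSum _ fun j _ => I1 i j),
    integral_sub (int_lag hK hu.cY hY0 cK s)
      (integrable_finsetSum _ fun i _ => integrable_finsetSum _ fun j _ => I2 i j)]
  congr 1
  rw [integral_finsetSum _ (fun i _ => integrable_finsetSum _ fun j _ => I1 i j),
    integral_finsetSum _ (fun i _ => integrable_finsetSum _ fun j _ => I2 i j)]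
  refine Finset.sum_congr rfl fun i _ => ?_
  rw [integral_finsetSum _ (fun j _ => I1 i j), integral_finsetSum _ (fun j _ => I2 i j)]
  refine Finset.sum_congr rfl fun j _ => ?_
  rw [integral_const_mul, integral_const_mul, h.int_uij hu hK h0 z hs]

theorem Ell.Phi_deriv (h : Ell cM CM A M) (hu : KD u Yu ui uij) (hK : IsCompact K) (h0 : ∀ z ∉ K, u z = 0)
    (z : Z d) {s : ℝ} (hs : s < z.1) :
    HasDerivAt (fun s => ∫ p, u (lag s p) * Kp M z s p) (∫ p, LA A Yu uij (lag s p) * Kp M z s p) s := by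
  obtain ⟨hY0, hi0, hij0⟩ := hu.zero_off hK.isClosed h0
  rw [h.int_f hu hK h0 z hs]
  set F' : ℝ → E d × E d → ℝ := fun s p => (Yu (lag s p) * Kp M z s p - u (lag s p) *
      (Kp M z s p * (inner ℝ (M (qv z s p)) (qv z s p) - 2 * d / (z.1 - s)))) with hF'
  set b := (s + z.1) / 2 with hb
  have hbz : b < z.1 := by rw [hb]; linarith
  have hsb : s < b := by rw [hb]; linarith
  have hC : ContinuousOn (fun w : ℝ × (E d × E d) => F' w.1 w.2) (Icc (s - 1) b ×ˢ Kpre K) := by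
    have hsub : Icc (s - 1) b ×ˢ Kpre K ⊆ {w : ℝ × (E d × E d) | w.1 < z.1} := by
      rintro w ⟨hw, -⟩
      exact lt_of_le_of_lt hw.2 hbz
    have c1 := (Kp_contOn M z).mono hsub
    have c2 := (qv_contOn z).mono hsub
    have c3 := (hu.cY.comp lag_cont).continuousOn (s := Icc (s - 1) b ×ˢ Kpre K)
    have c4 := (hu.cu.comp lag_cont).continuousOn (s := Icc (s - 1) b ×ˢ Kpre K)
    have c5 : ContinuousOn (fun w : ℝ × (E d × E d) => 2 * (d:ℝ) / (z.1 - w.1)) (Icc (s - 1) b ×ˢ Kpre K) := by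
      refine ContinuousOn.div (by fun_prop) (by fun_prop) ?_
      intro w hw
      have : w.1 < z.1 := hsub hw
      linarith
    have c6 : ContinuousOn (fun w : ℝ × (E d × E d) => inner ℝ (M (qv z w.1 w.2)) (qv z w.1 w.2)) (Icc (s - 1) b ×ˢ Kpre K) :=
      (M.continuous.comp_continuousOn c2).inner c2
    exact (c3.mul c1).sub (c4.mul (c1.mul (c6.sub c5)))
  obtain ⟨C, hCb⟩ := (isCompact_Icc.prod (Kpre_compact hK)).exists_bound_of_continuousOn hC
  refine (hasDerivAt_integral_of_dominated_loc_of_deriv_le (F' := F') (bound := (Kpre K).indicator (fun _ => C))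
    (s := Ioo (s - 1) b) (Ioo_mem_nhds (by linarith) hsb) ?_ (int_lag hK hu.cu h0 (Kp_cont M z hs) s) ?_ ?_ ?_ ?_).2
  · filter_upwards [Iio_mem_nhds hs] with r hr
    exact (int_lag hK hu.cu h0 (Kp_cont M z hr) r).aestronglyMeasurable
  · have cK := Kp_cont M z hs
    have cq' := qv_cont z s
    have c3 := (hu.cY.comp (lag_cont' s))
    have c4 := (hu.cu.comp (lag_cont' s))
    refine Continuous.aestronglyMeasurable ?_
    rw [hF']
    exact (c3.mul cK).sub (c4.mul (cK.mul (((M.continuous.comp cq').inner cq').sub continuous_const)))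
  · refine Eventually.of_forall fun p r hr => ?_
    by_cases hp : p ∈ Kpre K
    · rw [indicator_of_mem hp]
      exact hCb (r, p) ⟨⟨hr.1.le, hr.2.le⟩, hp⟩
    · rw [indicator_of_notMem hp]
      have : lag r p ∉ K := fun hh => hp (lag_mem hh)
      simp [hF', h0 _ this, hY0 _ this]
  · rw [integrable_indicator_iff (Kpre_compact hK).measurableSet]
    exact integrableOn_const (Kpre_compact hK).measure_lt_top.ne
  · refine Eventually.of_forall fun p r hr => ?_
    have hrz : r < z.1 := hr.2.trans hbz
    have a : HasDerivAt (fun r => u (lag r p)) (Yu (lag r p)) r := by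
      apply shift_deriv
      have := hu.hY r (p.1 + r • p.2) p.2
      refine (this.congr_of_eventuallyEq (Eventually.of_forall fun τ => ?_))
      simp only [lag]
      congr 3
      module
    have b' : HasDerivAt (fun r => Kp M z r p)
        (- (Kp M z r p * (inner ℝ (M (qv z r p)) (qv z r p) - 2 * d / (z.1 - r)))) r := by
      have := (Gam_T_deriv h (T := z.1 - r) (by linarith) (z.2.1 - p.1 - z.1 • p.2) (z.2.2 - p.2)).scomp r
        ((hasDerivAt_id r).const_sub z.1)
      refine this.congr_deriv ?_
      simp [Kp, qv]
    refine (a.mul b').congr_deriv ?_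
    rw [hF']
    ring

end KS

namespace KS
open Filter Topology Set

variable {cM CM : ℝ} {A : Fin d → Fin d → ℝ} {M : E d →L[ℝ] E d}
  {u Yu : Z d → ℝ} {ui : Fin d → Z d → ℝ} {uij : Fin d → Fin d → Z d → ℝ} {K : Set (Z d)}

/-- averaged quantity -/
def JJ (h : Z d → ℝ) (k : E d × E d → ℝ) (z : Z d) (s : ℝ) : ℝ :=
  ∫ p, h (gz z (√(z.1 - s)) p) * k p

theorem gz_cont (z : Z d) : Continuous (fun w : ℝ × (E d × E d) => gz z w.1 w.2) := by
  unfold gz; fun_prop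

theorem gz_cont_s (z : Z d) (p : E d × E d) : Continuous (fun s : ℝ => gz z (√(z.1 - s)) p) := by
  unfold gz; fun_prop

theorem gz_cont_p (z : Z d) (ρ : ℝ) : Continuous (gz z ρ) := by
  unfold gz; fun_prop

theorem JJ_int {h : Z d → ℝ} (hc : Continuous h) {B : ℝ} (hB : ∀ z, |h z| ≤ B) {k : E d × E d → ℝ}
    (hk : Integrable k) (z : Z d) (ρ : ℝ) : Integrable (fun p => h (gz z ρ p) * k p) := by
  refine hk.bdd_mul (c := B) ((hc.comp (gz_cont_p z ρ)).aestronglyMeasurable) ?_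
  exact Eventually.of_forall fun p => hB _

theorem JJ_cont {h : Z d → ℝ} (hc : Continuous h) {B : ℝ} (hB : ∀ z, |h z| ≤ B) {k : E d × E d → ℝ}
    (hk : Integrable k) (z : Z d) : Continuous (JJ h k z) := by
  unfold JJ
  refine continuous_of_dominated (bound := fun p => B * |k p|) ?_ ?_ ?_ ?_
  · intro s
    exact (JJ_int hc hB hk z _).aestronglyMeasurable
  · intro s
    refine Eventually.of_forall fun p => ?_
    rw [norm_mul]
    exact mul_le_mul_of_nonneg_right (hB _) (norm_nonneg _)
  · exact hk.abs.const_mul B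
  · refine Eventually.of_forall fun p => ?_
    exact (hc.comp (gz_cont_s z p)).mul continuous_const

theorem bdd_of_supp {h : Z d → ℝ} (hc : Continuous h) (hK : IsCompact K) (h0 : ∀ z ∉ K, h z = 0) :
    ∃ B, ∀ z, |h z| ≤ B := by
  obtain ⟨C, hC⟩ := hK.exists_bound_of_continuousOn hc.continuousOn
  refine ⟨max C 0, fun z => ?_⟩
  by_cases hz : z ∈ K
  · exact (hC z hz).trans (le_max_left _ _)
  · simp [h0 z hz]

theorem LA_cont (hu : KD u Yu ui uij) : Continuous (LA A Yu uij) := by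
  have h1 := hu.cY
  have h2 := hu.cvv
  unfold LA
  fun_prop

theorem LA_zero (hu : KD u Yu ui uij) (hK : IsClosed K) (h0 : ∀ z ∉ K, u z = 0) :
    ∀ z ∉ K, LA A Yu uij z = 0 := by
  obtain ⟨hY0, hi0, hij0⟩ := hu.zero_off hK h0
  intro z hz
  simp [LA, hY0 z hz, hij0 _ _ z hz]

/-- kernel weight -/
def kk (M : E d →L[ℝ] E d) (p : E d × E d) : ℝ := Real.exp (- H1 M p)

theorem JJ_self (M : E d →L[ℝ] E d) (h : Z d → ℝ) (z : Z d) {s : ℝ} (hs : s < z.1) :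
    ∫ p, h (lag s p) * Kp M z s p = JJ h (kk M) z s := by
  have hp : 0 < √(z.1 - s) := Real.sqrt_pos.2 (by linarith)
  have := lag_int_self M h z hp
  rw [Real.sq_sqrt (by linarith), sub_sub_cancel] at this
  exact this

theorem JJ_end (M : E d →L[ℝ] E d) (h : Z d → ℝ) (z : Z d) : JJ h (kk M) z z.1 = ZM M * h z := by
  have e : ∀ p, gz z (√(z.1 - z.1)) p = z := by
    intro p
    simp [gz]
  simp only [JJ, e]
  rw [integral_const_mul, mul_comm]
  rfl

theorem Ell.rep (h : Ell cM CM A M) (hc : 0 < cM) (hu : KD u Yu ui uij) (hK : IsCompact K) (h0 : ∀ z ∉ K, u z = 0)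
    (z : Z d) {s₀ : ℝ} (hs : s₀ ≤ z.1) (hs0 : ∀ ζ : Z d, ζ.1 ≤ s₀ → u ζ = 0) :
    ZM M * u z = ∫ s in s₀..z.1, JJ (LA A Yu uij) (kk M) z s := by
  have hk : Integrable (kk M) := h.int_exp hc
  obtain ⟨B, hB⟩ := bdd_of_supp hu.cu hK h0
  obtain ⟨B', hB'⟩ := bdd_of_supp (LA_cont (A := A) hu) hK (LA_zero hu hK.isClosed h0)
  have c1 := JJ_cont hu.cu hB hk z
  have c2 := JJ_cont (LA_cont (A := A) hu) hB' hk z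
  rw [intervalIntegral.integral_eq_sub_of_hasDerivAt_of_le hs c1.continuousOn (f' := JJ (LA A Yu uij) (kk M) z) ?_ (c2.intervalIntegrable _ _)]
  · rw [JJ_end]
    have : JJ u (kk M) z s₀ = 0 := by
      rw [JJ]
      have e : ∀ p, u (gz z (√(z.1 - s₀)) p) = 0 := by
        intro p
        apply hs0
        simp only [gz]
        rw [Real.sq_sqrt (by linarith)]
        linarith
      simp [e]
    rw [this, sub_zero]
  · intro s hs'
    rw [← JJ_self M _ z hs'.2]
    refine (h.Phi_deriv hu hK h0 z hs'.2).congr_of_eventuallyEq ?_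
    filter_upwards [Iio_mem_nhds hs'.2] with r hr
    exact (JJ_self M u z hr).symm

end KS

namespace KS
open Filter Topology Set

variable {cM CM : ℝ} {A : Fin d → Fin d → ℝ} {M : E d →L[ℝ] E d}
  {u Yu : Z d → ℝ} {ui : Fin d → Z d → ℝ} {uij : Fin d → Fin d → Z d → ℝ} {K : Set (Z d)}

theorem gz_mem (z : Z d) {ρ : ℝ} (hρ : 0 < ρ) (p : E d × E d) : gz z ρ p ∈ kCyl (2 * ρ * SS p) z := by
  have hS := SS_ge p
  have h1 : ‖p.1‖ + ‖p.2‖ < 2 * SS p := by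
    unfold SS; linarith [norm_nonneg p.1, norm_nonneg p.2]
  have h2 : ‖p.2‖ < 2 * SS p := by
    unfold SS; linarith [norm_nonneg p.1, norm_nonneg p.2]
  refine ⟨?_, ?_, ?_, ?_⟩
  · simp only [gz]
    have : ρ ^ 2 < (2 * ρ * SS p) ^ 2 := by
      apply pow_lt_pow_left₀ _ hρ.le (by norm_num)
      nlinarith
    linarith
  · simp only [gz]
    linarith [sq_nonneg ρ]
  · have e : (gz z ρ p).2.1 - z.2.1 - ((gz z ρ p).1 - z.1) • z.2.2 = ρ ^ 3 • (p.2 - p.1) := by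
      simp only [gz]; module
    rw [e, norm_smul, Real.norm_of_nonneg (by positivity)]
    have h3 : ‖p.2 - p.1‖ < (2 * SS p) ^ 3 := by
      have := norm_sub_le p.2 p.1
      have h4 : (2 * SS p) ≤ (2 * SS p) ^ 3 := le_self_pow₀ (by linarith) (by norm_num)
      linarith
    calc ρ ^ 3 * ‖p.2 - p.1‖ < ρ ^ 3 * (2 * SS p) ^ 3 := mul_lt_mul_of_pos_left h3 (by positivity)
      _ = _ := by ring
  · have e : (gz z ρ p).2.2 - z.2.2 = - (ρ • p.2) := by
      simp only [gz]; module
    rw [e, norm_neg, norm_smul, Real.norm_of_nonneg hρ.le]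
    nlinarith

theorem gz_mem' {z z₁ : Z d} {r ρ : ℝ} (hr : 0 < r) (hz : z ∈ kCyl r z₁) (hρ : 0 < ρ) (p : E d × E d) :
    gz z ρ p ∈ kCyl (r + 2 * ρ * SS p) z₁ := by
  have hS := SS_ge p
  exact kCyl_sub hr (by positivity) hz (gz_mem z hρ p)

theorem kk_le (h : Ell cM CM A M) (hc : 0 < cM) (p : E d × E d) : kk M p ≤ Real.exp (- (cM / 16) * qq p) := by
  refine Real.exp_le_exp.2 ?_
  have := h.H1_ge hc p
  have := mul_nonneg hc.le (qq_nonneg p)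
  linarith

theorem kk_pos (M : E d →L[ℝ] E d) (p : E d × E d) : 0 < kk M p := Real.exp_pos _

theorem kk_cont (M : E d →L[ℝ] E d) : Continuous (kk M) := by
  have := H1_cont M
  unfold kk; fun_prop

theorem kk_mul_int (h : Ell cM CM A M) (hc : 0 < cM) (k : ℕ) {f : E d × E d → ℝ} (hf : Continuous f) {B : ℝ}
    (hB : ∀ p, |f p| ≤ B * SS p ^ k) : Integrable (fun p => kk M p * f p) := by
  refine int_of_le (c := cM / 16) (by positivity) k ((kk_cont M).mul hf) (B := B) ?_
  intro p
  rw [abs_mul, abs_of_pos (kk_pos M p)]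
  have h0 : 0 ≤ B * SS p ^ k := (abs_nonneg _).trans (hB p)
  calc kk M p * |f p| ≤ Real.exp (- (cM / 16) * qq p) * (B * SS p ^ k) :=
        mul_le_mul (kk_le h hc p) (hB p) (abs_nonneg _) (Real.exp_pos _).le
    _ = _ := by ring

/-- matrix coefficient kernel -/
def km (M : E d →L[ℝ] E d) (i j : Fin d) (p : E d × E d) : ℝ :=
  - (inner ℝ (M (ee i)) (ee j) + inner ℝ (M (ee j)) (ee i)) + kl M p (ee i) * kl M p (ee j)

theorem kt_bd (h : Ell cM CM A M) (hC : 0 < CM) (p : E d × E d) : |kt M p| ≤ (2 * d + 25 * CM) * SS p ^ 2 := by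
  have h1 := h.bdd p.2 p.2
  have h2 := h.bdd p.2 p.1
  have h3 := h.bdd p.1 p.1
  have hS := SS_ge p
  have n1 : ‖p.1‖ ≤ SS p := by unfold SS; linarith [norm_nonneg p.1, norm_nonneg p.2]
  have n2 : ‖p.2‖ ≤ SS p := by unfold SS; linarith [norm_nonneg p.1, norm_nonneg p.2]
  have m : ∀ {a b : ℝ}, 0 ≤ a → 0 ≤ b → a ≤ SS p → b ≤ SS p → CM * (a * b) ≤ CM * SS p ^ 2 := by
    intro a b ha hb h1 h2
    refine mul_le_mul_of_nonneg_left ?_ hC.le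
    rw [sq]; exact mul_le_mul h1 h2 hb (by linarith)
  have h1' := h1.trans (m (norm_nonneg _) (norm_nonneg _) n2 n2)
  have h2' := h2.trans (m (norm_nonneg _) (norm_nonneg _) n2 n1)
  have h3' := h3.trans (m (norm_nonneg _) (norm_nonneg _) n1 n1)
  have hS2 : 1 ≤ SS p ^ 2 := one_le_pow₀ hS
  have hd : (2 * (d:ℝ)) ≤ 2 * d * SS p ^ 2 := le_mul_of_one_le_right (by positivity) hS2
  have hd0 : (0:ℝ) ≤ d := Nat.cast_nonneg d
  obtain ⟨a1, b1⟩ := abs_le.1 h1'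
  obtain ⟨a2, b2⟩ := abs_le.1 h2'
  obtain ⟨a3, b3⟩ := abs_le.1 h3'
  unfold kt
  refine abs_le.2 ⟨?_, ?_⟩
  · linarith only [a1, b1, a2, b2, a3, b3, hd, hd0]
  · linarith only [a1, b1, a2, b2, a3, b3, hd, hd0]

theorem kl_bd (h : Ell cM CM A M) (hC : 0 < CM) (i : Fin d) (p : E d × E d) : |kl M p (ee i)| ≤ (3 * CM) * SS p ^ 1 := by
  unfold kl
  rw [abs_neg]
  refine (h.bdd _ _).trans ?_
  rw [norm_ee, mul_one, pow_one, mul_comm 3, mul_assoc]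
  refine mul_le_mul_of_nonneg_left ?_ hC.le
  refine (norm_sub_le _ _).trans ?_
  rw [norm_smul, norm_smul]
  simp only [Real.norm_ofNat]
  unfold SS
  linarith [norm_nonneg p.1, norm_nonneg p.2]

theorem km_bd (h : Ell cM CM A M) (hC : 0 < CM) (i j : Fin d) (p : E d × E d) :
    |km M i j p| ≤ (2 * CM + 9 * CM ^ 2) * SS p ^ 2 := by
  have h1 := h.bdd (ee i) (ee j)
  have h2 := h.bdd (ee j) (ee i)
  rw [norm_ee, norm_ee, mul_one, mul_one] at h1 h2
  have h3 := mul_bd (kl_bd h hC i p) (kl_bd h hC j p)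
  have hS2 : 1 ≤ SS p ^ 2 := one_le_pow₀ (SS_ge p)
  have h4 : CM ≤ CM * SS p ^ 2 := le_mul_of_one_le_right hC.le hS2
  unfold km
  obtain ⟨a1, b1⟩ := abs_le.1 h1
  obtain ⟨a2, b2⟩ := abs_le.1 h2
  obtain ⟨a3, b3⟩ := abs_le.1 h3
  refine abs_le.2 ⟨?_, ?_⟩
  · nlinarith only [a1, b1, a2, b2, a3, b3, h4]
  · nlinarith only [a1, b1, a2, b2, a3, b3, h4]

theorem kt_cont (M : E d →L[ℝ] E d) : Continuous (kt M) := by unfold kt; fun_prop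
theorem kl_cont (M : E d →L[ℝ] E d) (ω : E d) : Continuous (fun p => kl M p ω) := by unfold kl; fun_prop
theorem km_cont (M : E d →L[ℝ] E d) (i j : Fin d) : Continuous (km M i j) := by
  have := kl_cont M
  unfold km; fun_prop

theorem vec_sum (ω : E d) : ω = ∑ i, ω i • (ee i : E d) := by
  ext j
  simp [ee, Pi.single_apply]

theorem kl_sum (M : E d →L[ℝ] E d) (p : E d × E d) (ω : E d) : kl M p ω = ∑ i, ω i * kl M p (ee i) := by
  unfold kl
  conv_lhs => rw [vec_sum ω]
  simp [inner_sum, inner_smul_right]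

theorem kq_sum (M : E d →L[ℝ] E d) (p : E d × E d) (ω : E d) :
    kq M p ω = (1 / 2) * ∑ i, ∑ j, km M i j p * ω i * ω j := by
  have h2 : inner ℝ (M ω) ω = ∑ i, ∑ j, inner ℝ (M (ee j)) (ee i) * ω i * ω j := by
    conv_lhs => rw [vec_sum ω]
    simp only [map_sum, map_smul, sum_inner, inner_sum, inner_smul_right, real_inner_smul_left]
    refine Finset.sum_congr rfl fun i _ => ?_
    simp only [Finset.mul_sum]
    refine Finset.sum_congr rfl fun j _ => by ring
  have h1 : inner ℝ (M ω) ω = ∑ i, ∑ j, inner ℝ (M (ee i)) (ee j) * ω i * ω j := by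
    rw [h2, Finset.sum_comm]
    exact Finset.sum_congr rfl fun i _ => Finset.sum_congr rfl fun j _ => by ring
  have h3 : (kl M p ω) ^ 2 = ∑ i, ∑ j, (kl M p (ee i) * kl M p (ee j)) * ω i * ω j := by
    rw [kl_sum, sq, Finset.sum_mul_sum]
    exact Finset.sum_congr rfl fun i _ => Finset.sum_congr rfl fun j _ => by ring
  have h4 : ∑ i, ∑ j, km M i j p * ω i * ω j = - (inner ℝ (M ω) ω + inner ℝ (M ω) ω) + (kl M p ω) ^ 2 := by
    rw [h3]; nth_rewrite 1 [h1]; rw [h2]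
    simp only [← Finset.sum_add_distrib, ← Finset.sum_neg_distrib]
    exact Finset.sum_congr rfl fun i _ => Finset.sum_congr rfl fun j _ => by unfold km; ring
  rw [h4, kq]; ring

end KS

namespace KS
open Filter Topology Set

variable {cM CM : ℝ} {A : Fin d → Fin d → ℝ} {M : E d →L[ℝ] E d}
  {u Yu : Z d → ℝ} {ui : Fin d → Z d → ℝ} {uij : Fin d → Fin d → Z d → ℝ} {K : Set (Z d)}

/-- Gaussian moment -/
def Wt (d : ℕ) (c : ℝ) (k : ℕ) : ℝ := ∫ p : E d × E d, SS p ^ k * Real.exp (- (c / 16) * qq p)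

theorem Wt_nonneg (d : ℕ) (c : ℝ) (k : ℕ) : 0 ≤ Wt d c k := by
  refine integral_nonneg fun p => ?_
  have := SS_ge p
  positivity

theorem tay_integral {X : Type*} [MeasurableSpace X] {μ : Measure X} {c b : X → ℝ} {q : X → Fin d → ℝ}
    {m : X → Fin d → Fin d → ℝ} (hc : Integrable c μ) (hb : Integrable b μ) (hq : ∀ i, Integrable (fun x => q x i) μ)
    (hm : ∀ i j, Integrable (fun x => m x i j) μ) (z₁ z : Z d) :
    Integrable (fun x => tay (c x) (b x) (q x) (m x) z₁ z) μ ∧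
    ∫ x, tay (c x) (b x) (q x) (m x) z₁ z ∂μ =
      tay (∫ x, c x ∂μ) (∫ x, b x ∂μ) (fun i => ∫ x, q x i ∂μ) (fun i j => ∫ x, m x i j ∂μ) z₁ z := by
  have i1 : Integrable (fun x => b x * (z.1 - z₁.1)) μ := hb.mul_const _
  have i2 : ∀ i ∈ Finset.univ, Integrable (fun x => q x i * (z.2.2 i - z₁.2.2 i)) μ := fun i _ => (hq i).mul_const _
  have i2' := integrable_finsetSum _ i2
  have i3 : ∀ i j, Integrable (fun x => m x i j * (z.2.2 i - z₁.2.2 i) * (z.2.2 j - z₁.2.2 j)) μ :=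
    fun i j => ((hm i j).mul_const _).mul_const _
  have i4 : ∀ i ∈ Finset.univ, Integrable (fun x => ∑ j, m x i j * (z.2.2 i - z₁.2.2 i) * (z.2.2 j - z₁.2.2 j)) μ :=
    fun i _ => integrable_finsetSum _ fun j _ => i3 i j
  have i5 := (integrable_finsetSum _ i4).const_mul (1 / 2)
  unfold tay
  have i6 : Integrable (fun x => c x + b x * (z.1 - z₁.1)) μ := hc.add i1
  have i7 : Integrable (fun x => c x + b x * (z.1 - z₁.1) + ∑ i, q x i * (z.2.2 i - z₁.2.2 i)) μ := i6.add i2'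
  refine ⟨i7.add i5, ?_⟩
  rw [integral_add i7 i5, integral_add i6 i2', integral_add hc i1,
    integral_finsetSum _ i2, integral_const_mul, integral_finsetSum _ i4, integral_mul_const]
  congr 2
  · simp only [integral_mul_const]
  · refine Finset.sum_congr rfl fun i _ => ?_
    rw [integral_finsetSum _ fun j _ => i3 i j]
    simp only [integral_mul_const]

section
variable {h : Z d → ℝ} {α F : ℝ} {z₁ : Z d}

theorem JJ_near (hE : Ell cM CM A M) (hc : 0 < cM) (hF0 : 0 ≤ F) (hα0 : 0 < α) (hα1 : α < 1)
    (hF : ∀ r : ℝ, 0 < r → ∀ ζ ∈ kCyl r z₁, |h ζ| ≤ F * r ^ α) {r κ : ℝ} (hr : 0 < r) (hκ : 0 ≤ κ) {z : Z d}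
    (hz : z ∈ kCyl r z₁) {s : ℝ} (hsr : √(z.1 - s) ≤ κ * r) :
    |JJ h (kk M) z s| ≤ F * r ^ α * (1 + 2 * κ) * Wt d cM 1 := by
  have hm0 : ∀ p, gz z (√(z.1 - s)) p ∈ kCyl (r + 2 * √(z.1 - s) * SS p) z₁ := by
    intro p
    rcases (Real.sqrt_nonneg (z.1 - s)).eq_or_lt with h0 | hρ
    · rw [← h0]
      simpa [gz] using hz
    · exact gz_mem' hr hz hρ p
  unfold JJ Wt
  rw [← integral_const_mul, ← Real.norm_eq_abs]
  refine norm_integral_le_of_norm_le ((int_weight (d := d) (c := cM / 16) (by positivity) 1).const_mul _) ?_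
  refine Eventually.of_forall fun p => ?_
  have hS := SS_ge p
  have hm := hm0 p
  have h1 := hF _ (by positivity) _ hm
  have h2 : r + 2 * √(z.1 - s) * SS p ≤ r * ((1 + 2 * κ) * SS p) := by
    have : √(z.1 - s) * SS p ≤ κ * r * SS p := mul_le_mul_of_nonneg_right hsr (by linarith)
    nlinarith
  have h3 : 1 ≤ (1 + 2 * κ) * SS p := by nlinarith
  have h4 : (r + 2 * √(z.1 - s) * SS p) ^ α ≤ r ^ α * ((1 + 2 * κ) * SS p) := by
    refine (Real.rpow_le_rpow (by positivity) h2 hα0.le).trans ?_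
    rw [Real.mul_rpow hr.le (by positivity)]
    refine mul_le_mul_of_nonneg_left ?_ (by positivity)
    calc ((1 + 2 * κ) * SS p) ^ α ≤ ((1 + 2 * κ) * SS p) ^ (1:ℝ) := Real.rpow_le_rpow_of_exponent_le h3 hα1.le
      _ = _ := Real.rpow_one _
  rw [norm_mul, Real.norm_eq_abs, Real.norm_eq_abs, abs_of_pos (kk_pos M p), pow_one]
  calc |h (gz z (√(z.1 - s)) p)| * kk M p ≤ (F * (r ^ α * ((1 + 2 * κ) * SS p))) * Real.exp (- (cM / 16) * qq p) :=
        mul_le_mul (h1.trans (mul_le_mul_of_nonneg_left h4 hF0)) (kk_le hE hc p) (kk_pos M p).le (by positivity)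
    _ = _ := by ring

/-- the tay polynomial of the kernel integral -/
def JT (h : Z d → ℝ) (M : E d →L[ℝ] E d) (z₁ z : Z d) (s : ℝ) : ℝ :=
  tay (JJ h (kk M) z₁ s) (((√(z₁.1 - s)) ^ 2)⁻¹ * JJ h (fun p => kk M p * kt M p) z₁ s)
    (fun i => (√(z₁.1 - s))⁻¹ * JJ h (fun p => kk M p * kl M p (ee i)) z₁ s)
    (fun i j => ((√(z₁.1 - s)) ^ 2)⁻¹ * JJ h (fun p => kk M p * km M i j p) z₁ s) z₁ z

theorem JT_eq (hE : Ell cM CM A M) (hc : 0 < cM) (hC : 0 < CM) (hcont : Continuous h) {B : ℝ} (hB : ∀ z, |h z| ≤ B)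
    (z₁ z : Z d) {s : ℝ} :
    Integrable (fun p => h (gz z₁ (√(z₁.1 - s)) p) * (kk M p * (1 + ((z.1 - z₁.1) / (√(z₁.1 - s)) ^ 2) * kt M p
      + kl M p ((√(z₁.1 - s))⁻¹ • (z.2.2 - z₁.2.2)) + kq M p ((√(z₁.1 - s))⁻¹ • (z.2.2 - z₁.2.2))))) ∧
    ∫ p, h (gz z₁ (√(z₁.1 - s)) p) * (kk M p * (1 + ((z.1 - z₁.1) / (√(z₁.1 - s)) ^ 2) * kt M p
      + kl M p ((√(z₁.1 - s))⁻¹ • (z.2.2 - z₁.2.2)) + kq M p ((√(z₁.1 - s))⁻¹ • (z.2.2 - z₁.2.2))))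
     = JT h M z₁ z s := by
  set ρ := √(z₁.1 - s) with hρ
  have I1 := JJ_int hcont hB (hE.int_exp hc) z₁ ρ
  have I2 := JJ_int hcont hB (kk_mul_int hE hc 2 (kt_cont M) (kt_bd hE hC)) z₁ ρ
  have I3 := fun i => JJ_int hcont hB (kk_mul_int hE hc 1 (kl_cont M (ee i)) (kl_bd hE hC i)) z₁ ρ
  have I4 := fun i j => JJ_int hcont hB (kk_mul_int hE hc 2 (km_cont M i j) (km_bd hE hC i j)) z₁ ρ
  have key := tay_integral (c := fun p => h (gz z₁ ρ p) * kk M p)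
    (b := fun p => (ρ ^ 2)⁻¹ * (h (gz z₁ ρ p) * (kk M p * kt M p)))
    (q := fun p i => ρ⁻¹ * (h (gz z₁ ρ p) * (kk M p * kl M p (ee i))))
    (m := fun p i j => (ρ ^ 2)⁻¹ * (h (gz z₁ ρ p) * (kk M p * km M i j p)))
    I1 (I2.const_mul _) (fun i => (I3 i).const_mul _) (fun i j => (I4 i j).const_mul _) z₁ z
  have e : ∀ p, h (gz z₁ ρ p) * (kk M p * (1 + ((z.1 - z₁.1) / ρ ^ 2) * kt M p
      + kl M p (ρ⁻¹ • (z.2.2 - z₁.2.2)) + kq M p (ρ⁻¹ • (z.2.2 - z₁.2.2)))) =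
      tay (h (gz z₁ ρ p) * kk M p) ((ρ ^ 2)⁻¹ * (h (gz z₁ ρ p) * (kk M p * kt M p)))
      (fun i => ρ⁻¹ * (h (gz z₁ ρ p) * (kk M p * kl M p (ee i))))
      (fun i j => (ρ ^ 2)⁻¹ * (h (gz z₁ ρ p) * (kk M p * km M i j p))) z₁ z := by
    intro p
    rw [kl_sum, kq_sum, tay]
    have e1 : ∑ i, ρ⁻¹ * (h (gz z₁ ρ p) * (kk M p * kl M p (ee i))) * (z.2.2 i - z₁.2.2 i)
        = h (gz z₁ ρ p) * kk M p * ∑ i, (ρ⁻¹ • (z.2.2 - z₁.2.2)) i * kl M p (ee i) := by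
      rw [Finset.mul_sum]
      refine Finset.sum_congr rfl fun i _ => ?_
      simp only [PiLp.smul_apply, PiLp.sub_apply, smul_eq_mul]
      ring
    have e2 : ∑ i, ∑ j, (ρ ^ 2)⁻¹ * (h (gz z₁ ρ p) * (kk M p * km M i j p)) * (z.2.2 i - z₁.2.2 i) * (z.2.2 j - z₁.2.2 j)
        = h (gz z₁ ρ p) * kk M p * ∑ i, ∑ j, km M i j p * (ρ⁻¹ • (z.2.2 - z₁.2.2)) i * (ρ⁻¹ • (z.2.2 - z₁.2.2)) j := by
      simp only [Finset.mul_sum]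
      refine Finset.sum_congr rfl fun i _ => Finset.sum_congr rfl fun j _ => ?_
      simp only [PiLp.smul_apply, PiLp.sub_apply, smul_eq_mul]
      ring
    rw [e1, e2]
    ring
  simp only [e]
  refine ⟨key.1, key.2.trans ?_⟩
  unfold JT JJ
  simp only [integral_const_mul, hρ]

theorem Gam_cont (M : E d →L[ℝ] E d) (T : ℝ) (η ω : E d) (ϑ : ℝ) :
    Continuous (fun p : E d × E d => Gam M T (p.1 + η + ϑ • p.2) (p.2 + ω)) := by
  unfold Gam HH; fun_prop

theorem JJ_far {C ε₀ : ℝ}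
    (hT : ∀ (A : Fin d → Fin d → ℝ) (M : E d →L[ℝ] E d), Ell cM CM A M →
    ∀ (p : E d × E d) (ϑ ε : ℝ) (η ω : E d), 0 ≤ ε → ε ≤ ε₀ → |ϑ| ≤ ε ^ 2 → ‖η‖ ≤ ε ^ 3 → ‖ω‖ ≤ ε →
    |Gam M (1 + ϑ) (p.1 + η + ϑ • p.2) (p.2 + ω)
      - Real.exp (- H1 M p) * (1 + ϑ * kt M p + kl M p ω + kq M p ω)|
      ≤ C * ε ^ 3 * (SS p ^ 6 * Real.exp (- (cM / 16) * qq p)))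
    (hC' : 0 < C) (hε₀ : ε₀ ≤ 1 / 2)
    (hE : Ell cM CM A M) (hc : 0 < cM) (hC : 0 < CM) (hcont : Continuous h) {B : ℝ} (hB : ∀ z, |h z| ≤ B)
    (hF0 : 0 ≤ F) (hα0 : 0 < α) (hα1 : α < 1)
    (hF : ∀ r : ℝ, 0 < r → ∀ ζ ∈ kCyl r z₁, |h ζ| ≤ F * r ^ α) {r : ℝ} (hr : 0 < r) {z : Z d}
    (hz : z ∈ kCyl r z₁) {s : ℝ} (hs : s < z₁.1) (hsr : r ≤ ε₀ * √(z₁.1 - s)) :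
    |JJ h (kk M) z s - JT h M z₁ z s| ≤ (2 * C * F * Wt d cM 7) * r ^ 3 * (√(z₁.1 - s)) ^ (α - 3) := by
  have hρ : 0 < √(z₁.1 - s) := Real.sqrt_pos.2 (by linarith)
  have hρ2 : (√(z₁.1 - s)) ^ 2 = z₁.1 - s := Real.sq_sqrt (by linarith)
  obtain ⟨JI, JE⟩ := JT_eq hE hc hC hcont hB z₁ z (s := s)
  set ρ := √(z₁.1 - s) with hρd
  obtain ⟨z1, z2, z3, z4⟩ := hz
  have hsz : s < z.1 := by
    have : r < ρ := by nlinarith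
    have : r ^ 2 < ρ ^ 2 := pow_lt_pow_left₀ this hr.le (by norm_num)
    linarith
  have e1 := lag_int M h z z₁ hρ
  rw [hρ2, sub_sub_cancel, JJ_self M h z hsz, ← hρ2] at e1
  rw [e1]
  set ϑ := (z.1 - z₁.1) / ρ ^ 2 with hϑ
  set η := (ρ ^ 3)⁻¹ • (z.2.1 - z₁.2.1 - (z.1 - z₁.1) • z₁.2.2) with hη
  set ω := ρ⁻¹ • (z.2.2 - z₁.2.2) with hω
  have b1 : |ϑ| ≤ (r / ρ) ^ 2 := by
    rw [hϑ, abs_div, abs_of_pos (pow_pos hρ 2), div_pow]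
    refine div_le_div_of_nonneg_right ?_ (by positivity)
    rw [abs_le]; constructor <;> nlinarith
  have b2 : ‖η‖ ≤ (r / ρ) ^ 3 := by
    rw [hη, norm_smul, norm_inv, Real.norm_of_nonneg (by positivity), div_pow, inv_mul_eq_div]
    exact div_le_div_of_nonneg_right z3.le (by positivity)
  have b3 : ‖ω‖ ≤ r / ρ := by
    rw [hω, norm_smul, norm_inv, Real.norm_of_nonneg (by positivity), inv_mul_eq_div]
    exact div_le_div_of_nonneg_right z4.le (by positivity)
  have b4 : r / ρ ≤ ε₀ := (div_le_iff₀ hρ).2 hsr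
  have hR : ∀ p, |Gam M (1 + ϑ) (p.1 + η + ϑ • p.2) (p.2 + ω) - kk M p * (1 + ϑ * kt M p + kl M p ω + kq M p ω)|
      ≤ C * (r / ρ) ^ 3 * (SS p ^ 6 * Real.exp (- (cM / 16) * qq p)) :=
    fun p => hT A M hE p ϑ (r / ρ) η ω (by positivity) b4 b1 b2 b3
  have cR : Continuous fun p => Gam M (1 + ϑ) (p.1 + η + ϑ • p.2) (p.2 + ω) - kk M p * (1 + ϑ * kt M p + kl M p ω + kq M p ω) := by
    have c1 := Gam_cont M (1 + ϑ) η ω ϑ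
    have c2 := kk_cont M
    have c3 := kt_cont M
    have c4 := kl_cont M ω
    have c5 : Continuous (fun p => kq M p ω) := by unfold kq; fun_prop
    exact c1.sub (c2.mul (((continuous_const.add (continuous_const.mul c3)).add c4).add c5))
  have IR := JJ_int hcont hB (int_of_le (c := cM / 16) (by positivity) 6 cR hR) z₁ ρ
  have e2 : (∫ p, h (gz z₁ ρ p) * Gam M (1 + ϑ) (p.1 + η + ϑ • p.2) (p.2 + ω))
      - JT h M z₁ z s = ∫ p, h (gz z₁ ρ p) * (Gam M (1 + ϑ) (p.1 + η + ϑ • p.2) (p.2 + ω) - kk M p * (1 + ϑ * kt M p + kl M p ω + kq M p ω)) := by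
    have : ∀ p, h (gz z₁ ρ p) * Gam M (1 + ϑ) (p.1 + η + ϑ • p.2) (p.2 + ω) =
      h (gz z₁ ρ p) * (Gam M (1 + ϑ) (p.1 + η + ϑ • p.2) (p.2 + ω) - kk M p * (1 + ϑ * kt M p + kl M p ω + kq M p ω))
      + h (gz z₁ ρ p) * (kk M p * (1 + ϑ * kt M p + kl M p ω + kq M p ω)) := fun p => by ring
    simp only [this]
    rw [integral_add IR JI, JE, add_sub_cancel_right]
  rw [e2]
  have e3 : (2 * C * F * Wt d cM 7) * r ^ 3 * ρ ^ (α - 3) =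
      ∫ p : E d × E d, (2 * C * F * r ^ 3 * ρ ^ (α - 3)) * (SS p ^ 7 * Real.exp (- (cM / 16) * qq p)) := by
    rw [integral_const_mul, Wt]; ring
  rw [e3, ← Real.norm_eq_abs]
  refine norm_integral_le_of_norm_le ((int_weight (d := d) (c := cM / 16) (by positivity) 7).const_mul _) ?_
  refine Eventually.of_forall fun p => ?_
  have hS := SS_ge p
  have h1 := hF _ (by positivity) _ (gz_mem z₁ hρ p)
  have h4 : (2 * ρ * SS p) ^ α ≤ 2 * ρ ^ α * SS p := by
    rw [show 2 * ρ * SS p = ρ * (2 * SS p) by ring, Real.mul_rpow hρ.le (by positivity)]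
    have : (2 * SS p) ^ α ≤ (2 * SS p) ^ (1:ℝ) := Real.rpow_le_rpow_of_exponent_le (by linarith) hα1.le
    rw [Real.rpow_one] at this
    calc ρ ^ α * (2 * SS p) ^ α ≤ ρ ^ α * (2 * SS p) := mul_le_mul_of_nonneg_left this (by positivity)
      _ = _ := by ring
  have h5 : ρ ^ (α - 3) = ρ ^ α / ρ ^ 3 := by
    rw [Real.rpow_sub hρ]; norm_num
  rw [Real.norm_eq_abs]
  refine (mul_bd (h1.trans (mul_le_mul_of_nonneg_left h4 hF0)) (hR p)).trans (le_of_eq ?_)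
  rw [h5, div_pow]
  field_simp
end

end KS

namespace KS
open Filter Topology Set

theorem int_pow_bound {t₁ s₀ s₁ a α : ℝ} (hα1 : α < 1) (ha : 0 < a) (hs : s₀ ≤ s₁) (hs1 : t₁ - s₁ = a ^ 2) :
    IntervalIntegrable (fun s => (√(t₁ - s)) ^ (α - 3)) volume s₀ s₁ ∧
    ∫ s in s₀..s₁, (√(t₁ - s)) ^ (α - 3) ≤ 2 / (1 - α) * a ^ (α - 1) := by
  have ha2 : 0 < a ^ 2 := by positivity
  have hpos : ∀ s ∈ uIcc s₀ s₁, 0 < t₁ - s := by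
    intro s hs'
    rw [uIcc_of_le hs] at hs'
    linarith [hs'.2]
  constructor
  · apply ContinuousOn.intervalIntegrable
    intro s hs'
    have := hpos s hs'
    apply ContinuousAt.continuousWithinAt
    refine ContinuousAt.rpow_const (by fun_prop) (Or.inl ?_)
    exact (Real.sqrt_pos.2 this).ne'
  · have e1 : ∫ s in s₀..s₁, (√(t₁ - s)) ^ (α - 3) = ∫ s in s₀..s₁, (t₁ - s) ^ ((α - 3) / 2) := by
      refine intervalIntegral.integral_congr fun s hs' => ?_
      have := hpos s hs'
      change (√(t₁ - s)) ^ (α - 3) = (t₁ - s) ^ ((α - 3) / 2)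
      rw [Real.sqrt_eq_rpow, ← Real.rpow_mul this.le]
      congr 1; ring
    rw [e1, intervalIntegral.integral_comp_sub_left (fun x => x ^ ((α - 3) / 2)) t₁, integral_rpow, hs1]
    · have e2 : (α - 3) / 2 + 1 = - ((1 - α) / 2) := by ring
      have e3 : (a ^ 2) ^ (- ((1 - α) / 2)) = a ^ (α - 1) := by
        rw [← Real.rpow_natCast, ← Real.rpow_mul ha.le]
        congr 1; push_cast; ring
      rw [e2, e3, div_neg, ← neg_div, neg_sub, div_le_iff₀ (by linarith)]
      have : 0 ≤ (t₁ - s₀) ^ (- ((1 - α) / 2)) := Real.rpow_nonneg (by linarith) _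
      have e4 : 2 / (1 - α) * a ^ (α - 1) * ((1 - α) / 2) = a ^ (α - 1) := by
        have : 1 - α ≠ 0 := by linarith
        field_simp
      rw [e4]; linarith
    · right
      constructor
      · linarith
      · rw [hs1, uIcc_of_le (by linarith)]
        intro h
        linarith [h.1]

theorem tay_lin (k c c0 b b0 : ℝ) (q : Fin d → ℝ) (m : Fin d → Fin d → ℝ) (z₁ z : Z d) :
    tay (k * (c + c0)) (k * (b + b0)) (fun i => k * q i) (fun i j => k * m i j) z₁ z =
    k * (tay c b q m z₁ z + c0 + b0 * (z.1 - z₁.1)) := by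
  unfold tay
  simp only [mul_add, Finset.mul_sum]
  have : ∀ i j, 1 / 2 * (k * m i j * (z.2.2 i - z₁.2.2 i) * (z.2.2 j - z₁.2.2 j)) =
    k * (1 / 2 * (m i j * (z.2.2 i - z₁.2.2 i) * (z.2.2 j - z₁.2.2 j))) := fun i j => by ring
  simp only [this]
  have : ∀ i, k * q i * (z.2.2 i - z₁.2.2 i) = k * (q i * (z.2.2 i - z₁.2.2 i)) := fun i => by ring
  simp only [this]
  ring

theorem JT_int {cM CM : ℝ} {A : Fin d → Fin d → ℝ} {M : E d →L[ℝ] E d} {h : Z d → ℝ}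
    (hE : Ell cM CM A M) (hc : 0 < cM) (hC : 0 < CM) (hcont : Continuous h) {B : ℝ} (hB : ∀ z, |h z| ≤ B)
    (z₁ : Z d) {s₀ s₁ : ℝ} (hs : s₀ ≤ s₁) (hs1 : s₁ < z₁.1) :
    ∃ c b : ℝ, ∃ q : Fin d → ℝ, ∃ m : Fin d → Fin d → ℝ, (∀ i j, m i j = m j i) ∧ ∀ z,
      IntervalIntegrable (JT h M z₁ z) volume s₀ s₁ ∧ ∫ s in s₀..s₁, JT h M z₁ z s = tay c b q m z₁ z := by
  have c1 := JJ_cont hcont hB (hE.int_exp hc) z₁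
  have c2 := JJ_cont hcont hB (kk_mul_int hE hc 2 (kt_cont M) (kt_bd hE hC)) z₁
  have c3 := fun i => JJ_cont hcont hB (kk_mul_int hE hc 1 (kl_cont M (ee i)) (kl_bd hE hC i)) z₁
  have c4 := fun i j => JJ_cont hcont hB (kk_mul_int hE hc 2 (km_cont M i j) (km_bd hE hC i j)) z₁
  have hne : ∀ s ∈ Icc s₀ s₁, √(z₁.1 - s) ≠ 0 := fun s hs' => (Real.sqrt_pos.2 (by linarith [hs'.2])).ne'
  have i1 : ContinuousOn (fun s => (√(z₁.1 - s))⁻¹) (Icc s₀ s₁) := ContinuousOn.inv₀ (by fun_prop) hne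
  have i2 : ContinuousOn (fun s => ((√(z₁.1 - s)) ^ 2)⁻¹) (Icc s₀ s₁) :=
    ContinuousOn.inv₀ (by fun_prop) fun s hs' => pow_ne_zero 2 (hne s hs')
  have tr : ∀ {f : ℝ → ℝ}, ContinuousOn f (Icc s₀ s₁) → Integrable f (volume.restrict (Ioc s₀ s₁)) := by
    intro f hf
    exact (hf.integrableOn_Icc).mono_set Ioc_subset_Icc_self
  have key := fun z => tay_integral (μ := volume.restrict (Ioc s₀ s₁)) (c := JJ h (kk M) z₁)
    (b := fun s => ((√(z₁.1 - s)) ^ 2)⁻¹ * JJ h (fun p => kk M p * kt M p) z₁ s)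
    (q := fun s i => (√(z₁.1 - s))⁻¹ * JJ h (fun p => kk M p * kl M p (ee i)) z₁ s)
    (m := fun s i j => ((√(z₁.1 - s)) ^ 2)⁻¹ * JJ h (fun p => kk M p * km M i j p) z₁ s)
    (tr c1.continuousOn) (tr (i2.mul c2.continuousOn)) (fun i => tr (i1.mul (c3 i).continuousOn))
    (fun i j => tr (i2.mul (c4 i j).continuousOn)) z₁ z
  refine ⟨_, _, _, _, ?_, fun z => ⟨?_, (intervalIntegral.integral_of_le hs).trans (key z).2⟩⟩
  · intro i j
    have : ∀ p, km M i j p = km M j i p := fun p => by unfold km; ring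
    simp only [this]
  · rw [intervalIntegrable_iff_integrableOn_Ioc_of_le hs]
    exact (key z).1

set_option maxHeartbeats 800000 in
theorem pot (d : ℕ) {cM CM α : ℝ} (hc : 0 < cM) (hC : 0 < CM) (hα0 : 0 < α) (hα1 : α < 1) :
    ∃ C : ℝ, 0 < C ∧ ∀ (A : Fin d → Fin d → ℝ) (M : E d →L[ℝ] E d), Ell cM CM A M →
    ∀ (u Yu : Z d → ℝ) (ui : Fin d → Z d → ℝ) (uij : Fin d → Fin d → Z d → ℝ), KD u Yu ui uij →
    ∀ K : Set (Z d), IsCompact K → (∀ z ∉ K, u z = 0) → ∀ (z₁ : Z d) (f₀ F : ℝ), 0 ≤ F →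
    (∀ r : ℝ, 0 < r → ∀ ζ ∈ kCyl r z₁, |LA A Yu uij ζ - f₀| ≤ F * r ^ α) →
    ∀ r : ℝ, 0 < r → ∃ c b : ℝ, ∃ q : Fin d → ℝ, ∃ m : Fin d → Fin d → ℝ, (∀ i j, m i j = m j i) ∧
      ∀ z ∈ kCyl r z₁, |u z - tay c b q m z₁ z| ≤ C * F * r ^ (2 + α) := by
  obtain ⟨C', ε₀, hC', hε, hε2, hT⟩ := taylor_ker d hc hC
  have hz := zlow_pos (d := d) hC
  set C1 := (1 + 2 * (1 / ε₀)) * Wt d cM 1 * (1 / ε₀) ^ 2 with hC1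
  set C2 := 2 * C' * Wt d cM 7 * (2 / (1 - α)) with hC2
  have hW1 := Wt_nonneg d cM 1
  have hW7 := Wt_nonneg d cM 7
  have h1α : 0 < 1 - α := by linarith
  have hC10 : 0 ≤ C1 := by positivity
  have hC20 : 0 ≤ C2 := by positivity
  refine ⟨(zlow d CM)⁻¹ * (C1 + C2 + 1), by positivity, ?_⟩
  intro A M hE u Yu ui uij hu K hK h0 z₁ f₀ F hF0 hF r hr
  set f := LA A Yu uij with hf
  have fc : Continuous f := LA_cont hu
  obtain ⟨B, hB⟩ := bdd_of_supp fc hK (LA_zero hu hK.isClosed h0)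
  set h : Z d → ℝ := fun ζ => f ζ - f₀ with hh
  have hcont : Continuous h := fc.sub continuous_const
  have hBh : ∀ z, |h z| ≤ B + |f₀| := fun z => (abs_sub _ _).trans (by linarith [hB z])
  have kI : Integrable (kk M) := hE.int_exp hc
  have hZ : zlow d CM ≤ ZM M := hE.ZM_ge hc hC
  have hZ0 : 0 < ZM M := hz.trans_le hZ
  set a := r / ε₀ with ha
  have ha0 : 0 < a := by positivity
  have har : r ≤ a := by rw [ha, le_div_iff₀ hε]; nlinarith
  set s₁ := z₁.1 - a ^ 2 with hs1
  have hs1' : z₁.1 - s₁ = a ^ 2 := by rw [hs1]; ring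
  have ha2 : 0 < a ^ 2 := by positivity
  obtain ⟨s₀, hs01, hs0⟩ : ∃ s₀ ≤ s₁, ∀ ζ : Z d, ζ.1 ≤ s₀ → u ζ = 0 := by
    obtain ⟨L, hL⟩ := hK.exists_bound_of_continuousOn (f := fun z : Z d => z.1) continuous_fst.continuousOn
    refine ⟨min s₁ (- L - 1), min_le_left _ _, fun ζ hζ => h0 ζ fun hm => ?_⟩
    have h1 := hL ζ hm
    have h2 := hζ.trans (min_le_right _ _)
    rw [Real.norm_eq_abs] at h1
    linarith [(abs_le.1 h1).1]
  obtain ⟨c, b, q, m, hm, hJ⟩ := JT_int hE hc hC hcont hBh z₁ hs01 (by linarith)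
  refine ⟨(ZM M)⁻¹ * (c + f₀ * ZM M * (z₁.1 - s₀)), (ZM M)⁻¹ * (b + f₀ * ZM M), fun i => (ZM M)⁻¹ * q i,
    fun i j => (ZM M)⁻¹ * m i j, fun i j => congrArg ((ZM M)⁻¹ * ·) (hm i j), ?_⟩
  intro z hzm
  obtain ⟨hJi, hJe⟩ := hJ z
  have hzz := hzm
  obtain ⟨z1, z2, z3, z4⟩ := hzz
  have hsz : s₁ ≤ z.1 := by
    have : r ^ 2 ≤ a ^ 2 := pow_le_pow_left₀ hr.le har 2
    linarith
  have rep := hE.rep hc hu hK h0 z (hs01.trans hsz) hs0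
  have cJ := JJ_cont hcont hBh kI z
  have e1 : ∀ s, JJ (LA A Yu uij) (kk M) z s = JJ h (kk M) z s + f₀ * ZM M := by
    intro s
    have i1 := JJ_int hcont hBh kI z (√(z.1 - s))
    unfold JJ
    have : ∀ p, LA A Yu uij (gz z (√(z.1 - s)) p) * kk M p = h (gz z (√(z.1 - s)) p) * kk M p + f₀ * kk M p := by
      intro p; rw [hh, hf]; ring
    simp only [this]
    rw [integral_add i1 (kI.const_mul _), integral_const_mul]
    rfl
  have e2 : ZM M * u z = (∫ s in s₀..s₁, JJ h (kk M) z s) + (∫ s in s₁..z.1, JJ h (kk M) z s) + f₀ * ZM M * (z.1 - s₀) := by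
    rw [rep]
    simp only [e1]
    rw [intervalIntegral.integral_add (cJ.intervalIntegrable _ _) (by simp),
      intervalIntegral.integral_add_adjacent_intervals (cJ.intervalIntegrable _ _) (cJ.intervalIntegrable _ _),
      intervalIntegral.integral_const, smul_eq_mul]
    ring
  have near : |∫ s in s₁..z.1, JJ h (kk M) z s| ≤ C1 * F * r ^ (2 + α) := by
    have := intervalIntegral.norm_integral_le_of_norm_le_const (f := JJ h (kk M) z) (a := s₁) (b := z.1)
      (C := F * r ^ α * (1 + 2 * (1 / ε₀)) * Wt d cM 1) (by
        intro s hs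
        rw [uIoc_of_le hsz] at hs
        refine JJ_near hE hc hF0 hα0 hα1 hF hr (by positivity) hzm ?_
        rw [Real.sqrt_le_left (by positivity)]
        have : 1 / ε₀ * r = a := by rw [ha]; ring
        rw [this]
        linarith [hs.1])
    rw [Real.norm_eq_abs, abs_of_nonneg (by linarith : 0 ≤ z.1 - s₁)] at this
    refine this.trans ?_
    have h2 : z.1 - s₁ ≤ a ^ 2 := by linarith
    refine (mul_le_mul_of_nonneg_left h2 (by positivity)).trans (le_of_eq ?_)
    rw [Real.rpow_add hr, hC1, ha]
    norm_num
    ring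
  have far : |(∫ s in s₀..s₁, JJ h (kk M) z s) - tay c b q m z₁ z| ≤ C2 * F * r ^ (2 + α) := by
    rw [← hJe, ← intervalIntegral.integral_sub (cJ.intervalIntegrable _ _) hJi, ← Real.norm_eq_abs]
    obtain ⟨p1, p2⟩ := int_pow_bound hα1 ha0 hs01 hs1'
    refine (intervalIntegral.norm_integral_le_of_norm_le hs01
      (g := fun s => (2 * C' * F * Wt d cM 7) * r ^ 3 * (√(z₁.1 - s)) ^ (α - 3)) ?_ (p1.const_mul _)).trans ?_
    · refine Eventually.of_forall fun s hs => ?_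
      refine JJ_far hT hC' hε2 hE hc hC hcont hBh hF0 hα0 hα1 hF hr hzm (by linarith [hs.2]) ?_
      have : a ≤ √(z₁.1 - s) := by
        apply Real.le_sqrt_of_sq_le
        linarith [hs.2]
      calc r = ε₀ * a := by rw [ha]; field_simp
        _ ≤ _ := mul_le_mul_of_nonneg_left this hε.le
    · rw [intervalIntegral.integral_const_mul]
      have p3 : a ^ (α - 1) ≤ r ^ (α - 1) := Real.rpow_le_rpow_of_nonpos hr har (by linarith)
      have p4 : r ^ 3 * r ^ (α - 1) = r ^ (2 + α) := by
        rw [← Real.rpow_natCast, ← Real.rpow_add hr]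
        congr 1; push_cast; ring
      calc _ ≤ (2 * C' * F * Wt d cM 7) * r ^ 3 * (2 / (1 - α) * r ^ (α - 1)) := by
            refine mul_le_mul_of_nonneg_left (p2.trans ?_) (by positivity)
            exact mul_le_mul_of_nonneg_left p3 (by positivity)
        _ = C2 * F * (r ^ 3 * r ^ (α - 1)) := by rw [hC2]; ring
        _ = _ := by rw [p4]
  rw [tay_lin]
  have e3 : u z - (ZM M)⁻¹ * (tay c b q m z₁ z + f₀ * ZM M * (z₁.1 - s₀) + f₀ * ZM M * (z.1 - z₁.1)) =
      (ZM M)⁻¹ * (((∫ s in s₀..s₁, JJ h (kk M) z s) - tay c b q m z₁ z) + (∫ s in s₁..z.1, JJ h (kk M) z s)) := by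
    have : u z = (ZM M)⁻¹ * (ZM M * u z) := by field_simp
    rw [this, e2]; ring
  rw [e3, abs_mul, abs_of_pos (inv_pos.2 hZ0), mul_assoc, mul_assoc]
  have hr0 : 0 ≤ F * r ^ (2 + α) := by positivity
  refine mul_le_mul ((inv_le_inv₀ hZ0 hz).2 hZ) ?_ (abs_nonneg _) (by positivity)
  refine (abs_add_le _ _).trans ?_
  nlinarith only [far, near, hr0]

end KS

namespace KS
open Filter Topology Set

theorem line_deriv {F : Z d → ℝ} (hF : ContDiff ℝ ((⊤ : ℕ∞) : WithTop ℕ∞) F) (ζ w : Z d) (k : ℝ) :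
    HasDerivAt (fun s : ℝ => F (ζ + (s * k) • w)) (k * fderiv ℝ F ζ w) 0 := by
  have h1 : HasDerivAt (fun s : ℝ => ζ + (s * k) • w) (k • w) 0 := by
    have h := (((hasDerivAt_id (0:ℝ)).mul_const k).smul_const w).const_add ζ
    simpa using h
  have h2 : HasFDerivAt F (fderiv ℝ F ζ) (ζ + ((0:ℝ) * k) • w) := by
    simpa using ((hF.differentiable (by simp)) ζ).hasFDerivAt
  have := h2.comp_hasDerivAt (0:ℝ) h1
  exact this.congr_deriv (by simp)

theorem cdir {F : Z d → ℝ} (hF : ContDiff ℝ ((⊤ : ℕ∞) : WithTop ℕ∞) F) {w : Z d → Z d} (hw : ContDiff ℝ ((⊤ : ℕ∞) : WithTop ℕ∞) w) :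
    ContDiff ℝ ((⊤ : ℕ∞) : WithTop ℕ∞) (fun ζ => fderiv ℝ F ζ (w ζ)) := by
  have : ContDiff ℝ ((⊤ : ℕ∞) : WithTop ℕ∞) (fderiv ℝ F) := hF.fderiv_right (by simp)
  exact this.clm_apply hw

def dv (F : Z d → ℝ) (i : Fin d) (ζ : Z d) : ℝ := fderiv ℝ F ζ (0, 0, ee i)
def dY (F : Z d → ℝ) (ζ : Z d) : ℝ := fderiv ℝ F ζ (1, ζ.2.2, 0)

theorem dv_smooth {F : Z d → ℝ} (hF : ContDiff ℝ ((⊤ : ℕ∞) : WithTop ℕ∞) F) (i) : ContDiff ℝ ((⊤ : ℕ∞) : WithTop ℕ∞) (dv F i) :=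
  cdir hF contDiff_const
theorem dY_smooth {F : Z d → ℝ} (hF : ContDiff ℝ ((⊤ : ℕ∞) : WithTop ℕ∞) F) : ContDiff ℝ ((⊤ : ℕ∞) : WithTop ℕ∞) (dY F) :=
  cdir hF (contDiff_const.prodMk ((contDiff_snd.comp contDiff_snd).prodMk contDiff_const))

def tau (ρ : ℝ) (z₁ z : Z d) : Z d :=
  ((z.1 - z₁.1) * (ρ⁻¹ ^ 2), (ρ⁻¹ ^ 3) • (z.2.1 - z₁.2.1 - (z.1 - z₁.1) • z₁.2.2), ρ⁻¹ • (z.2.2 - z₁.2.2))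

theorem tau_cont (ρ : ℝ) (z₁ : Z d) : Continuous (tau ρ z₁) := by
  unfold tau; fun_prop

theorem tau_v (ρ : ℝ) (z₁ : Z d) (i) (t : ℝ) (x v : E d) (s : ℝ) :
    tau ρ z₁ (t, x, v + s • ee i) = tau ρ z₁ (t, x, v) + (s * ρ⁻¹) • (0, 0, ee i) := by
  simp only [tau, Prod.smul_mk, smul_zero, Prod.mk_add_mk, add_zero, Prod.mk.injEq, true_and]
  module

theorem tau_Y (ρ : ℝ) (z₁ : Z d) (t : ℝ) (x v : E d) (s : ℝ) :
    tau ρ z₁ (t + s, x + s • v, v) = tau ρ z₁ (t, x, v)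
      + (s * ρ⁻¹ ^ 2) • (1, (tau ρ z₁ (t, x, v)).2.2, 0) := by
  simp only [tau, Prod.smul_mk, smul_zero, Prod.mk_add_mk, add_zero, Prod.mk.injEq, and_true]
  refine ⟨by simp; ring, ?_⟩
  module

theorem KD_tau {F : Z d → ℝ} (hF : ContDiff ℝ ((⊤ : ℕ∞) : WithTop ℕ∞) F) (ρ : ℝ) (z₁ : Z d) :
    KD (fun z => F (tau ρ z₁ z)) (fun z => ρ⁻¹ ^ 2 * dY F (tau ρ z₁ z))
      (fun i z => ρ⁻¹ * dv F i (tau ρ z₁ z)) (fun i j z => ρ⁻¹ ^ 2 * dv (dv F j) i (tau ρ z₁ z)) := by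
  have hc := tau_cont ρ z₁
  refine ⟨?_, ?_, ?_, hF.continuous.comp hc, continuous_const.mul ((dY_smooth hF).continuous.comp hc),
    fun i => continuous_const.mul ((dv_smooth hF i).continuous.comp hc),
    fun i j => continuous_const.mul ((dv_smooth (dv_smooth hF j) i).continuous.comp hc)⟩
  · intro t x v
    simp only [tau_Y]
    exact line_deriv hF _ _ _
  · intro i t x v
    simp only [tau_v]
    exact line_deriv hF _ _ _
  · intro i j t x v
    simp only [tau_v]
    have := (line_deriv (dv_smooth hF j) (tau ρ z₁ (t, x, v)) (0, 0, ee i) ρ⁻¹).const_mul ρ⁻¹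
    refine this.congr_deriv ?_
    change ρ⁻¹ * (ρ⁻¹ * dv (dv F j) i _) = _
    ring

theorem ev_derivs {F : Z d → ℝ} {a : ℝ} {ζ : Z d} (h : F =ᶠ[𝓝 ζ] fun _ => a) :
    F ζ = a ∧ dY F ζ = 0 ∧ (∀ i, dv F i ζ = 0) ∧ ∀ i j, dv (dv F j) i ζ = 0 := by
  have key : ∀ {G : Z d → ℝ} {b : ℝ}, (G =ᶠ[𝓝 ζ] fun _ => b) → fderiv ℝ G =ᶠ[𝓝 ζ] fun _ => 0 := by
    intro G b h
    have := h.fderiv (𝕜 := ℝ)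
    refine this.trans (Eventually.of_forall fun z => ?_)
    simp
  have h1 : ∀ i, dv F i =ᶠ[𝓝 ζ] fun _ => 0 := by
    intro i
    filter_upwards [key h] with z hz
    simp [dv, hz]
  refine ⟨h.self_of_nhds, ?_, fun i => (h1 i).self_of_nhds, fun i j => ?_⟩
  · simp [dY, (key h).self_of_nhds]
  · simp [dv, (key (h1 j)).self_of_nhds]

theorem bdd_ball {h : Z d → ℝ} (hc : Continuous h) (h0 : ∀ ζ ∉ Metric.ball (0 : Z d) 2, h ζ = 0) :
    ∃ B, 0 ≤ B ∧ ∀ ζ, |h ζ| ≤ B := by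
  obtain ⟨B, hB⟩ := bdd_of_supp hc (isCompact_closedBall (0 : Z d) 2)
    (fun z hz => h0 z fun h => hz (Metric.ball_subset_closedBall h))
  exact ⟨|B|, abs_nonneg _, fun z => ((hB z)).trans (le_abs_self _)⟩

theorem tau_mem {ρ : ℝ} (hρ : 0 < ρ) {z₁ z : Z d} (hz : z ∈ kCyl ρ z₁) :
    tau ρ z₁ z ∈ Metric.ball (0 : Z d) 1 := by
  obtain ⟨h1, h2, h3, h4⟩ := hz
  have hi : 0 < ρ⁻¹ := inv_pos.2 hρ
  rw [mem_ball_zero_iff, Prod.norm_def, Prod.norm_def, max_lt_iff, max_lt_iff]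
  refine ⟨?_, ?_, ?_⟩
  · simp only [tau, norm_eq_abs, abs_mul, inv_pow]
    rw [abs_of_pos (a := (ρ ^ 2)⁻¹) (by positivity), ← div_eq_mul_inv, div_lt_one (by positivity), abs_lt]
    constructor <;> nlinarith [sq_pos_of_pos hρ]
  · simp only [tau, norm_smul, norm_eq_abs, inv_pow]
    rw [abs_of_pos (a := (ρ ^ 3)⁻¹) (by positivity), mul_comm, ← div_eq_mul_inv, div_lt_one (by positivity)]
    exact h3
  · simp only [tau, norm_smul, norm_eq_abs]
    rw [abs_of_pos hi, mul_comm, ← div_eq_mul_inv, div_lt_one (by positivity)]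
    exact h4

theorem tau_mem2 {ρ : ℝ} (hρ : 0 < ρ) {z₁ z : Z d} (ht : z.1 ≤ z₁.1) (hz : tau ρ z₁ z ∈ Metric.ball (0 : Z d) 2) :
    z ∈ kCyl (2 * ρ) z₁ := by
  have hi : 0 < ρ⁻¹ := inv_pos.2 hρ
  rw [mem_ball_zero_iff, Prod.norm_def, Prod.norm_def, max_lt_iff, max_lt_iff] at hz
  obtain ⟨h1, h2, h3⟩ := hz
  simp only [tau, norm_eq_abs, abs_mul, inv_pow] at h1
  rw [abs_of_pos (a := (ρ ^ 2)⁻¹) (by positivity), ← div_eq_mul_inv, div_lt_iff₀ (by positivity), abs_lt] at h1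
  simp only [tau, norm_smul, norm_eq_abs, inv_pow] at h2
  rw [abs_of_pos (a := (ρ ^ 3)⁻¹) (by positivity), mul_comm, ← div_eq_mul_inv, div_lt_iff₀ (by positivity)] at h2
  simp only [tau, norm_smul, norm_eq_abs] at h3
  rw [abs_of_pos hi, mul_comm, ← div_eq_mul_inv, div_lt_iff₀ (by positivity)] at h3
  have := pow_pos hρ 3
  have := pow_pos hρ 2
  exact ⟨by nlinarith, ht, by nlinarith, h3⟩

theorem tau_inv {ρ : ℝ} (hρ : 0 < ρ) (z₁ z : Z d) :
    z = (z₁.1 + ρ ^ 2 * (tau ρ z₁ z).1, z₁.2.1 + (ρ ^ 2 * (tau ρ z₁ z).1) • z₁.2.2 + ρ ^ 3 • (tau ρ z₁ z).2.1,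
      z₁.2.2 + ρ • (tau ρ z₁ z).2.2) := by
  have h : ρ ^ 2 * ((z.1 - z₁.1) * ρ⁻¹ ^ 2) = z.1 - z₁.1 := by field_simp
  have h3 : ρ ^ 3 * ρ⁻¹ ^ 3 = 1 := by field_simp
  have h1 : ρ * ρ⁻¹ = 1 := by field_simp
  simp only [tau, h, smul_smul, h3, h1, one_smul]
  ext <;> simp

structure Cut (Kf ρ : ℝ) (z₁ : Z d) (φ Yφ : Z d → ℝ) (φi : Fin d → Z d → ℝ) (φij : Fin d → Fin d → Z d → ℝ) : Prop where
  kd : KD φ Yφ φi φij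
  cpt : ∃ K, IsCompact K ∧ ∀ z ∉ K, φ z = 0
  b0 : ∀ z, |φ z| ≤ Kf
  bY : ∀ z, |Yφ z| ≤ Kf / ρ ^ 2
  b1 : ∀ i z, |φi i z| ≤ Kf / ρ
  b2 : ∀ i j z, |φij i j z| ≤ Kf / ρ ^ 2
  inn : ∀ z ∈ kCyl ρ z₁, φ z = 1 ∧ Yφ z = 0 ∧ (∀ i, φi i z = 0) ∧ ∀ i j, φij i j z = 0
  out : ∀ z, z.1 ≤ z₁.1 → z ∉ kCyl (2 * ρ) z₁ → φ z = 0 ∧ Yφ z = 0 ∧ (∀ i, φi i z = 0) ∧ ∀ i j, φij i j z = 0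

theorem exists_cut (d : ℕ) : ∃ Kf : ℝ, 0 < Kf ∧ ∀ (z₁ : Z d) (ρ : ℝ), 0 < ρ →
    ∃ φ Yφ φi φij, Cut Kf ρ z₁ φ Yφ φi φij := by
  let Φ : ContDiffBump (0 : Z d) := ⟨1, 3/2, by norm_num, by norm_num⟩
  have hΦ : ContDiff ℝ ((⊤ : ℕ∞) : WithTop ℕ∞) (Φ : Z d → ℝ) := Φ.contDiff
  have hin : ∀ ζ ∈ Metric.ball (0 : Z d) 1, (Φ : Z d → ℝ) =ᶠ[𝓝 ζ] fun _ => 1 := fun ζ h =>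
    Φ.eventuallyEq_one_of_mem_ball h
  have hout : ∀ ζ ∉ Metric.ball (0 : Z d) 2, (Φ : Z d → ℝ) =ᶠ[𝓝 ζ] fun _ => 0 := by
    intro ζ h
    have h1 : ζ ∈ (Metric.closedBall (0 : Z d) (3/2))ᶜ := fun h' =>
      h (Metric.closedBall_subset_ball (by norm_num) h')
    filter_upwards [Metric.isClosed_closedBall.isOpen_compl.mem_nhds h1] with z hz
    apply Φ.zero_of_le_dist
    simp only [mem_compl_iff, Metric.mem_closedBall, not_le] at hz
    exact hz.le
  obtain ⟨B0, hB0, h0⟩ := bdd_ball hΦ.continuous (fun ζ h => (ev_derivs (hout ζ h)).1)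
  obtain ⟨BY, hBY, hY⟩ := bdd_ball (dY_smooth hΦ).continuous (fun ζ h => (ev_derivs (hout ζ h)).2.1)
  choose Bi hBi hi using fun i => bdd_ball (dv_smooth hΦ i).continuous (fun ζ h => (ev_derivs (hout ζ h)).2.2.1 i)
  choose Bj hBj hj using fun i j => bdd_ball (dv_smooth (dv_smooth hΦ j) i).continuous
    (fun ζ h => (ev_derivs (hout ζ h)).2.2.2 i j)
  have hs1 : 0 ≤ ∑ i, Bi i := Finset.sum_nonneg fun i _ => hBi i
  have hs2 : 0 ≤ ∑ i, ∑ j, Bj i j := Finset.sum_nonneg fun i _ => Finset.sum_nonneg fun j _ => hBj i j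
  have hl1 : ∀ i, Bi i ≤ ∑ i, Bi i := fun i => Finset.single_le_sum (fun i _ => hBi i) (Finset.mem_univ i)
  have hl2 : ∀ i j, Bj i j ≤ ∑ i, ∑ j, Bj i j := fun i j =>
    (Finset.single_le_sum (fun j _ => hBj i j) (Finset.mem_univ j)).trans
    (Finset.single_le_sum (f := fun i => ∑ j, Bj i j) (fun i _ => Finset.sum_nonneg fun j _ => hBj i j) (Finset.mem_univ i))
  refine ⟨1 + B0 + BY + ∑ i, Bi i + ∑ i, ∑ j, Bj i j, by positivity, fun z₁ ρ hρ =>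
    ⟨_, _, _, _, KD_tau hΦ ρ z₁, ?_, ?_, ?_, ?_, ?_, ?_, ?_⟩⟩
  · refine ⟨(fun ζ : Z d => ((z₁.1 + ρ ^ 2 * ζ.1, z₁.2.1 + (ρ ^ 2 * ζ.1) • z₁.2.2 + ρ ^ 3 • ζ.2.1,
      z₁.2.2 + ρ • ζ.2.2) : Z d)) '' Metric.closedBall 0 2,
      (isCompact_closedBall (0 : Z d) 2).image (by fun_prop), fun z hz => ?_⟩
    refine (ev_derivs (hout _ fun h => hz ⟨tau ρ z₁ z, Metric.ball_subset_closedBall h, ?_⟩)).1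
    exact (tau_inv hρ z₁ z).symm
  · intro z
    exact (h0 _).trans (by linarith)
  · intro z
    rw [abs_mul, inv_pow, abs_of_pos (a := (ρ ^ 2)⁻¹) (by positivity), mul_comm, ← div_eq_mul_inv]
    gcongr
    exact (hY _).trans (by linarith)
  · intro i z
    rw [abs_mul, abs_of_pos (a := ρ⁻¹) (by positivity), mul_comm, ← div_eq_mul_inv]
    gcongr
    exact (hi i _).trans (by linarith [hl1 i])
  · intro i j z
    rw [abs_mul, inv_pow, abs_of_pos (a := (ρ ^ 2)⁻¹) (by positivity), mul_comm, ← div_eq_mul_inv]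
    gcongr
    exact (hj i j _).trans (by linarith [hl2 i j])
  · intro z hz
    obtain ⟨e1, e2, e3, e4⟩ := ev_derivs (hin _ (tau_mem hρ hz))
    exact ⟨e1, by simp [e2], by simp [e3], by simp [e4]⟩
  · intro z ht hz
    obtain ⟨e1, e2, e3, e4⟩ := ev_derivs (hout _ fun h => hz (tau_mem2 hρ ht h))
    exact ⟨e1, by simp [e2], by simp [e3], by simp [e4]⟩

theorem KD.mul {u Yu w Yw : Z d → ℝ} {ui wi : Fin d → Z d → ℝ} {uij wij : Fin d → Fin d → Z d → ℝ}
    (hu : KD u Yu ui uij) (hw : KD w Yw wi wij) :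
    KD (fun z => u z * w z) (fun z => Yu z * w z + u z * Yw z) (fun i z => ui i z * w z + u z * wi i z)
      (fun i j z => (uij i j z * w z + ui j z * wi i z) + (ui i z * wi j z + u z * wij i j z)) := by
  refine ⟨?_, ?_, ?_, hu.cu.mul hw.cu, (hu.cY.mul hw.cu).add (hu.cu.mul hw.cY),
    fun i => ((hu.cv i).mul hw.cu).add (hu.cu.mul (hw.cv i)), fun i j => ?_⟩
  · intro t x v
    exact ((hu.hY t x v).mul (hw.hY t x v)).congr_deriv (by simp)
  · intro i t x v
    exact ((hu.hv i t x v).mul (hw.hv i t x v)).congr_deriv (by simp)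
  · intro i j t x v
    exact (((hu.hvv i j t x v).mul (hw.hv i t x v)).add ((hu.hv i t x v).mul (hw.hvv i j t x v))).congr_deriv (by simp)
  · exact (((hu.cvv i j).mul hw.cu).add ((hu.cv j).mul (hw.cv i))).add
      (((hu.cv i).mul (hw.cv j)).add (hu.cu.mul (hw.cvv i j)))

end KS

namespace KS
open Filter Topology Set

theorem sum1 {f : Fin d → ℝ} {B : ℝ} (h : ∀ i, |f i| ≤ B) : |∑ i, f i| ≤ d * B := by
  refine (Finset.abs_sum_le_sum_abs _ _).trans ((Finset.sum_le_sum fun i _ => h i).trans ?_)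
  simp

theorem sum2 {f : Fin d → Fin d → ℝ} {B : ℝ} (h : ∀ i j, |f i j| ≤ B) : |∑ i, ∑ j, f i j| ≤ d * (d * B) :=
  sum1 fun i => sum1 (h i)

structure Eqn (K α lam : ℝ) (a : Fin d → Fin d → Z d → ℝ) (b : Fin d → Z d → ℝ) (c S g Yg : Z d → ℝ)
    (gi : Fin d → Z d → ℝ) (gij : Fin d → Fin d → Z d → ℝ) : Prop where
  kd : KD g Yg gi gij
  ab : ∀ i j z, |a i j z| ≤ K
  ah : ∀ i j r, 0 < r → ∀ z₁, ∀ z ∈ kCyl r z₁, |a i j z - a i j z₁| ≤ K * r ^ α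
  bb : ∀ i z, |b i z| ≤ K
  bh : ∀ i r, 0 < r → ∀ z₁, ∀ z ∈ kCyl r z₁, |b i z - b i z₁| ≤ K * r ^ α
  cb : ∀ z, |c z| ≤ K
  ch : ∀ r, 0 < r → ∀ z₁, ∀ z ∈ kCyl r z₁, |c z - c z₁| ≤ K * r ^ α
  ell : ∀ z : Z d, ∀ ξ : E d, lam * ‖ξ‖ ^ 2 ≤ ∑ i, ∑ j, a i j z * ξ i * ξ j
  eq : ∀ z : Z d, Yg z = ∑ i, ∑ j, a i j z * gij i j z + ∑ i, b i z * gi i z + c z * g z + S z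

structure Loc (α : ℝ) (S g Yg : Z d → ℝ) (gi : Fin d → Z d → ℝ) (gij : Fin d → Fin d → Z d → ℝ)
    (z₁ : Z d) (ρ N G H : ℝ) : Prop where
  hρ : 0 < ρ
  hρ1 : ρ ≤ 1
  hN : 0 ≤ N
  hG : 0 ≤ G
  hH : 0 ≤ H
  tb : ∀ z ∈ kCyl (2 * ρ) z₁, TB α g Yg gi gij z (ρ / 2) N
  gb : ∀ z ∈ kCyl (3 * ρ) z₁, |g z| ≤ G
  Sh : ∀ r, 0 < r → r ≤ ρ → ∀ z ∈ kCyl r z₁, |S z - S z₁| ≤ H * r ^ α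

def DD (α ε ρ N G : ℝ) : ℝ := 64 * (N * (ε * ρ) ^ α + G / (ε * ρ) ^ 2)

variable {K α lam ε ρ N G H : ℝ} {a : Fin d → Fin d → Z d → ℝ} {b : Fin d → Z d → ℝ} {c S g Yg : Z d → ℝ}
    {gi : Fin d → Z d → ℝ} {gij : Fin d → Fin d → Z d → ℝ} {z₁ : Z d}

theorem DD_nonneg (hε : 0 < ε) (h : Loc α S g Yg gi gij z₁ ρ N G H) : 0 ≤ DD α ε ρ N G := by
  have := h.hρ; have := h.hN; have := h.hG
  unfold DD; positivity

theorem ders (hE : KD g Yg gi gij) (hε : 0 < ε) (hε1 : ε ≤ 1/2)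
    (h : Loc α S g Yg gi gij z₁ ρ N G H) {z : Z d} (hz : z ∈ kCyl (2 * ρ) z₁) :
    |Yg z| ≤ DD α ε ρ N G ∧ (∀ i, |gi i z| ≤ ρ * DD α ε ρ N G) ∧ ∀ i j, |gij i j z| ≤ DD α ε ρ N G := by
  have hρ := h.hρ; have hN := h.hN; have hG := h.hG
  have hs : 0 < ε * ρ := by positivity
  have hsρ : ε * ρ ≤ ρ / 2 := by nlinarith
  have hsub : kCyl (ε * ρ) z ⊆ kCyl (3 * ρ) z₁ :=
    (kCyl_sub (by positivity) hs hz).trans (kCyl_mono (by positivity) (by linarith) _)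
  obtain ⟨h1, h2, h3⟩ := hE.interp (h.tb z hz) hs hsρ (fun z' hz' => h.gb z' (hsub hz'))
  have e : ∀ k : ℝ, k * (N * (ε * ρ) ^ (2 + α) + G) / (ε * ρ) ^ 2 = k * (N * (ε * ρ) ^ α + G / (ε * ρ) ^ 2) := by
    intro k
    rw [Real.rpow_add hs, Real.rpow_two]
    field_simp
  have e1 : 4 * (N * (ε * ρ) ^ (2 + α) + G) / (ε * ρ) = (ε * ρ) * (4 * (N * (ε * ρ) ^ α + G / (ε * ρ) ^ 2)) := by
    rw [← e]; field_simp
  have hX : 0 ≤ N * (ε * ρ) ^ α + G / (ε * ρ) ^ 2 := by positivity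
  rw [e] at h1
  simp only [e1] at h2
  simp only [e] at h3
  refine ⟨h1.trans (by unfold DD; linarith), fun i => (h2 i).trans ?_, h3⟩
  unfold DD
  exact mul_le_mul (by linarith) (by linarith) (by positivity) hρ.le

theorem pow_le_self_rpow {r α : ℝ} (hr : 0 < r) (hr1 : r ≤ 1) (hα1 : α < 1) : r ≤ r ^ α := by
  have := Real.rpow_le_rpow_of_exponent_ge hr hr1 hα1.le
  simpa using this

theorem small_case (hα1 : α < 1) (hK : 1 ≤ K) (hE : Eqn K α lam a b c S g Yg gi gij) (hε : 0 < ε) (hε1 : ε ≤ 1/2)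
    (h : Loc α S g Yg gi gij z₁ ρ N G H) {r : ℝ} (hr : 0 < r) (hrρ : r ≤ ρ / 4) {ζ : Z d} (hζ : ζ ∈ kCyl r z₁) :
    |(Yg ζ - ∑ i, ∑ j, a i j z₁ * gij i j ζ) - (Yg z₁ - ∑ i, ∑ j, a i j z₁ * gij i j z₁)| ≤
      (K * (1 + 2 * d + 3 * d ^ 2) * DD α ε ρ N G + K * (36 * d + 1) * ρ * N + K * G + H) * r ^ α := by
  have hρ := h.hρ; have hN := h.hN; have hG := h.hG; have hρ1 := h.hρ1
  set D := DD α ε ρ N G with hDdef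
  have hD : 0 ≤ D := DD_nonneg hε h
  have hζ2 : ζ ∈ kCyl (2 * ρ) z₁ := kCyl_mono hr.le (by linarith) _ hζ
  have hz2 : z₁ ∈ kCyl (2 * ρ) z₁ := mem_kCyl_self (by positivity)
  obtain ⟨hY, h1, h2⟩ := ders hE.kd hε hε1 h hζ2
  obtain ⟨hY0, h10, h20⟩ := ders hE.kd hε hε1 h hz2
  rw [← hDdef] at h2
  have h1' : ∀ i, |gi i z₁| ≤ D := fun i => (h10 i).trans (by nlinarith)
  have hra : 0 < r ^ α := Real.rpow_pos_of_pos hr _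
  have hrr : r ≤ r ^ α := pow_le_self_rpow hr (by linarith) hα1
  have hr2 : r ^ 2 ≤ r ^ α := le_trans (by nlinarith) hrr
  have p2 : r ^ (2 + α) ≤ ρ * r ^ α := by
    rw [Real.rpow_add hr, Real.rpow_two]; gcongr; nlinarith
  have p1 : r ^ (1 + α) ≤ ρ * r ^ α := by
    rw [Real.rpow_add hr, Real.rpow_one]; gcongr; linarith
  have hgi : ∀ i, |gi i ζ - gi i z₁| ≤ (36 * N * ρ + d * D) * r ^ α := by
    intro i
    refine (hE.kd.grad_holder hα1 hN hr (ρ := ρ / 2) (by linarith) hζ (h.tb ζ hζ2) (h.tb z₁ hz2) i).trans ?_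
    have e1 : ∑ j, |gij i j z₁| * r ≤ d * (D * r ^ α) := by
      refine (Finset.sum_le_sum (g := fun _ => D * r ^ α) fun j _ => ?_).trans (by simp)
      exact mul_le_mul (h20 i j) hrr hr.le hD
    have e2 : 36 * N * r ^ (1 + α) ≤ 36 * N * (ρ * r ^ α) := by gcongr
    linarith only [e1, e2]
  have hg : |g ζ - g z₁| ≤ (N * ρ + (1 + d + d ^ 2) * D) * r ^ α := by
    have e1 := h.tb z₁ hz2 r hr (by linarith) ζ hζ
    have e2 := tay_bound (c := 0) (b := Yg z₁) (q := fun i => gi i z₁) (m := fun i j => gij i j z₁) hr hζ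
      (by simp : |(0:ℝ)| ≤ 0) hY0 h1' h20
    have e3 : tay (g z₁) (Yg z₁) (fun i => gi i z₁) (fun i j => gij i j z₁) z₁ ζ
      = g z₁ + tay 0 (Yg z₁) (fun i => gi i z₁) (fun i j => gij i j z₁) z₁ ζ := by
      simp only [tay]; ring
    rw [e3] at e1
    have e4 : N * r ^ (2 + α) ≤ N * (ρ * r ^ α) := by gcongr
    have e5 : D * r ^ 2 ≤ D * r ^ α := by gcongr
    have e6 : (d:ℝ) * (D * r) ≤ d * (D * r ^ α) := by gcongr
    have e7 : (d:ℝ) * (d * (D * r ^ 2)) ≤ d * (d * (D * r ^ α)) := by gcongr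
    have e8 : 0 ≤ (d:ℝ) * (d * (D * r ^ α)) := by positivity
    have e9 := abs_add_le (g ζ - (g z₁ + tay 0 (Yg z₁) (fun i => gi i z₁) (fun i j => gij i j z₁) z₁ ζ))
      (tay 0 (Yg z₁) (fun i => gi i z₁) (fun i j => gij i j z₁) z₁ ζ)
    rw [show g ζ - (g z₁ + tay 0 (Yg z₁) (fun i => gi i z₁) (fun i j => gij i j z₁) z₁ ζ) +
      (tay 0 (Yg z₁) (fun i => gi i z₁) (fun i j => gij i j z₁) z₁ ζ) = g ζ - g z₁ by ring] at e9
    linarith only [e1, e2, e4, e5, e6, e7, e8, e9]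
  have t1 := sum2 fun i j => mul_bd (hE.ah i j r hr z₁ ζ hζ) (h2 i j)
  have t2 := sum1 fun i => mul_bd (hE.bb i ζ) (hgi i)
  have t3 := sum1 fun i => mul_bd (hE.bh i r hr z₁ ζ hζ) (h1' i)
  have t4 := mul_bd (hE.cb ζ) hg
  have t5 := mul_bd (hE.ch r hr z₁ ζ hζ) (h.gb z₁ (mem_kCyl_self (by positivity)))
  have t6 := h.Sh r hr (by linarith) ζ hζ
  have key : (Yg ζ - ∑ i, ∑ j, a i j z₁ * gij i j ζ) - (Yg z₁ - ∑ i, ∑ j, a i j z₁ * gij i j z₁) =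
      ∑ i, ∑ j, (a i j ζ - a i j z₁) * gij i j ζ + ∑ i, b i ζ * (gi i ζ - gi i z₁)
      + ∑ i, (b i ζ - b i z₁) * gi i z₁ + c ζ * (g ζ - g z₁) + (c ζ - c z₁) * g z₁ + (S ζ - S z₁) := by
    rw [hE.eq ζ, hE.eq z₁]
    simp only [sub_mul, mul_sub, Finset.sum_sub_distrib]
    ring
  rw [key]
  refine (abs_add_le _ _).trans ?_
  refine (add_le_add_left ((abs_add_le _ _).trans (add_le_add_left ((abs_add_le _ _).trans
    (add_le_add_left ((abs_add_le _ _).trans (add_le_add_left (abs_add_le _ _) _)) _)) _)) _).trans ?_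
  linarith only [t1, t2, t3, t4, t5, t6]

def usy (a : Fin d → Fin d → Z d → ℝ) (z₁ : Z d) (i j : Fin d) : ℝ := (a i j z₁ + a j i z₁) / 2

theorem usy_sum (m : Fin d → Fin d → ℝ) (hm : ∀ i j, m i j = m j i) :
    ∑ i, ∑ j, usy a z₁ i j * m i j = ∑ i, ∑ j, a i j z₁ * m i j := by
  have h1 : ∑ i, ∑ j, a j i z₁ * m i j = ∑ i, ∑ j, a i j z₁ * m i j := by
    rw [Finset.sum_comm]
    refine Finset.sum_congr rfl fun i _ => Finset.sum_congr rfl fun j _ => by rw [hm]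
  have h2 : ∑ i, ∑ j, usy a z₁ i j * m i j = (∑ i, ∑ j, a i j z₁ * m i j + ∑ i, ∑ j, a j i z₁ * m i j) / 2 := by
    simp only [← Finset.sum_add_distrib, Finset.sum_div]
    refine Finset.sum_congr rfl fun i _ => Finset.sum_congr rfl fun j _ => by simp only [usy]; ring
  rw [h2, h1]; ring

theorem usy_bd (h : ∀ i j z, |a i j z| ≤ K) (i j) : |usy a z₁ i j| ≤ K := by
  have h1 := abs_le.1 (h i j z₁)
  have h2 := abs_le.1 (h j i z₁)
  unfold usy
  exact abs_le.2 ⟨by linarith [h1.1, h2.1], by linarith [h1.2, h2.2]⟩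

theorem sup_case (hK : 1 ≤ K) (hE : Eqn K α lam a b c S g Yg gi gij) (hε : 0 < ε) (hε1 : ε ≤ 1/2)
    (h : Loc α S g Yg gi gij z₁ ρ N G H) {Kf : ℝ} (hKf : 0 < Kf) {φ Yφ : Z d → ℝ} {φi : Fin d → Z d → ℝ}
    {φij : Fin d → Fin d → Z d → ℝ} (hφ : Cut Kf ρ z₁ φ Yφ φi φij) (ζ : Z d) (hζ : ζ.1 ≤ z₁.1) :
    |LA (usy a z₁) (fun z => Yφ z * g z + φ z * Yg z)
      (fun i j z => (φij i j z * g z + φi j z * gi i z) + (φi i z * gi j z + φ z * gij i j z)) ζ| ≤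
      Kf * (2 + 4 * d ^ 2 * K) * DD α ε ρ N G := by
  have hρ := h.hρ; have hN := h.hN; have hG := h.hG; have hρ1 := h.hρ1
  set D := DD α ε ρ N G with hDdef
  have hD : 0 ≤ D := DD_nonneg hε h
  by_cases hζ2 : ζ ∈ kCyl (2 * ρ) z₁
  · obtain ⟨hY, h1, h2⟩ := ders hE.kd hε hε1 h hζ2
    rw [← hDdef] at hY h1 h2
    have hg := h.gb ζ (kCyl_mono (by positivity) (by linarith) _ hζ2)
    have hGD : G / ρ ^ 2 ≤ D := by
      have e1 : G / ρ ^ 2 ≤ G / (ε * ρ) ^ 2 := by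
        gcongr
        nlinarith
      have e2 : 0 ≤ N * (ε * ρ) ^ α := by positivity
      have e3 : 0 ≤ G / (ε * ρ) ^ 2 := by positivity
      simp only [hDdef, DD]; linarith
    have hA : ∀ {x y X Y W : ℝ}, |x| ≤ X → |y| ≤ Y → X * Y ≤ W → |x * y| ≤ W := fun h1 h2 h3 => (mul_bd h1 h2).trans h3
    have f1 : Kf / ρ ^ 2 * G ≤ Kf * D := by
      rw [div_mul_eq_mul_div, mul_div_assoc]; gcongr
    have f2 : Kf / ρ * (ρ * D) ≤ Kf * D := le_of_eq (by field_simp)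
    have t1 := hA (hφ.bY ζ) hg f1
    have t2 := mul_bd (hφ.b0 ζ) hY
    have t3 : ∀ i j, |(φij i j ζ * g ζ + φi j ζ * gi i ζ) + (φi i ζ * gi j ζ + φ ζ * gij i j ζ)| ≤ 4 * (Kf * D) := by
      intro i j
      have s1 := hA (hφ.b2 i j ζ) hg f1
      have s2 := hA (hφ.b1 j ζ) (h1 i) f2
      have s3 := hA (hφ.b1 i ζ) (h1 j) f2
      have s4 := mul_bd (hφ.b0 ζ) (h2 i j)
      have := abs_add_le (φij i j ζ * g ζ + φi j ζ * gi i ζ) (φi i ζ * gi j ζ + φ ζ * gij i j ζ)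
      have := abs_add_le (φij i j ζ * g ζ) (φi j ζ * gi i ζ)
      have := abs_add_le (φi i ζ * gi j ζ) (φ ζ * gij i j ζ)
      linarith
    have t4 := sum2 fun i j => mul_bd (usy_bd (z₁ := z₁) hE.ab i j) (t3 i j)
    have t5 := abs_add_le (Yφ ζ * g ζ) (φ ζ * Yg ζ)
    refine (abs_sub _ _).trans ?_
    linarith only [t1, t2, t4, t5]
  · obtain ⟨e1, e2, e3, e4⟩ := hφ.out ζ hζ hζ2
    simp only [LA, e1, e2, e3, e4, zero_mul, mul_zero, add_zero, Finset.sum_const_zero, sub_zero, abs_zero]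
    positivity

end KS

namespace KS
open Filter Topology Set

variable {K α lam ε ρ N G H : ℝ} {a : Fin d → Fin d → Z d → ℝ} {b : Fin d → Z d → ℝ} {c S g Yg : Z d → ℝ}
    {gi : Fin d → Z d → ℝ} {gij : Fin d → Fin d → Z d → ℝ} {z₁ : Z d}

def XX (α ε ρ N B : ℝ) : ℝ := ε ^ α * N + ρ * N + B / (ε ^ 2 * ρ ^ 3)

theorem DD_le (hα1 : α < 1) (hε : 0 < ε) (h : Loc α S g Yg gi gij z₁ ρ N G H) :
    DD α ε ρ N G ≤ 64 * XX α ε ρ N (G + H) * ρ ^ α := by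
  have hρ := h.hρ; have hN := h.hN; have hG := h.hG; have hρ1 := h.hρ1; have hH := h.hH
  have h1 : ρ ≤ ρ ^ α := pow_le_self_rpow hρ hρ1 hα1
  have h2 : G / (ε * ρ) ^ 2 ≤ (G + H) / (ε ^ 2 * ρ ^ 3) * ρ ^ α := by
    calc G / (ε * ρ) ^ 2 = G / (ε ^ 2 * ρ ^ 3) * ρ := by field_simp
      _ ≤ (G + H) / (ε ^ 2 * ρ ^ 3) * ρ ^ α := by gcongr; linarith
  unfold DD XX
  rw [Real.mul_rpow hε.le hρ.le]
  have h3 : 0 ≤ ρ * N * ρ ^ α := by positivity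
  nlinarith only [h2, h3]

theorem F_bound (hα0 : 0 < α) (hα1 : α < 1) (hK : 1 ≤ K) (hE : Eqn K α lam a b c S g Yg gi gij) (hε : 0 < ε) (hε1 : ε ≤ 1/2)
    (h : Loc α S g Yg gi gij z₁ ρ N G H) {Kf : ℝ} (hKf : 0 < Kf) {φ Yφ : Z d → ℝ} {φi : Fin d → Z d → ℝ}
    {φij : Fin d → Fin d → Z d → ℝ} (hφ : Cut Kf ρ z₁ φ Yφ φi φij) (r : ℝ) (hr : 0 < r) (ζ : Z d) (hζ : ζ ∈ kCyl r z₁) :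
    |LA (usy a z₁) (fun z => Yφ z * g z + φ z * Yg z)
      (fun i j z => (φij i j z * g z + φi j z * gi i z) + (φi i z * gi j z + φ z * gij i j z)) ζ
      - LA (usy a z₁) (fun z => Yφ z * g z + φ z * Yg z)
      (fun i j z => (φij i j z * g z + φi j z * gi i z) + (φi i z * gi j z + φ z * gij i j z)) z₁| ≤
      (64 * (K * (1 + 2 * d + 3 * d ^ 2)) + K * (36 * d + 1) + K + 512 * (Kf * (2 + 4 * d ^ 2 * K)))
        * XX α ε ρ N (G + H) * r ^ α := by
  have hρ := h.hρ; have hN := h.hN; have hG := h.hG; have hρ1 := h.hρ1; have hH := h.hH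
  have hD := DD_nonneg hε h
  have hDX := DD_le hα1 hε h
  have hra : 0 < r ^ α := Real.rpow_pos_of_pos hr _
  have hρa : 0 < ρ ^ α := Real.rpow_pos_of_pos hρ _
  have hρa1 : ρ ^ α ≤ 1 := Real.rpow_le_one hρ.le hρ1 hα0.le
  have hx1 : ρ * N ≤ XX α ε ρ N (G + H) := by
    unfold XX
    have : 0 ≤ ε ^ α * N := by positivity
    have : 0 ≤ (G + H) / (ε ^ 2 * ρ ^ 3) := by positivity
    linarith
  have hx2 : G + H ≤ XX α ε ρ N (G + H) := by
    have e1 : 0 ≤ ε ^ α * N := by positivity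
    have e2 : 0 ≤ ρ * N := by positivity
    have e3 : G + H ≤ (G + H) / (ε ^ 2 * ρ ^ 3) := by
      rw [le_div_iff₀ (by positivity)]
      have : ε ^ 2 * ρ ^ 3 ≤ 1 * 1 := by gcongr <;> apply pow_le_one₀ <;> linarith
      nlinarith
    unfold XX; linarith
  set X := XX α ε ρ N (G + H)
  set D := DD α ε ρ N G
  have hX : 0 ≤ X := le_trans (by positivity) hx2
  have hKp : 0 < K := by linarith
  by_cases hrρ : r ≤ ρ / 4
  · have hz : ∀ ζ ∈ kCyl ρ z₁, LA (usy a z₁) (fun z => Yφ z * g z + φ z * Yg z)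
        (fun i j z => (φij i j z * g z + φi j z * gi i z) + (φi i z * gi j z + φ z * gij i j z)) ζ =
        Yg ζ - ∑ i, ∑ j, a i j z₁ * gij i j ζ := by
      intro ζ hζ
      obtain ⟨e1, e2, e3, e4⟩ := hφ.inn ζ hζ
      simp only [LA, e1, e2, e3, e4, zero_mul, zero_add, one_mul]
      rw [usy_sum (fun i j => gij i j ζ) (fun i j => hE.kd.symm i j ζ)]
    rw [hz ζ (kCyl_mono hr.le (by linarith) _ hζ), hz z₁ (mem_kCyl_self hρ)]
    refine (small_case hα1 hK hE hε hε1 h hr hrρ hζ).trans ?_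
    gcongr
    have hD1 : D ≤ 64 * X := hDX.trans (by nlinarith)
    have s1 : K * (1 + 2 * d + 3 * d ^ 2) * D ≤ K * (1 + 2 * d + 3 * d ^ 2) * (64 * X) := by gcongr
    have s2 : K * (36 * d + 1) * ρ * N ≤ K * (36 * d + 1) * X := by
      rw [mul_assoc _ ρ N]; gcongr
    have s3 : K * (G + H) ≤ K * X := by gcongr
    have s4 : H ≤ K * H := by nlinarith
    have s5 : 0 ≤ Kf * (2 + 4 * d ^ 2 * K) * X := by positivity
    linarith only [s1, s2, s3, s4, s5]
  · have h1 := sup_case hK hE hε hε1 h hKf hφ ζ hζ.2.1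
    have h2 := sup_case hK hE hε hε1 h hKf hφ z₁ le_rfl
    refine (abs_sub _ _).trans ?_
    have h3 : ρ ^ α ≤ 4 * r ^ α := by
      calc ρ ^ α ≤ (4 * r) ^ α := Real.rpow_le_rpow hρ.le (by linarith) hα0.le
        _ = 4 ^ α * r ^ α := Real.mul_rpow (by norm_num) hr.le
        _ ≤ 4 * r ^ α := by
          gcongr
          have := Real.rpow_le_rpow_of_exponent_le (by norm_num : (1:ℝ) ≤ 4) hα1.le
          simpa using this
    have h4 : D ≤ 256 * X * r ^ α := hDX.trans (by nlinarith)
    have h5 : Kf * (2 + 4 * d ^ 2 * K) * D ≤ Kf * (2 + 4 * d ^ 2 * K) * (256 * X * r ^ α) := by gcongr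
    have h6 : 0 ≤ (64 * (K * (1 + 2 * d + 3 * d ^ 2)) + K * (36 * d + 1) + K) * X * r ^ α := by positivity
    linarith only [h1, h2, h5, h6]

theorem one_step (d : ℕ) (hd : 1 ≤ d) (hα0 : 0 < α) (hα1 : α < 1) (hK : 1 ≤ K) (hlam : 0 < lam) :
    ∃ C0 : ℝ, 0 < C0 ∧ ∀ {a : Fin d → Fin d → Z d → ℝ} {b : Fin d → Z d → ℝ} {c S g Yg : Z d → ℝ}
      {gi : Fin d → Z d → ℝ} {gij : Fin d → Fin d → Z d → ℝ}, Eqn K α lam a b c S g Yg gi gij →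
      ∀ {ε : ℝ}, 0 < ε → ε ≤ 1/2 → ∀ {z₁ : Z d} {ρ N G H : ℝ}, Loc α S g Yg gi gij z₁ ρ N G H →
      TB α g Yg gi gij z₁ ρ (C0 * XX α ε ρ N (G + H)) := by
  have hd0 : (0:ℝ) < d := by exact_mod_cast hd
  obtain ⟨Cp, hCp, pot⟩ := pot d (cM := lam / (d * K) ^ 2) (CM := 1 / lam) (by positivity) (by positivity) hα0 hα1
  obtain ⟨Kf, hKf, cut⟩ := exists_cut d
  set c5 := 64 * (K * (1 + 2 * d + 3 * d ^ 2)) + K * (36 * d + 1) + K + 512 * (Kf * (2 + 4 * d ^ 2 * K)) with hc5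
  have hc5p : 0 < c5 := by positivity
  refine ⟨CT d α * (Cp * c5), mul_pos (CT_pos hα0) (by positivity), ?_⟩
  intro a b c S g Yg gi gij hE ε hε hε1 z₁ ρ N G H h
  have hρ := h.hρ; have hN := h.hN; have hG := h.hG; have hH := h.hH
  have hX : 0 ≤ XX α ε ρ N (G + H) := by unfold XX; positivity
  obtain ⟨φ, Yφ, φi, φij, hφ⟩ := cut z₁ ρ hρ
  obtain ⟨M, hM⟩ := exists_ell hlam (by linarith : 0 < K) hd (usy a z₁) (fun i j => by simp only [usy]; ring)
    (usy_bd hE.ab) (fun ξ => by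
      have := usy_sum (a := a) (z₁ := z₁) (fun i j => ξ i * ξ j) (fun i j => mul_comm _ _)
      simp only [← mul_assoc] at this
      rw [this]
      exact hE.ell z₁ ξ)
  obtain ⟨Kc, hKc, hK0⟩ := hφ.cpt
  have main := pot (usy a z₁) M hM _ _ _ _ (hφ.kd.mul hE.kd) Kc hKc (fun z hz => by simp [hK0 z hz]) z₁ _
    (c5 * XX α ε ρ N (G + H)) (by positivity) (fun r hr ζ hζ => F_bound hα0 hα1 hK hE hε hε1 h hKf hφ r hr ζ hζ)
  have := hE.kd.telescope hα0 (N := Cp * (c5 * XX α ε ρ N (G + H))) (ρ := ρ) (by positivity) z₁ (fun r hr hrρ => by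
    obtain ⟨c, b, q, m, hm, hb⟩ := main r hr
    refine ⟨c, b, q, m, hm, fun z hz => ?_⟩
    have := hb z hz
    rw [(hφ.inn z (kCyl_mono hr.le hrρ _ hz)).1, one_mul] at this
    exact this)
  convert this using 1
  ring

end KS

namespace KS
open Filter Topology Set

theorem TB.mono {α ρ ρ' N N' : ℝ} {u Yu : Z d → ℝ} {ui : Fin d → Z d → ℝ} {uij : Fin d → Fin d → Z d → ℝ} {z : Z d}
    (h : TB α u Yu ui uij z ρ N) (hρ : ρ' ≤ ρ) (hN : N ≤ N') : TB α u Yu ui uij z ρ' N' := by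
  intro r hr hrρ z' hz'
  refine (h r hr (hrρ.trans hρ) z' hz').trans ?_
  have := Real.rpow_pos_of_pos hr (2 + α)
  gcongr

theorem exists_small {α C : ℝ} (hα : 0 < α) (hC : 0 < C) : ∃ ε : ℝ, 0 < ε ∧ ε ≤ 1/2 ∧ C * ε ^ α ≤ 1/32 := by
  have h1 : Tendsto (fun ε : ℝ => C * ε ^ α) (𝓝[>] 0) (𝓝 0) := by
    have h := ((Real.continuousAt_rpow_const 0 α (Or.inr hα.le)).tendsto).const_mul C
    rw [Real.zero_rpow hα.ne', mul_zero] at h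
    exact h.mono_left nhdsWithin_le_nhds
  have h2 := h1.eventually (gt_mem_nhds (by norm_num : (0:ℝ) < 1/32))
  have h3 : Ioc (0:ℝ) (1/2) ∈ 𝓝[>] (0:ℝ) := Ioc_mem_nhdsGT (by norm_num)
  obtain ⟨ε, he, hm⟩ := (h2.and h3).exists
  exact ⟨ε, hm.1, hm.2, he.le⟩

theorem iter (d : ℕ) (hd : 1 ≤ d) {K α lam : ℝ} (hα0 : 0 < α) (hα1 : α < 1) (hK : 1 ≤ K) (hlam : 0 < lam) :
    ∃ ρ₀ C1 : ℝ, 0 < ρ₀ ∧ 0 < C1 ∧ ∀ {a : Fin d → Fin d → Z d → ℝ} {b : Fin d → Z d → ℝ} {c S g Yg : Z d → ℝ}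
      {gi : Fin d → Z d → ℝ} {gij : Fin d → Fin d → Z d → ℝ}, Eqn K α lam a b c S g Yg gi gij →
      ∀ N₀ : ℝ, 0 ≤ N₀ → (∀ z, TB α g Yg gi gij z 1 N₀) → ∀ (zs : Z d) (G H : ℝ), 0 ≤ G → 0 ≤ H →
      (∀ z ∈ kCyl 2 zs, |g z| ≤ G) →
      (∀ z₁ ∈ kCyl 2 zs, ∀ r, 0 < r → kCyl r z₁ ⊆ kCyl 2 zs → ∀ z ∈ kCyl r z₁, |S z - S z₁| ≤ H * r ^ α) →
      ∀ z ∈ kCyl 1 zs, TB α g Yg gi gij z ρ₀ (C1 * (G + H)) := by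
  obtain ⟨C0, hC0, step⟩ := one_step (α := α) (K := K) (lam := lam) d hd hα0 hα1 hK hlam
  obtain ⟨ε, hε, hε1, hεC⟩ := exists_small hα0 hC0
  obtain ⟨ρ₀, hρ₀, hρ6, hρC⟩ : ∃ ρ₀ : ℝ, 0 < ρ₀ ∧ ρ₀ ≤ 1/6 ∧ C0 * ρ₀ ≤ 1/32 := by
    refine ⟨min (1/6) (1/(32*C0)), by positivity, min_le_left _ _, ?_⟩
    calc C0 * min (1/6) (1/(32*C0)) ≤ C0 * (1/(32*C0)) := by gcongr; exact min_le_right _ _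
      _ = 1/32 := by field_simp
  refine ⟨ρ₀, 2 * (C0 / (ε ^ 2 * ρ₀ ^ 3)), hρ₀, by positivity, ?_⟩
  intro a b c S g Yg gi gij hE N₀ hN₀ hT zs G H hG hH hg hS
  set C1 := C0 / (ε ^ 2 * ρ₀ ^ 3) with hC1
  have hC1p : 0 < C1 := by positivity
  have claim : ∀ n k : ℕ, ∀ z ∈ kCyl (2 - 1 / 2 ^ k) zs,
      TB α g Yg gi gij z (ρ₀ / 2 ^ k) (N₀ / 16 ^ n + 2 * C1 * 8 ^ k * (G + H)) := by
    intro n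
    induction n with
    | zero =>
      intro k z _
      refine (hT z).mono ?_ ?_
      · rw [div_le_one (by positivity)]
        have : (1:ℝ) ≤ 2 ^ k := one_le_pow₀ (by norm_num)
        linarith
      · have : 0 ≤ 2 * C1 * 8 ^ k * (G + H) := by positivity
        simp; linarith
    | succ n ih =>
      intro k z hz
      set N := N₀ / 16 ^ n + 2 * C1 * 8 ^ (k+1) * (G + H) with hN
      have hNp : 0 ≤ N := by positivity
      set p : ℝ := 1 / 2 ^ k with hp
      have hp0 : 0 < p := by positivity
      have hp1 : p ≤ 1 := by
        rw [hp, div_le_one (by positivity)]; exact one_le_pow₀ (by norm_num)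
      have hpk : (1:ℝ) / 2 ^ (k+1) = p / 2 := by rw [hp, pow_succ]; field_simp
      have hρk : ρ₀ / 2 ^ k = ρ₀ * p := by rw [hp]; ring
      have hρk1 : ρ₀ / 2 ^ (k+1) = ρ₀ * p / 2 := by rw [hp, pow_succ]; field_simp
      have hρp : 0 < ρ₀ * p := by positivity
      have hρp6 : ρ₀ * p ≤ 1/6 * p := by gcongr
      have sub : ∀ m : ℝ, 0 < m → m ≤ 3 → kCyl (m * (ρ₀ * p)) z ⊆ kCyl (2 - p/2) zs := fun m hm hm3 =>
        (kCyl_sub (by linarith) (by positivity) hz).trans (kCyl_mono (by nlinarith) (by nlinarith) _)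
      have sub2 : kCyl (2 - p/2) zs ⊆ kCyl 2 zs := kCyl_mono (by linarith) (by linarith) _
      have loc : Loc α S g Yg gi gij z (ρ₀ * p) N G H := by
        refine ⟨hρp, by linarith, hNp, hG, hH, fun y hy => ?_, fun y hy => hg y (sub2 (sub 3 (by norm_num) le_rfl hy)), ?_⟩
        · have := ih (k+1) y (by rw [hpk]; exact sub 2 (by norm_num) (by norm_num) hy)
          rwa [hρk1] at this
        · intro r hr hrρ y hy
          have h1 : kCyl r z ⊆ kCyl 2 zs :=
            ((kCyl_mono hr.le (by linarith) z).trans (sub 1 one_pos (by norm_num))).trans sub2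
          exact hS z (h1 (mem_kCyl_self hr)) r hr h1 y hy
      rw [hρk]
      refine (step hE hε hε1 loc).mono le_rfl ?_
      have e1 : C0 * ε ^ α * N ≤ 1/32 * N := by gcongr
      have e2 : C0 * (ρ₀ * p) * N ≤ 1/32 * N := by
        gcongr
        exact le_trans (by gcongr; nlinarith) hρC
      have e3 : C0 * ((G + H) / (ε ^ 2 * (ρ₀ * p) ^ 3)) = C1 * 8 ^ k * (G + H) := by
        have : (8:ℝ) ^ k = (2 ^ k) ^ 3 := by rw [← pow_mul, mul_comm, pow_mul]; norm_num
        rw [this, hp, hC1]; field_simp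
      have e4 : N / 16 = N₀ / 16 ^ (n+1) + C1 * 8 ^ k * (G + H) := by
        rw [hN, pow_succ, pow_succ]; ring
      unfold XX
      linarith only [e1, e2, e3, e4]
  intro z hz r hr hrρ z' hz'
  have hlim : Tendsto (fun n : ℕ => (N₀ / 16 ^ n + 2 * C1 * (G + H)) * r ^ (2 + α)) atTop
      (𝓝 ((0 + 2 * C1 * (G + H)) * r ^ (2 + α))) := by
    refine Tendsto.mul_const _ (Tendsto.add_const _ ?_)
    exact tendsto_const_nhds.div_atTop (tendsto_pow_atTop_atTop_of_one_lt (by norm_num))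
  rw [zero_add] at hlim
  refine ge_of_tendsto' hlim fun n => ?_
  have := claim n 0 z (by norm_num; exact hz) r hr (by simpa using hrρ) z' hz'
  simpa using this

theorem holder_of {α : ℝ} {Q : Set (Z d)} {f : Z d → ℝ} {H : ℝ} (hH : 0 ≤ H) (h : kHolder α Q f ≤ ENNReal.ofReal H)
    {z₁ : Z d} (hz₁ : z₁ ∈ Q) {r : ℝ} (hr : 0 < r) (hs : kCyl r z₁ ⊆ Q) {z : Z d} (hz : z ∈ kCyl r z₁) :
    |f z - f z₁| ≤ H * r ^ α := by
  simp only [kHolder, iSup_le_iff] at h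
  have := h z₁ hz₁ r hr hs z hz
  rw [ENNReal.ofReal_le_ofReal_iff hH, div_le_iff₀ (Real.rpow_pos_of_pos hr _)] at this
  exact this

theorem sup_of {Q : Set (Z d)} {f : Z d → ℝ} {G : ℝ} (hG : 0 ≤ G) (h : supAbs Q f ≤ ENNReal.ofReal G)
    {z : Z d} (hz : z ∈ Q) : |f z| ≤ G := by
  simp only [supAbs, iSup_le_iff] at h
  have := h z hz
  rwa [ENNReal.ofReal_le_ofReal_iff hG] at this

theorem coef_of {α Ka K : ℝ} {f : Z d → ℝ} (hK : 0 ≤ K) (hKa : Ka ≤ K)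
    (h : supAbs Set.univ f + kHolder α Set.univ f ≤ ENNReal.ofReal Ka) :
    (∀ z, |f z| ≤ K) ∧ ∀ r, 0 < r → ∀ z₁, ∀ z ∈ kCyl r z₁, |f z - f z₁| ≤ K * r ^ α := by
  have h' := h.trans (ENNReal.ofReal_le_ofReal hKa)
  exact ⟨fun z => sup_of hK (le_self_add.trans h') (mem_univ z), fun r hr z₁ z hz =>
    holder_of hK (le_add_self.trans h') (mem_univ z₁) hr (subset_univ _) hz⟩

theorem apriori {α : ℝ} (hα0 : 0 < α) {g Yg : Z d → ℝ} {gi : Fin d → Z d → ℝ} {gij : Fin d → Fin d → Z d → ℝ}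
    (hg : KD g Yg gi gij) (h : kSemi2 α Set.univ g < ⊤) : ∃ N, 0 ≤ N ∧ ∀ z, TB α g Yg gi gij z 1 N := by
  set s := (kSemi2 α Set.univ g).toReal with hs
  have hs0 : 0 ≤ s := ENNReal.toReal_nonneg
  have hle : kSemi2 α Set.univ g ≤ ENNReal.ofReal s := by rw [hs, ENNReal.ofReal_toReal h.ne]
  refine ⟨CT d α * (s + 1), mul_nonneg (CT_pos hα0).le (by linarith), fun z => hg.telescope hα0 (by linarith) z ?_⟩
  intro r hr _
  simp only [kSemi2, iSup_le_iff] at hle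
  have h1 := hle z (mem_univ z) r hr (subset_univ _)
  have hrp : 0 < r ^ (2 + α) := Real.rpow_pos_of_pos hr _
  rw [ENNReal.div_le_iff (by simpa using hrp) ENNReal.ofReal_ne_top, ← ENNReal.ofReal_mul hs0] at h1
  have h2 : ENNReal.ofReal (s * r ^ (2 + α)) < ENNReal.ofReal ((s + 1) * r ^ (2 + α)) := by
    rw [ENNReal.ofReal_lt_ofReal_iff (by positivity)]; nlinarith
  have h3 := h1.trans_lt h2
  simp only [iInf_lt_iff] at h3
  obtain ⟨a, b, q, M, h4⟩ := h3
  refine ⟨kpoly a b q M z, b, fun i => q i + ∑ j, (M i j + M j i) / 2 * z.2.2 j,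
    fun i j => (M i j + M j i) / 2, fun i j => by ring, fun y hy => ?_⟩
  · rw [← kpoly_eq_tay a b q M z y]
    have h5 := h4.le
    simp only [iSup_le_iff] at h5
    have := h5 y hy
    rwa [ENNReal.ofReal_le_ofReal_iff (by positivity)] at this

theorem semi_of {α ρ₀ D G : ℝ} (hα0 : 0 < α) (hρ₀ : 0 < ρ₀) {g Yg : Z d → ℝ} {gi : Fin d → Z d → ℝ} {gij : Fin d → Fin d → Z d → ℝ}
    (hg : KD g Yg gi gij) {Q : Set (Z d)} (hT : ∀ z ∈ Q, TB α g Yg gi gij z ρ₀ D) (hD : 0 ≤ D) (hG : 0 ≤ G)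
    (hb : ∀ z ∈ Q, |g z| ≤ G) : kSemi2 α Q g ≤ ENNReal.ofReal (D + G / ρ₀ ^ (2 + α)) := by
  simp only [kSemi2, iSup_le_iff]
  intro z hz r hr hs
  have hrp : 0 < r ^ (2 + α) := Real.rpow_pos_of_pos hr _
  have hρp : 0 < ρ₀ ^ (2 + α) := Real.rpow_pos_of_pos hρ₀ _
  rw [ENNReal.div_le_iff (by simpa using hrp) ENNReal.ofReal_ne_top, ← ENNReal.ofReal_mul (by positivity)]
  have key : ∃ a b q M, ∀ y ∈ kCyl r z, |g y - kpoly a b q M y| ≤ (D + G / ρ₀ ^ (2 + α)) * r ^ (2 + α) := by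
    by_cases h : r ≤ ρ₀
    · obtain ⟨a, b, q, M, hk⟩ := tay_eq_kpoly (g z) (Yg z) (fun i => gi i z) (m := fun i j => gij i j z)
        (fun i j => hg.symm i j z) z
      refine ⟨a, b, q, M, fun y hy => ?_⟩
      rw [← hk]
      refine (hT z hz r hr h y hy).trans ?_
      gcongr
      have : 0 ≤ G / ρ₀ ^ (2 + α) := by positivity
      linarith
    · refine ⟨0, 0, 0, 0, fun y hy => ?_⟩
      have h0 : kpoly (d := d) 0 0 0 0 y = 0 := by simp [kpoly]
      rw [h0, sub_zero]
      have e1 : ρ₀ ^ (2 + α) ≤ r ^ (2 + α) := Real.rpow_le_rpow hρ₀.le (not_le.1 h).le (by linarith)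
      calc |g y| ≤ G := hb y (hs hy)
        _ = G / ρ₀ ^ (2 + α) * ρ₀ ^ (2 + α) := by field_simp
        _ ≤ (D + G / ρ₀ ^ (2 + α)) * r ^ (2 + α) := by gcongr; linarith
  obtain ⟨a, b, q, M, hk⟩ := key
  refine iInf_le_of_le a (iInf_le_of_le b (iInf_le_of_le q (iInf_le_of_le M ?_)))
  simp only [iSup_le_iff]
  exact fun y hy => ENNReal.ofReal_le_ofReal (hk y hy)

end KS

/-- **Local Schauder estimate** for linear kinetic Fokker–Planck equations with Hölder
continuous coefficients: `‖g‖_{L^∞(Q₁(z₀))} + [g]_{C_ℓ^{2+α}(Q₁(z₀))}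
≤ C ([S]_{C_ℓ^α(Q₂(z₀))} + ‖g‖_{L^∞(Q₂(z₀))})`, where `C` depends only on `d`, `λ`, `α`
and upper bounds `Ka, Kb, Kc` for the `C_ℓ^α` norms of the coefficients. -/
theorem local_schauder_estimate
    (d : ℕ) (hd : 1 ≤ d) (α lam Ka Kb Kc : ℝ)
    (hα0 : 0 < α) (hα1 : α < 1) (hlam : 0 < lam) :
    ∃ C : ℝ, 0 < C ∧
      ∀ (a : Fin d → Fin d → Z d → ℝ) (b : Fin d → Z d → ℝ) (c S g : Z d → ℝ),
        (∀ i j, supAbs Set.univ (a i j) + kHolder α Set.univ (a i j)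
            ≤ ENNReal.ofReal Ka) →
        (∀ i, supAbs Set.univ (b i) + kHolder α Set.univ (b i) ≤ ENNReal.ofReal Kb) →
        (supAbs Set.univ c + kHolder α Set.univ c ≤ ENNReal.ofReal Kc) →
        (supAbs Set.univ S + kHolder α Set.univ S < ⊤) →
        (∀ z : Z d, ∀ ξ : E d, lam * ‖ξ‖ ^ 2 ≤ ∑ i, ∑ j, a i j z * ξ i * ξ j) →
        KinReg g Set.univ →
        (∀ z : Z d, Yop g z =
          ∑ i, ∑ j, a i j z * pvv g i j z + ∑ i, b i z * pv g i z + c z * g z + S z) →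
        kSemi2 α Set.univ g < ⊤ →
        ∀ z₀ : Z d,
          supAbs (kCyl 1 z₀) g + kSemi2 α (kCyl 1 z₀) g
            ≤ ENNReal.ofReal C * (kHolder α (kCyl 2 z₀) S + supAbs (kCyl 2 z₀) g) := by
  obtain ⟨ρ₀, C1, hρ₀, hC1, it⟩ := KS.iter d hd (K := max 1 (max Ka (max Kb Kc))) hα0 hα1 (le_max_left _ _) hlam
  have hρp : 0 < ρ₀ ^ (2 + α) := Real.rpow_pos_of_pos hρ₀ _
  have hCp : 0 < 1 + (C1 + 1 / ρ₀ ^ (2 + α)) := by positivity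
  refine ⟨1 + (C1 + 1 / ρ₀ ^ (2 + α)), hCp, ?_⟩
  intro a b c S g ha hb hc _ hell hreg heq hsemi z₀
  by_cases htop : kHolder α (kCyl 2 z₀) S + supAbs (kCyl 2 z₀) g = ⊤
  · rw [htop, ENNReal.mul_top (by simpa using hCp)]
    exact le_top
  obtain ⟨hH, hG⟩ := ENNReal.add_ne_top.1 htop
  have hkd := KS.KinReg.toKD hreg
  have hK0 : (0:ℝ) ≤ max 1 (max Ka (max Kb Kc)) := le_trans zero_le_one (le_max_left _ _)
  have ka := fun i j => KS.coef_of hK0 ((le_max_left _ _).trans (le_max_right _ _)) (ha i j)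
  have kb := fun i => KS.coef_of hK0 (((le_max_left _ _).trans (le_max_right _ _)).trans (le_max_right _ _)) (hb i)
  have kc := KS.coef_of hK0 (((le_max_right _ _).trans (le_max_right _ _)).trans (le_max_right _ _)) hc
  have hE : KS.Eqn (max 1 (max Ka (max Kb Kc))) α lam a b c S g (Yop g) (pv g) (pvv g) :=
    ⟨hkd, fun i j => (ka i j).1, fun i j => (ka i j).2, fun i => (kb i).1, fun i => (kb i).2, kc.1, kc.2, hell, heq⟩
  obtain ⟨N₀, hN₀, hT⟩ := KS.apriori hα0 hkd hsemi
  set H := (kHolder α (kCyl 2 z₀) S).toReal with hHdef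
  set G := (supAbs (kCyl 2 z₀) g).toReal with hGdef
  have hH0 : 0 ≤ H := ENNReal.toReal_nonneg
  have hG0 : 0 ≤ G := ENNReal.toReal_nonneg
  have eH : kHolder α (kCyl 2 z₀) S = ENNReal.ofReal H := (ENNReal.ofReal_toReal hH).symm
  have eG : supAbs (kCyl 2 z₀) g = ENNReal.ofReal G := (ENNReal.ofReal_toReal hG).symm
  have gb : ∀ z ∈ kCyl 2 z₀, |g z| ≤ G := fun z hz => KS.sup_of hG0 eG.le hz
  have main := it hE N₀ hN₀ hT z₀ G H hG0 hH0 gb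
    (fun z₁ hz₁ r hr hs z hz => KS.holder_of hH0 eH.le hz₁ hr hs hz)
  have hsub : kCyl 1 z₀ ⊆ kCyl 2 z₀ := KS.kCyl_mono zero_le_one one_le_two z₀
  have h1 : supAbs (kCyl 1 z₀) g ≤ ENNReal.ofReal G := by
    simp only [supAbs, iSup_le_iff]
    exact fun z hz => ENNReal.ofReal_le_ofReal (gb z (hsub hz))
  have h2 := KS.semi_of hα0 hρ₀ hkd main (by positivity) hG0 (fun z hz => gb z (hsub hz))
  rw [eH, eG, ← ENNReal.ofReal_add hH0 hG0, ← ENNReal.ofReal_mul hCp.le]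
  refine (add_le_add h1 h2).trans ?_
  rw [← ENNReal.ofReal_add hG0 (by positivity)]
  refine ENNReal.ofReal_le_ofReal ?_
  have e1 : G / ρ₀ ^ (2 + α) = 1 / ρ₀ ^ (2 + α) * G := by ring
  have e2 : 0 ≤ 1 / ρ₀ ^ (2 + α) * H := by positivity
  rw [e1]
  linarith only [e2, hH0]
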